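/- arXiv:1409.0846 — 3 statements merged into one kernel-verified Lean document; each statement's English description precedes it below -/
import Mathlib

section
/- Let p be a prime and k the algebraic closure of F_p. Let F_1,…,F_m ∈ k[t][x] with deg_x F_i > 0 be pairwise non-associate irreducible polynomials, separable over k(t), not necessarily monic in x. Set F = ∏_{i=1}^m F_i and let C be the affine plane curve over k defined by F(t,x) = 0. Let n ≥ 3 be a natural number with n > #{P ∈ C(k) : m_P > 2}. Let a_0,…,a_n be algebraically independent variables, f♯ = Σ_{j=0}^n a_j t^j, and N_i = deg_t F_i(t, f♯). Assume p > max_{1≤i≤m} N_i. Let L be the splitting field of F(t, f♯) over k(a_0,…,a_n) and G = Gal(L/k(a_0,…,a_n)), viewed as a subgroup of S_{N_1}×…×S_{N_m} via its action on the roots of the F_i(t, f♯). Then G = S_{N_1}×…×S_{N_m}. -/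
open Polynomial

/-- The generic polynomial `f♯ = Σ_{j=0}^n a_j t^j`. -/
noncomputable def fsharp (K : Type) [CommRing K] (n : ℕ) :
    Polynomial (MvPolynomial (Fin (n + 1)) K) :=
  ∑ j : Fin (n + 1), Polynomial.C (MvPolynomial.X j) * Polynomial.X ^ (j : ℕ)

/-- For `F ∈ K[t][x]` (with `x` the outer variable), the substitution
`F(t, f♯) ∈ K[a_0,…,a_n][t]`. -/
noncomputable def substF {K : Type} [CommRing K] (n : ℕ)
    (F : Polynomial (Polynomial K)) :
    Polynomial (MvPolynomial (Fin (n + 1)) K) :=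
  Polynomial.eval (fsharp K n) (F.map (Polynomial.mapRingHom MvPolynomial.C))

/-- The multiplicity of the point `(τ, ξ)` on the affine plane curve `F(t,x) = 0`:
the lowest total degree of a monomial of the Taylor expansion of `F` at `(τ, ξ)`. -/
noncomputable def multAt {K : Type} [Field K] (F : Polynomial (Polynomial K)) (τ ξ : K) : ℕ :=
  sInf {d : ℕ | ∃ j l, j + l = d ∧
    (((F.map (Polynomial.aeval (Polynomial.X + Polynomial.C τ) :
          Polynomial K →ₐ[K] Polynomial K).toRingHom).comp
        (Polynomial.X + Polynomial.C (Polynomial.C ξ))).coeff j).coeff l ≠ 0}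

/-- Hensel lifting without the monic hypothesis. -/
theorem hensel_nonmonic {R : Type*} [CommRing R] (I : Ideal R) [IsAdicComplete I R]
    (f : R[X]) (a₀ : R) (h₁ : f.eval a₀ ∈ I)
    (h₂ : IsUnit (Ideal.Quotient.mk I (f.derivative.eval a₀))) :
    ∃ a : R, f.IsRoot a ∧ a - a₀ ∈ I := by
  classical
    let f' := derivative f
    let c : ℕ → R := fun n => Nat.recOn n a₀ fun _ b => b - f.eval b * Ring.inverse (f'.eval b)
    have hc : ∀ n, c (n + 1) = c n - f.eval (c n) * Ring.inverse (f'.eval (c n)) := by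
      intro n
      simp only [c]
    have hc_mod : ∀ n, c n ≡ a₀ [SMOD I] := by
      intro n
      induction n with
      | zero => rfl
      | succ n ih => ?_
      rw [hc, sub_eq_add_neg, ← add_zero a₀]
      refine ih.add ?_
      rw [SModEq.zero, Ideal.neg_mem_iff]
      refine I.mul_mem_right _ ?_
      rw [← SModEq.zero] at h₁ ⊢
      exact (ih.eval f).trans h₁
    have hf'c : ∀ n, IsUnit (f'.eval (c n)) := by
      intro n
      have := isLocalHom_of_le_jacobson_bot I (IsAdicComplete.le_jacobson_bot I)
      apply IsUnit.of_map (Ideal.Quotient.mk I)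
      convert! h₂ using 1
      exact SModEq.def.mp ((hc_mod n).eval _)
    have hfcI : ∀ n, f.eval (c n) ∈ I ^ (n + 1) := by
      intro n
      induction n with
      | zero => simpa only [Nat.rec_zero, zero_add, pow_one] using! h₁
      | succ n ih => ?_
      rw [← taylor_eval_sub (c n), hc, sub_eq_add_neg, sub_eq_add_neg,
        add_neg_cancel_comm]
      rw [eval_eq_sum, sum_over_range' _ _ _ (lt_add_of_pos_right _ zero_lt_two), ←
        Finset.sum_range_add_sum_Ico _ (Nat.le_add_left _ _)]
      swap
      · intro i
        rw [zero_mul]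
      refine Ideal.add_mem _ ?_ ?_
      · rw [← one_add_one_eq_two, Finset.sum_range_succ, Finset.range_one, Finset.sum_singleton,
          taylor_coeff_zero, taylor_coeff_one, pow_zero, pow_one, mul_one, mul_neg,
          mul_left_comm, Ring.mul_inverse_cancel _ (hf'c n), mul_one, add_neg_cancel]
        exact Ideal.zero_mem _
      · refine Submodule.sum_mem _ ?_
        simp only [Finset.mem_Ico]
        rintro i ⟨h2i, _⟩
        have aux : n + 2 ≤ i * (n + 1) := by trans 2 * (n + 1) <;> nlinarith only [h2i]
        refine Ideal.mul_mem_left _ _ (Ideal.pow_le_pow_right aux ?_)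
        rw [pow_mul']
        exact Ideal.pow_mem_pow ((Ideal.neg_mem_iff _).2 <| Ideal.mul_mem_right _ _ ih) _
    have aux : ∀ m n, m ≤ n → c m ≡ c n [SMOD (I ^ m • ⊤ : Ideal R)] := by
      intro m n hmn
      rw [← Ideal.one_eq_top, Ideal.smul_eq_mul, mul_one]
      obtain ⟨k, rfl⟩ := Nat.exists_eq_add_of_le hmn
      clear hmn
      induction k with
      | zero => rw [add_zero]
      | succ k ih => ?_
      rw [← add_assoc, hc, ← add_zero (c m), sub_eq_add_neg]
      refine ih.add ?_
      symm
      rw [SModEq.zero, Ideal.neg_mem_iff]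
      refine Ideal.mul_mem_right _ _ (Ideal.pow_le_pow_right ?_ (hfcI _))
      rw [add_assoc]
      exact le_self_add
    obtain ⟨a, ha⟩ := IsPrecomplete.prec' c (aux _ _)
    refine ⟨a, ?_, ?_⟩
    · show f.IsRoot a
      suffices ∀ n, f.eval a ≡ 0 [SMOD (I ^ n • ⊤ : Ideal R)] by exact IsHausdorff.haus' _ this
      intro n
      specialize ha n
      rw [← Ideal.one_eq_top, Ideal.smul_eq_mul, mul_one] at ha ⊢
      refine (ha.symm.eval f).trans ?_
      rw [SModEq.zero]
      exact Ideal.pow_le_pow_right le_self_add (hfcI _)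
    · show a - a₀ ∈ I
      specialize ha (0 + 1)
      rw [hc, pow_one, ← Ideal.one_eq_top, Ideal.smul_eq_mul, mul_one, sub_eq_add_neg] at ha
      rw [← SModEq.sub_mem, ← add_zero a₀]
      refine ha.symm.trans (SModEq.rfl.add ?_)
      rw [SModEq.zero, Ideal.neg_mem_iff]
      exact Ideal.mul_mem_right _ _ h₁

theorem ps_hensel {W : Type*} [Field W] (P : (PowerSeries W)[X]) (z : W)
    (h0 : (P.map PowerSeries.constantCoeff).eval z = 0)
    (h1 : (P.map PowerSeries.constantCoeff).derivative.eval z ≠ 0) :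
    ∃ r : PowerSeries W, P.eval r = 0 ∧ PowerSeries.constantCoeff r = z := by
  have key : ∀ (Q : (PowerSeries W)[X]) (a : PowerSeries W),
      PowerSeries.constantCoeff (Q.eval a)
        = (Q.map PowerSeries.constantCoeff).eval (PowerSeries.constantCoeff a) := by
    intro Q a
    rw [Polynomial.eval_map, Polynomial.eval₂_hom]
  obtain ⟨r, hr, hr'⟩ := hensel_nonmonic (Ideal.span {(PowerSeries.X : PowerSeries W)}) P
    (PowerSeries.C z) (by
      rw [Ideal.mem_span_singleton, PowerSeries.X_dvd_iff, key]; simpa using h0) (by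
      apply IsUnit.map
      rw [PowerSeries.isUnit_iff_constantCoeff, key, isUnit_iff_ne_zero, ← derivative_map]
      simpa using h1)
  refine ⟨r, hr, ?_⟩
  rw [Ideal.mem_span_singleton, PowerSeries.X_dvd_iff, map_sub, sub_eq_zero] at hr'
  simpa using hr'

theorem ps_hensel_unique {W : Type*} [Field W] (P : (PowerSeries W)[X])
    (r r' : PowerSeries W) (hr : P.eval r = 0) (hr' : P.eval r' = 0)
    (h : PowerSeries.constantCoeff r = PowerSeries.constantCoeff r')
    (h1 : (P.map PowerSeries.constantCoeff).derivative.eval (PowerSeries.constantCoeff r) ≠ 0) :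
    r = r' := by
  refine IsLocalRing.eq_of_eval_eq_zero_of_not_isUnit_sub hr hr' ?_ ?_
  · rw [PowerSeries.isUnit_iff_constantCoeff, map_sub, h, sub_self]; simp
  · rw [PowerSeries.isUnit_iff_constantCoeff, isUnit_iff_ne_zero]
    rw [derivative_map, Polynomial.eval_map, Polynomial.eval₂_hom] at h1
    exact h1

theorem sep_deriv_ne {W : Type*} [Field W] (q : W[X]) (hq : q.Separable) (z : W)
    (hz : q.eval z = 0) : q.derivative.eval z ≠ 0 := by
  have := hq.eval₂_derivative_ne_zero (RingHom.id W) (x := z) (by simpa [eval₂_id] using hz)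
  simpa [eval₂_id] using this

theorem card_roots_of_finset {A : Type*} [CommRing A] [IsDomain A] (P : A[X]) (hP : P ≠ 0)
    (S : Finset A) (hS : ∀ r ∈ S, P.eval r = 0) (hc : P.natDegree ≤ S.card) :
    P.roots.card = P.natDegree := by
  classical
  apply le_antisymm (card_roots' P)
  refine hc.trans ?_
  rw [Finset.card_def]
  apply Multiset.card_le_card
  rw [Finset.val_le_iff_val_subset]
  intro r hr
  rw [mem_roots hP]
  exact hS r hr

/-- Splitting when the reduction is separable. -/
theorem ps_split_one {W : Type*} [Field W] (P : (PowerSeries W)[X])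
    (hdeg : P.natDegree = (P.map PowerSeries.constantCoeff).natDegree)
    (hsep : (P.map PowerSeries.constantCoeff).Separable)
    (hspl : (P.map PowerSeries.constantCoeff).Splits) :
    P.roots.card = P.natDegree := by
  classical
  set Pb := P.map PowerSeries.constantCoeff with hPb
  have h0 : Pb ≠ 0 := hsep.ne_zero
  have hP : P ≠ 0 := by rintro rfl; simp [hPb] at h0
  have hl : ∀ z : W, ∃ r : PowerSeries W, Pb.eval z = 0 →
      P.eval r = 0 ∧ PowerSeries.constantCoeff r = z := by
    intro z
    by_cases hz : Pb.eval z = 0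
    · obtain ⟨r, hr⟩ := ps_hensel P z hz (sep_deriv_ne _ hsep z hz)
      exact ⟨r, fun _ => hr⟩
    · exact ⟨0, fun h => absurd h hz⟩
  choose l hl using hl
  refine card_roots_of_finset P hP (Pb.roots.toFinset.image l) ?_ ?_
  · intro r hr
    simp only [Finset.mem_image, Multiset.mem_toFinset, mem_roots h0] at hr
    obtain ⟨z, hz, rfl⟩ := hr
    exact (hl z hz).1
  · rw [Finset.card_image_of_injOn, Multiset.toFinset_card_of_nodup (nodup_roots hsep), hdeg,
      splits_iff_card_roots.1 hspl]
    intro a ha b hb hab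
    simp only [Finset.mem_coe, Multiset.mem_toFinset, mem_roots h0] at ha hb
    rw [← (hl a ha).2, ← (hl b hb).2]
    exact congrArg _ hab

/-- Splitting when the reduction has exactly one double root. -/
theorem ps_split_two {W : Type*} [Field W] (h2 : (2 : W) ≠ 0)
    (P P1 : (PowerSeries W)[X]) (q : W[X]) (τ v : W)
    (hP : P = ((X - C τ) ^ 2 * q).map PowerSeries.C + C (PowerSeries.X ^ 2) * P1)
    (hdeg : P.natDegree = ((X - C τ) ^ 2 * q).natDegree)
    (hsep : q.Separable) (hspl : q.Splits) (hqτ : q.eval τ ≠ 0)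
    (hv : v ≠ 0)
    (hP1 : PowerSeries.constantCoeff (P1.eval (PowerSeries.C τ)) = - (q.eval τ * v ^ 2)) :
    P.roots.card = P.natDegree ∧
    ∃ r₁ r₂ : PowerSeries W, P.eval r₁ = 0 ∧ P.eval r₂ = 0 ∧
      PowerSeries.constantCoeff r₁ = τ ∧ PowerSeries.constantCoeff r₂ = τ ∧
      PowerSeries.coeff 1 r₁ = v ∧ PowerSeries.coeff 1 r₂ = - v ∧
      (∀ r, P.eval r = 0 → PowerSeries.constantCoeff r = τ → r = r₁ ∨ r = r₂) := by
  classical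
  have hPb : P.map PowerSeries.constantCoeff = (X - C τ) ^ 2 * q := by
    rw [hP, Polynomial.map_add, Polynomial.map_map, Polynomial.map_mul (PowerSeries.constantCoeff),
      Polynomial.map_C]
    have : (PowerSeries.constantCoeff (R := W)).comp PowerSeries.C = RingHom.id W := by
      ext x; simp
    rw [this]; simp
  have hq0 : q ≠ 0 := hsep.ne_zero
  have hPb0 : (X - C τ) ^ 2 * q ≠ 0 := mul_ne_zero (pow_ne_zero _ (X_sub_C_ne_zero τ)) hq0
  have hP0 : P ≠ 0 := by
    intro h
    rw [h, Polynomial.map_zero] at hPb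
    exact hPb0 hPb.symm
  -- the blown up polynomial
  let A := PowerSeries W
  let lin : A[X] := C (PowerSeries.C τ) + C PowerSeries.X * X
  let Q : A[X] := X ^ 2 * (q.map PowerSeries.C).comp lin + P1.comp lin
  have hQ : ∀ u : A, P.eval (PowerSeries.C τ + PowerSeries.X * u)
      = PowerSeries.X ^ 2 * Q.eval u := by
    intro u
    simp only [hP, Q, lin, eval_add, eval_mul, eval_pow, eval_comp, Polynomial.map_mul,
      Polynomial.map_pow, Polynomial.map_sub, map_X, map_C, eval_sub, eval_X, eval_C]
    ring
  have hlin : (lin.map PowerSeries.constantCoeff) = C τ := by simp [lin]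
  have hQb : Q.map PowerSeries.constantCoeff = C (q.eval τ) * (X ^ 2 - C (v ^ 2)) := by
    simp only [Q, Polynomial.map_add, Polynomial.map_mul, Polynomial.map_pow, map_X,
      Polynomial.map_comp, hlin, comp_C, Polynomial.map_map]
    have : (PowerSeries.constantCoeff (R := W)).comp PowerSeries.C = RingHom.id W := by
      ext x; simp
    rw [this, Polynomial.map_id]
    have h3 : (P1.map PowerSeries.constantCoeff).eval τ = - (q.eval τ * v ^ 2) := by
      rw [← hP1, ← Polynomial.eval₂_hom, Polynomial.eval_map]; simp
    rw [h3]
    simp only [map_neg, map_mul]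
    ring
  have hroot : ∀ w : W, w ^ 2 = v ^ 2 → w ≠ 0 → ∃ r : A, P.eval r = 0 ∧
      PowerSeries.constantCoeff r = τ ∧ PowerSeries.coeff 1 r = w := by
    intro w hw hw0
    obtain ⟨u, hu, hu'⟩ := ps_hensel Q w (by rw [hQb]; simp [hw]) (by
      rw [hQb]
      have : (C (q.eval τ) * (X ^ 2 - C (v ^ 2))).derivative.eval w = q.eval τ * (2 * w) := by
        rw [derivative_mul, derivative_sub, derivative_C, derivative_C, derivative_X_pow]
        simp
      rw [this]
      exact mul_ne_zero hqτ (mul_ne_zero h2 hw0))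
    refine ⟨PowerSeries.C τ + PowerSeries.X * u, by rw [hQ, hu, mul_zero], by simp, ?_⟩
    rw [map_add, mul_comm, show (1 : ℕ) = 0 + 1 from rfl, PowerSeries.coeff_succ_mul_X]
    simpa [PowerSeries.coeff_C] using hu'
  obtain ⟨r₁, h11, h12, h13⟩ := hroot v rfl hv
  obtain ⟨r₂, h21, h22, h23⟩ := hroot (-v) (by ring) (neg_ne_zero.2 hv)
  have hl : ∀ z : W, ∃ r : PowerSeries W, q.eval z = 0 →
      P.eval r = 0 ∧ PowerSeries.constantCoeff r = z := by
    intro z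
    by_cases hz : q.eval z = 0
    · have hzτ : z - τ ≠ 0 := by
        intro h; rw [sub_eq_zero] at h; rw [h] at hz; exact hqτ hz
      obtain ⟨r, hr⟩ := ps_hensel P z (by rw [hPb]; simp [hz]) (by
        rw [hPb]
        have := sep_deriv_ne _ hsep z hz
        simp [derivative_mul, hz, this, hzτ])
      exact ⟨r, fun _ => hr⟩
    · exact ⟨0, fun h => absurd h hz⟩
  choose l hl using hl
  have h12ne : r₁ ≠ r₂ := by
    intro h
    rw [h, h23] at h13
    apply h2
    have : 2 * v = 0 := by linear_combination -h13
    exact (mul_eq_zero.1 this).resolve_right hv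
  have hS : ∀ r ∈ q.roots.toFinset.image l, P.eval r = 0 ∧ PowerSeries.constantCoeff r ≠ τ := by
    intro r hr
    simp only [Finset.mem_image, Multiset.mem_toFinset, mem_roots hq0] at hr
    obtain ⟨z, hz, rfl⟩ := hr
    refine ⟨(hl z hz).1, ?_⟩
    rw [(hl z hz).2]
    rintro rfl
    exact hqτ hz
  have hcard : (q.roots.toFinset.image l).card = q.natDegree := by
    rw [Finset.card_image_of_injOn, Multiset.toFinset_card_of_nodup (nodup_roots hsep),
      splits_iff_card_roots.1 hspl]
    intro a ha b hb hab
    simp only [Finset.mem_coe, Multiset.mem_toFinset, mem_roots hq0] at ha hb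
    rw [← (hl a ha).2, ← (hl b hb).2]
    exact congrArg _ hab
  have hdeg' : P.natDegree = q.natDegree + 2 := by
    rw [hdeg, natDegree_mul (pow_ne_zero _ (X_sub_C_ne_zero τ)) hq0, natDegree_pow,
      natDegree_X_sub_C]; ring
  have hbase : ∀ (T : Finset A), (∀ r ∈ T, P.eval r = 0 ∧ PowerSeries.constantCoeff r = τ) →
      ∀ r ∈ T ∪ q.roots.toFinset.image l, P.eval r = 0 := by
    intro T hT r hr
    rw [Finset.mem_union] at hr
    exact hr.elim (fun h => (hT r h).1) (fun h => (hS r h).1)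
  have hbase2 : ∀ (T : Finset A), (∀ r ∈ T, P.eval r = 0 ∧ PowerSeries.constantCoeff r = τ) →
      (T ∪ q.roots.toFinset.image l).card = T.card + q.natDegree := by
    intro T hT
    rw [Finset.card_union_of_disjoint, hcard]
    rw [Finset.disjoint_left]
    intro r h1 h2
    exact (hS r h2).2 (hT r h1).2
  refine ⟨?_, r₁, r₂, h11, h21, h12, h22, h13, h23, ?_⟩
  · have hT : ∀ r ∈ ({r₁, r₂} : Finset A), P.eval r = 0 ∧ PowerSeries.constantCoeff r = τ := by
      intro r hr
      simp only [Finset.mem_insert, Finset.mem_singleton] at hr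
      rcases hr with rfl | rfl
      · exact ⟨h11, h12⟩
      · exact ⟨h21, h22⟩
    refine card_roots_of_finset P hP0 _ (hbase _ hT) ?_
    rw [hbase2 _ hT, hdeg', Finset.card_pair h12ne, add_comm]
  · intro r hr hrτ
    by_contra hcon
    push Not at hcon
    have hT : ∀ x ∈ ({r, r₁, r₂} : Finset A),
        P.eval x = 0 ∧ PowerSeries.constantCoeff x = τ := by
      intro x hx
      simp only [Finset.mem_insert, Finset.mem_singleton] at hx
      rcases hx with rfl | rfl | rfl
      · exact ⟨hr, hrτ⟩
      · exact ⟨h11, h12⟩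
      · exact ⟨h21, h22⟩
    have hc := hbase2 _ hT
    have h3 : ({r, r₁, r₂} : Finset A).card = 3 := by
      rw [Finset.card_eq_three]
      exact ⟨r, r₁, r₂, hcon.1, hcon.2, h12ne, rfl⟩
    have hle : (({r, r₁, r₂} : Finset A) ∪ q.roots.toFinset.image l).card ≤ P.natDegree := by
      refine le_trans ?_ (card_roots' P)
      rw [Finset.card_def]
      apply Multiset.card_le_card
      rw [Finset.val_le_iff_val_subset]
      intro x hx
      rw [mem_roots hP0]
      exact hbase _ hT x hx
    rw [hc, h3, hdeg'] at hle
    omega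

/-- Substitution `F(t,x) ↦ F(t,g)`. -/
noncomputable def sb {k B : Type*} [CommRing k] [CommRing B] (φ : k →+* B) (g : B[X]) :
    k[X][X] →+* B[X] := eval₂RingHom (mapRingHom φ) g

section sbsec
variable {k B B' : Type*} [CommRing k] [CommRing B] [CommRing B']

theorem sb_C (φ : k →+* B) (g : B[X]) (c : k[X]) : sb φ g (C c) = c.map φ := by
  simp [sb]

theorem sb_X (φ : k →+* B) (g : B[X]) : sb φ g X = g := by
  simp [sb]

theorem sb_map (φ : k →+* B) (g : B[X]) (θ : B →+* B') (F : k[X][X]) :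
    (sb φ g F).map θ = sb (θ.comp φ) (g.map θ) F := by
  have : (mapRingHom θ).comp (sb φ g) = sb (θ.comp φ) (g.map θ) := by
    apply Polynomial.ringHom_ext
    · intro a
      simp [sb_C, Polynomial.map_map]
    · simp [sb_X]
  exact RingHom.congr_fun this F

theorem sb_comp (φ : k →+* B) (g : B[X]) (u w : k[X]) (F : k[X][X]) :
    sb φ g (F.comp (C u + C w * X)) = sb φ (u.map φ + w.map φ * g) F := by
  have : (sb φ g).comp (compRingHom (C u + C w * X)) = sb φ (u.map φ + w.map φ * g) := by
    apply Polynomial.ringHom_ext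
    · intro a
      simp [sb_C]
    · simp [sb_X, sb_C]
  exact RingHom.congr_fun this F

theorem sb_eval (φ : k →+* B) (g : B[X]) (x : k) (F : k[X][X]) :
    (sb φ g F).eval (φ x) = (F.map (evalRingHom x)).eval₂ φ (g.eval (φ x)) := by
  have : (evalRingHom (φ x)).comp (sb φ g)
      = (eval₂RingHom φ (g.eval (φ x))).comp (mapRingHom (evalRingHom x)) := by
    apply Polynomial.ringHom_ext
    · intro a
      simp [sb_C, Polynomial.eval_map]
    · simp [sb_X]
  exact RingHom.congr_fun this F

/-- expected degree -/
noncomputable def NN (n : ℕ) (F : k[X][X]) : ℕ :=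
  F.support.sup (fun j => n * j + (F.coeff j).natDegree)

theorem le_NN (n : ℕ) (F : k[X][X]) (j : ℕ) (hj : F.coeff j ≠ 0) :
    n * j + (F.coeff j).natDegree ≤ NN n F :=
  Finset.le_sup (f := fun j => n * j + (F.coeff j).natDegree) (mem_support_iff.2 hj)

theorem mul_natDegree_le_NN (n : ℕ) (F : k[X][X]) (hF : F ≠ 0) :
    n * F.natDegree ≤ NN n F :=
  le_trans (Nat.le_add_right _ _) (le_NN n F F.natDegree (by simpa using hF))

theorem sb_natDegree (φ : k →+* B) (g : B[X]) (n : ℕ) (F : k[X][X]) (hF : F ≠ 0)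
    (hg : g.natDegree ≤ n)
    (hγ : ∀ ℓ : k[X], ℓ.eval₂ φ (g.coeff n) = 0 → ℓ = 0) :
    (sb φ g F).natDegree = NN n F := by
  classical
  have hexp : sb φ g F = ∑ j ∈ F.support, (F.coeff j).map φ * g ^ j := by
    simp [sb, eval₂_eq_sum, Polynomial.sum]
  have hdeg : ∀ j ∈ F.support, ((F.coeff j).map φ * g ^ j).natDegree ≤ NN n F := by
    intro j hj
    refine natDegree_mul_le.trans (le_trans ?_ (le_NN n F j (mem_support_iff.1 hj)))
    rw [add_comm]
    refine add_le_add ?_ natDegree_map_le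
    rw [mul_comm]
    exact natDegree_pow_le_of_le j hg
  apply natDegree_eq_of_le_of_coeff_ne_zero
  · rw [hexp]
    exact natDegree_sum_le_of_forall_le _ _ hdeg
  · let ℓ : k[X] := ∑ j ∈ F.support, C ((F.coeff j).coeff (NN n F - n * j)) * X ^ j
    have h1 : (sb φ g F).coeff (NN n F) = ℓ.eval₂ φ (g.coeff n) := by
      rw [hexp, finsetSum_coeff, eval₂_finsetSum]
      refine Finset.sum_congr rfl fun j hj => ?_
      have hle := le_NN n F j (mem_support_iff.1 hj)
      have hN : NN n F = (NN n F - n * j) + n * j := by omega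
      rw [eval₂_mul, eval₂_C, eval₂_X_pow]
      nth_rewrite 1 [hN]
      rw [coeff_mul_add_eq_of_natDegree_le, coeff_map, mul_comm n j, coeff_pow_of_natDegree_le hg]
      · exact natDegree_map_le.trans (by omega)
      · rw [mul_comm]
        exact natDegree_pow_le_of_le j hg
    rw [h1]
    intro h0
    have hℓ := hγ _ h0
    have hne : F.support.Nonempty := by simpa using hF
    obtain ⟨j, hj, hjN⟩ := Finset.exists_mem_eq_sup F.support hne
      (fun j => n * j + (F.coeff j).natDegree)
    have h2 : ℓ.coeff j = (F.coeff j).coeff (NN n F - n * j) := by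
      simp only [ℓ, finsetSum_coeff, coeff_C_mul, coeff_X_pow]
      simp only [mul_ite, mul_one, mul_zero]
      rw [Finset.sum_ite_eq]
      simp only [hj, if_true]
    have h3 : NN n F - n * j = (F.coeff j).natDegree := by
      have : NN n F = n * j + (F.coeff j).natDegree := hjN
      omega
    rw [hℓ, h3, coeff_zero] at h2
    exact (mem_support_iff.1 hj) (leadingCoeff_eq_zero.1 h2.symm)

end sbsec

theorem substF_eq {K : Type} [CommRing K] (n : ℕ) (F : K[X][X]) :
    substF n F = sb MvPolynomial.C (fsharp K n) F := by
  simp [substF, sb, eval_map]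

theorem fsharp_coeff {K : Type} [CommRing K] (n : ℕ) (j : Fin (n + 1)) :
    (fsharp K n).coeff j = MvPolynomial.X j := by
  simp only [fsharp, finsetSum_coeff, coeff_C_mul, coeff_X_pow]
  rw [Finset.sum_eq_single j]
  · simp
  · intro b _ hb
    rw [if_neg, mul_zero]
    intro h; exact hb (Fin.ext h.symm)
  · simp

theorem fsharp_natDegree_le {K : Type} [CommRing K] (n : ℕ) : (fsharp K n).natDegree ≤ n := by
  refine natDegree_sum_le_of_forall_le _ _ fun j _ => ?_
  refine (natDegree_C_mul_X_pow_le _ _).trans ?_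
  omega

theorem mv_transc {K σ : Type} [CommRing K] (j : σ) (ℓ : K[X])
    (h : ℓ.eval₂ MvPolynomial.C (MvPolynomial.X j : MvPolynomial σ K) = 0) : ℓ = 0 := by
  have h2 := congrArg (MvPolynomial.eval₂Hom (Polynomial.C) (fun _ : σ => (X : K[X]))) h
  rw [Polynomial.hom_eval₂, map_zero] at h2
  have : (MvPolynomial.eval₂Hom (Polynomial.C) (fun _ : σ => (X : K[X]))).comp MvPolynomial.C
      = Polynomial.C := by ext; simp
  rw [this] at h2
  simpa [eval₂_C_X] using h2

theorem substF_natDegree {K : Type} [CommRing K] (n : ℕ) (F : K[X][X]) (hF : F ≠ 0) :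
    (substF n F).natDegree = NN n F := by
  rw [substF_eq]
  apply sb_natDegree _ _ n F hF (fsharp_natDegree_le n)
  intro ℓ h
  have := fsharp_coeff (K := K) n (Fin.last n)
  rw [Fin.val_last] at this
  rw [this] at h
  exact mv_transc _ _ h

section irr
variable {k : Type} [Field k]

theorem fsharp_succ (d : ℕ) : fsharp k d = C (MvPolynomial.X 0) +
    ∑ j : Fin d, C (MvPolynomial.X j.succ) * X ^ ((j : ℕ) + 1) := by
  simp [fsharp, Fin.sum_univ_succ]

/-- retraction of `H ↦ H(t,f♯)` -/
noncomputable def retr (k : Type) [Field k] (d : ℕ) :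
    (MvPolynomial (Fin (d + 1)) k)[X] →+* k[X][X] :=
  eval₂RingHom (MvPolynomial.eval₂Hom ((C : k[X] →+* k[X][X]).comp C)
    (Fin.cases X (fun _ => 0))) (C X)

theorem retr_sb (d : ℕ) (H : k[X][X]) :
    retr k d (sb MvPolynomial.C (fsharp k d) H) = H := by
  have : (retr k d).comp (sb MvPolynomial.C (fsharp k d)) = RingHom.id _ := by
    apply Polynomial.ringHom_ext
    · intro a
      have : ((retr k d).comp (mapRingHom MvPolynomial.C)) = (C : k[X] →+* k[X][X]) := by
        apply Polynomial.ringHom_ext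
        · intro a
          simp [retr]
        · simp [retr]
      simpa [sb_C] using RingHom.congr_fun this a
    · simp [sb_X, fsharp_succ, retr, eval₂_finsetSum]
  exact RingHom.congr_fun this H

/-- forward change of variables -/
noncomputable def fwd (k : Type) [Field k] (d : ℕ) :
    MvPolynomial (Fin d) k[X][X] →+* (MvPolynomial (Fin (d + 1)) k)[X] :=
  MvPolynomial.eval₂Hom (sb MvPolynomial.C (fsharp k d)) (fun j => C (MvPolynomial.X j.succ))

/-- backward change of variables -/
noncomputable def bwd (k : Type) [Field k] (d : ℕ) :
    (MvPolynomial (Fin (d + 1)) k)[X] →+* MvPolynomial (Fin d) k[X][X] :=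
  eval₂RingHom (MvPolynomial.eval₂Hom (MvPolynomial.C.comp ((C : k[X] →+* k[X][X]).comp C))
    (Fin.cases (MvPolynomial.C X -
      ∑ j : Fin d, MvPolynomial.X j * MvPolynomial.C (C X : k[X][X]) ^ ((j : ℕ) + 1))
      (fun j => MvPolynomial.X j))) (MvPolynomial.C (C X))

theorem fwd_bwd (d : ℕ) : (fwd k d).comp (bwd k d) = RingHom.id _ := by
  apply Polynomial.ringHom_ext'
  · apply MvPolynomial.ringHom_ext
    · intro r
      simp [fwd, bwd, sb_C]
    · intro i
      refine Fin.cases ?_ (fun j => ?_) i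
      · simp [fwd, bwd, sb_C, sb_X, fsharp_succ]
      · simp [fwd, bwd]
  · simp [fwd, bwd, sb_C]

theorem bwd_fwd (d : ℕ) : (bwd k d).comp (fwd k d) = RingHom.id _ := by
  apply MvPolynomial.ringHom_ext
  · intro H
    have : ((bwd k d).comp (fwd k d)).comp MvPolynomial.C
        = (MvPolynomial.C : k[X][X] →+* MvPolynomial (Fin d) k[X][X]) := by
      apply Polynomial.ringHom_ext'
      · apply Polynomial.ringHom_ext'
        · ext r : 1
          simp [fwd, bwd, sb_C]
        · simp [fwd, bwd, sb_C]
      · simp [fwd, bwd, sb_X, fsharp_succ, eval₂_finsetSum]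
    exact RingHom.congr_fun this H
  · intro j
    simp [fwd, bwd]

theorem sb_prime (d : ℕ) (H : k[X][X]) (hH : Irreducible H) :
    Prime (sb MvPolynomial.C (fsharp k d) H) := by
  have h1 : Prime (MvPolynomial.C H : MvPolynomial (Fin d) k[X][X]) :=
    (MvPolynomial.prime_C_iff _).2 hH.prime
  let e : MvPolynomial (Fin d) k[X][X] ≃+* (MvPolynomial (Fin (d + 1)) k)[X] :=
    RingEquiv.ofRingHom (fwd k d) (bwd k d) (fwd_bwd d) (bwd_fwd d)
  have h2 := (MulEquiv.prime_iff e).2 h1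
  have h3 : e (MvPolynomial.C H) = sb MvPolynomial.C (fsharp k d) H := by
    change fwd k d (MvPolynomial.C H) = _
    simp [fwd]
  rwa [h3] at h2

/-- `H(t,f♯)` over the fraction field -/
theorem sb_irreducible (d : ℕ) (hd : 1 ≤ d) (H : k[X][X]) (hH : Irreducible H)
    (hdeg : 0 < H.natDegree) :
    Irreducible ((substF d H).map
      (algebraMap (MvPolynomial (Fin (d + 1)) k) (FractionRing (MvPolynomial (Fin (d + 1)) k)))) := by
  have hp := (sb_prime d H hH).irreducible
  rw [← substF_eq] at hp
  have hpos : (substF d H).natDegree ≠ 0 := by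
    rw [substF_natDegree d H hH.ne_zero]
    have := mul_natDegree_le_NN d H hH.ne_zero
    have : 0 < d * H.natDegree := Nat.mul_pos hd hdeg
    omega
  exact (hp.isPrimitive hpos).irreducible_iff_irreducible_map_fraction_map.1 hp

theorem sb_coprime (d : ℕ) (hd : 1 ≤ d) (H H' : k[X][X]) (hH : Irreducible H)
    (hdeg : 0 < H.natDegree) (hH' : Irreducible H')
    (hna : ¬ Associated H H') :
    IsCoprime ((substF d H).map
      (algebraMap (MvPolynomial (Fin (d + 1)) k) (FractionRing (MvPolynomial (Fin (d + 1)) k))))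
      ((substF d H').map
      (algebraMap (MvPolynomial (Fin (d + 1)) k)
        (FractionRing (MvPolynomial (Fin (d + 1)) k)))) := by
  rw [(sb_irreducible d hd H hH hdeg).coprime_iff_not_dvd]
  intro hdvd
  have hp := (sb_prime d H hH).irreducible
  have hp' := (sb_prime d H' hH').irreducible
  rw [← substF_eq] at hp hp'
  have hpos : ∀ H : k[X][X], Irreducible H → 0 < H.natDegree → (substF d H).natDegree ≠ 0 := by
    intro H hH hdeg
    rw [substF_natDegree d H hH.ne_zero]
    have := mul_natDegree_le_NN d H hH.ne_zero
    have : 0 < d * H.natDegree := Nat.mul_pos hd hdeg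
    omega
  have h1 := (hp.isPrimitive (hpos H hH hdeg)).dvd_of_fraction_map_dvd_fraction_map hdvd
  have h2 := hp.associated_of_dvd hp' h1
  rw [substF_eq, substF_eq] at h2
  have h3 := h2.map (retr k d)
  rw [retr_sb, retr_sb] at h3
  exact hna h3

theorem sb_eval_ne (d : ℕ) (H : k[X][X]) (τ : k) (h : H.map (evalRingHom τ) ≠ 0) :
    (substF d H).eval (MvPolynomial.C τ) ≠ 0 := by
  intro h0
  rw [substF_eq] at h0
  have h1 := (dvd_iff_isRoot).2 h0
  have h2 := map_dvd (retr k d) h1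
  rw [retr_sb] at h2
  obtain ⟨Q, hQ⟩ := h2
  apply h
  rw [hQ]
  simp [retr]

end irr

section config
variable {k : Type} [Field k]

theorem isPrimitive_of_eval [IsAlgClosed k] (H : k[X][X])
    (h : ∀ t : k, H.map (evalRingHom t) ≠ 0) : H.IsPrimitive := by
  rintro r ⟨Q, hQ⟩
  by_contra hr
  obtain ⟨t, ht⟩ : ∃ t, r.eval t = 0 := by
    by_cases h0 : r = 0
    · exact ⟨0, by simp [h0]⟩
    · exact IsAlgClosed.exists_root r (fun hd => hr (isUnit_iff_degree_eq_zero.2 hd))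
  apply h t
  rw [hQ]
  simp [ht]

theorem eval_ne_of_irreducible (F : k[X][X]) (hF : Irreducible F) (hd : 0 < F.natDegree) (t : k) :
    F.map (evalRingHom t) ≠ 0 := by
  intro h
  have h1 : C (X - C t) ∣ F := by
    rw [C_dvd_iff_dvd_coeff]
    intro i
    rw [dvd_iff_isRoot]
    have := congrArg (fun p => coeff p i) h
    simpa [coeff_map] using this
  exact not_isUnit_X_sub_C t (hF.isPrimitive hd.ne' _ h1)

theorem affine_dvd (F F' H H' : k[X][X]) (hF : Irreducible F) (hd : 0 < F.natDegree)
    (u w c c' : k[X]) (hw : w ≠ 0) (hc : c ≠ 0) (hc' : c' ≠ 0)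
    (h : F.comp (C u + C w * X) = C c * H) (h' : F'.comp (C u + C w * X) = C c' * H')
    (hdvd : H ∣ H') : F ∣ F' := by
  let K := FractionRing k[X]
  let ι : k[X] →+* K := algebraMap k[X] K
  have hinj : Function.Injective ι := IsFractionRing.injective k[X] K
  have hw' : ι w ≠ 0 := (map_ne_zero_iff _ hinj).2 hw
  have hcu : IsUnit (C (ι c) : K[X]) :=
    isUnit_C.2 (isUnit_iff_ne_zero.2 ((map_ne_zero_iff _ hinj).2 hc))
  have hcu' : IsUnit (C (ι c') : K[X]) :=
    isUnit_C.2 (isUnit_iff_ne_zero.2 ((map_ne_zero_iff _ hinj).2 hc'))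
  let _ : Invertible (ι w) := invertibleOfNonzero hw'
  let e : K[X] ≃ₐ[K] K[X] := algEquivCMulXAddC (ι w) (ι u)
  have he : ∀ G : k[X][X], e (G.map ι) = (G.comp (C u + C w * X)).map ι := by
    intro G
    rw [algEquivCMulXAddC_apply, Polynomial.map_comp]
    simp [add_comm, aeval_def, comp, eval₂_eq_eval_map]
  apply (hF.isPrimitive hd.ne').dvd_of_fraction_map_dvd_fraction_map (K := K)
  change F.map ι ∣ F'.map ι
  rw [← map_dvd_iff e, he, he, h, h', Polynomial.map_mul, Polynomial.map_mul, map_C, map_C,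
    hcu.mul_left_dvd, hcu'.dvd_mul_left]
  exact Polynomial.map_dvd ι hdvd

theorem affine_irreducible (F H : k[X][X]) (hF : Irreducible F) (hd : 0 < F.natDegree)
    (u w c : k[X]) (hw : w ≠ 0) (hc : c ≠ 0)
    (h : F.comp (C u + C w * X) = C c * H) (hH : H.IsPrimitive) : Irreducible H := by
  let K := FractionRing k[X]
  let ι : k[X] →+* K := algebraMap k[X] K
  have hinj : Function.Injective ι := IsFractionRing.injective k[X] K
  have hw' : ι w ≠ 0 := (map_ne_zero_iff _ hinj).2 hw
  have hcu : IsUnit (C (ι c) : K[X]) :=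
    isUnit_C.2 (isUnit_iff_ne_zero.2 ((map_ne_zero_iff _ hinj).2 hc))
  let _ : Invertible (ι w) := invertibleOfNonzero hw'
  let e : K[X] ≃ₐ[K] K[X] := algEquivCMulXAddC (ι w) (ι u)
  have he : ∀ G : k[X][X], e (G.map ι) = (G.comp (C u + C w * X)).map ι := by
    intro G
    rw [algEquivCMulXAddC_apply, Polynomial.map_comp]
    simp [add_comm, aeval_def, comp, eval₂_eq_eval_map]
  rw [hH.irreducible_iff_irreducible_map_fraction_map (K := K)]
  have h1 := (hF.isPrimitive hd.ne').irreducible_iff_irreducible_map_fraction_map (K := K) |>.1 hF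
  change Irreducible (F.map ι) at h1
  rw [← MulEquiv.irreducible_iff e.toMulEquiv] at h1
  change Irreducible (e (F.map ι)) at h1
  rw [he, h, Polynomial.map_mul, map_C, irreducible_isUnit_mul hcu] at h1
  exact h1

theorem eval_eval_map (F : k[X][X]) (u : k[X]) (τ : k) :
    (F.eval u).eval τ = (F.map (evalRingHom τ)).eval (u.eval τ) := by
  rw [← coe_evalRingHom τ, ← Polynomial.eval₂_hom, Polynomial.eval_map]

theorem exists_tangent (F : k[X][X]) (τ ξ : k)
    (h0 : (F.map (evalRingHom τ)).eval ξ = 0)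
    (h1 : (F.derivative.map (evalRingHom τ)).eval ξ ≠ 0) :
    ∃ u : k[X], u.natDegree ≤ 1 ∧ u.eval τ = ξ ∧ (X - C τ) ^ 2 ∣ F.eval u := by
  have hv : (X - C τ) ∣ F.eval (C ξ) := by
    rw [dvd_iff_isRoot, IsRoot, eval_eval_map, eval_C]; exact h0
  obtain ⟨v, hv⟩ := hv
  set D := (F.derivative.map (evalRingHom τ)).eval ξ with hD
  let s : k := - v.eval τ / D
  obtain ⟨K, hK⟩ := binomExpansion F (C ξ) (C s * (X - C τ))
  refine ⟨C ξ + C s * (X - C τ), ?_, by simp, ?_⟩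
  · compute_degree
  · rw [hK, hv]
    have h2 : (X - C τ) ∣ v + F.derivative.eval (C ξ) * C s := by
      rw [dvd_iff_isRoot, IsRoot, eval_add, eval_mul, eval_eval_map, eval_C, eval_C, ← hD]
      simp only [s]
      field_simp
      ring
    obtain ⟨v', hv'⟩ := h2
    refine ⟨v' + K * C s ^ 2, ?_⟩
    linear_combination (X - C τ) * hv'

theorem exists_factor (F : k[X][X]) (τ : k) (u w : k[X]) (hw : w.eval τ = 0)
    (hdvd : w ∣ F.eval u)
    (h1 : (F.derivative.map (evalRingHom τ)).eval (u.eval τ) ≠ 0) :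
    ∃ H : k[X][X], F.comp (C u + C w * X) = C w * H ∧ H.map (evalRingHom τ) ≠ 0 := by
  obtain ⟨v, hv⟩ := hdvd
  obtain ⟨K, hK⟩ := binomExpansion (F.map C) (C u) (C w * X)
  have h2 : F.comp (C u + C w * X) = (F.map C).eval (C u + C w * X) := by
    rw [comp, eval_map]
  have h3 : ∀ G : k[X][X], (G.map C).eval (C u) = C (G.eval u) := by
    intro G
    rw [eval_map, eval₂_hom]
  refine ⟨C v + C (F.derivative.eval u) * X + K * C w * X ^ 2, ?_, ?_⟩
  · rw [h2, hK, h3, derivative_map, h3, hv]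
    simp only [map_mul]
    ring
  · intro h
    have := congrArg (fun p => coeff p 1) h
    simp only [Polynomial.map_add, Polynomial.map_mul, map_C, map_X, Polynomial.map_pow,
      coe_evalRingHom, hw, coeff_add, coeff_C_mul, coeff_zero] at this
    rw [eval_eval_map] at this
    simp [h1] at this

end config

section config2
variable {k : Type} [Field k]

theorem clear_denoms (F G : k[X][X])
    (h : IsCoprime (F.map (algebraMap k[X] (FractionRing k[X])))
      (G.map (algebraMap k[X] (FractionRing k[X])))) :
    ∃ (a b : k[X][X]) (r : k[X]), r ≠ 0 ∧ a * F + b * G = C r := by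
  obtain ⟨a, b, hab⟩ := h
  obtain ⟨c, hc⟩ := IsLocalization.integerNormalization_map_to_map (nonZeroDivisors k[X]) a
  obtain ⟨d, hd⟩ := IsLocalization.integerNormalization_map_to_map (nonZeroDivisors k[X]) b
  refine ⟨C (d : k[X]) * IsLocalization.integerNormalization (nonZeroDivisors k[X]) a,
    C (c : k[X]) * IsLocalization.integerNormalization (nonZeroDivisors k[X]) b, c * d,
    mul_ne_zero (nonZeroDivisors.ne_zero c.2) (nonZeroDivisors.ne_zero d.2), ?_⟩
  apply Polynomial.map_injective (algebraMap k[X] (FractionRing k[X]))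
    (IsFractionRing.injective k[X] _)
  simp only [Polynomial.map_add, Polynomial.map_mul, map_C, hc, hd, map_mul]
  simp only [Algebra.smul_def, Polynomial.algebraMap_apply]
  linear_combination (C (algebraMap k[X] (FractionRing k[X]) c)) *
    (C (algebraMap k[X] (FractionRing k[X]) d)) * hab

theorem exists_point [IsAlgClosed k] {ι : Type} [Fintype ι] (F : k[X][X])
    (hF : Irreducible F) (hd : 0 < F.natDegree)
    (G : ι → k[X][X]) (hG : ∀ j, ¬ F ∣ G j) (hGi : ∀ j, Irreducible (G j))
    (hder : F.derivative ≠ 0) :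
    ∃ τ ξ : k, (F.map (evalRingHom τ)).eval ξ = 0 ∧
      (F.derivative.map (evalRingHom τ)).eval ξ ≠ 0 ∧
      ∀ j, ((G j).map (evalRingHom τ)).eval ξ ≠ 0 := by
  classical
  let K := FractionRing k[X]
  let ia : k[X] →+* K := algebraMap k[X] K
  have hinj : Function.Injective ia := IsFractionRing.injective k[X] K
  have hprim := hF.isPrimitive hd.ne'
  have hirr : Irreducible (F.map ia) :=
    hprim.irreducible_iff_irreducible_map_fraction_map.1 hF
  have hco : IsCoprime (F.map ia) ((F.derivative * ∏ j, G j).map ia) := by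
    rw [Polynomial.map_mul, Polynomial.map_prod]
    apply IsCoprime.mul_right
    · rw [← derivative_map]
      apply (separable_iff_derivative_ne_zero hirr).2
      rw [derivative_map]
      exact (Polynomial.map_ne_zero_iff hinj).2 hder
    · apply IsCoprime.prod_right
      intro j _
      rw [hirr.coprime_iff_not_dvd]
      intro h
      exact hG j (hprim.dvd_of_fraction_map_dvd_fraction_map h)
  obtain ⟨a, b, r, hr, hab⟩ := clear_denoms _ _ hco
  have hlc : F.leadingCoeff ≠ 0 := leadingCoeff_ne_zero.2 hF.ne_zero
  obtain ⟨τ, hτ⟩ : ∃ τ : k, (r * F.leadingCoeff).eval τ ≠ 0 := by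
    by_contra hcon
    push Not at hcon
    exact mul_ne_zero hr hlc (Polynomial.funext (by simpa using hcon))
  rw [eval_mul] at hτ
  have hτ1 : r.eval τ ≠ 0 := left_ne_zero_of_mul hτ
  have hτ2 : F.leadingCoeff.eval τ ≠ 0 := right_ne_zero_of_mul hτ
  obtain ⟨ξ, hξ⟩ := IsAlgClosed.exists_root (F.map (evalRingHom τ)) (by
    rw [degree_map_eq_of_leadingCoeff_ne_zero _ (by simpa using hτ2)]
    rw [degree_eq_natDegree hF.ne_zero]
    exact_mod_cast hd.ne')
  have hξ' : (F.map (evalRingHom τ)).eval ξ = 0 := hξ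
  have h3 := congrArg (fun p => (p.map (evalRingHom τ)).eval ξ) hab
  simp only [Polynomial.map_add, Polynomial.map_mul, eval_add, eval_mul, hξ', mul_zero, zero_add,
    map_C, eval_C, coe_evalRingHom, Polynomial.map_prod, eval_prod] at h3
  rw [← h3] at hτ1
  have h4 := right_ne_zero_of_mul hτ1
  refine ⟨τ, ξ, hξ', left_ne_zero_of_mul h4, fun j => ?_⟩
  exact Finset.prod_ne_zero_iff.1 (right_ne_zero_of_mul h4) j (Finset.mem_univ j)

theorem exists_config [IsAlgClosed k] {m : ℕ} (F : Fin m → k[X][X])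
    (hdegx : ∀ i, 0 < (F i).natDegree)
    (hnonassoc : ∀ i j, i ≠ j → ¬ Associated (F i) (F j))
    (hirr : ∀ i, Irreducible (F i)) (hder : ∀ i, (F i).derivative ≠ 0) (i : Fin m) :
    ∃ (τ : k) (u : k[X]), u.natDegree ≤ 1 ∧
      ((F i).derivative.map (evalRingHom τ)).eval (u.eval τ) ≠ 0 ∧
      (∀ j, j ≠ i → ((F j).map (evalRingHom τ)).eval (u.eval τ) ≠ 0) ∧
      ∀ e : ℕ, 1 ≤ e → e ≤ 2 → ∃ H : Fin m → k[X][X],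
        (∀ j, Irreducible (H j)) ∧ (∀ j, 0 < (H j).natDegree) ∧
        (∀ j, (H j).map (evalRingHom τ) ≠ 0) ∧
        (∀ j j', j ≠ j' → ¬ Associated (H j) (H j')) ∧
        (∀ j, (F j).comp (C u + C ((X - C τ) ^ e) * X)
          = C (if j = i then (X - C τ) ^ e else 1) * H j) := by
  classical
  obtain ⟨τ, ξ, h0, h1, h2⟩ := exists_point (ι := {j // j ≠ i}) (F i) (hirr i) (hdegx i)
    (fun j => F j) (fun j h => hnonassoc i j j.2.symm ((hirr i).associated_of_dvd (hirr j) h))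
    (fun j => hirr j) (hder i)
  obtain ⟨u, hu1, hu2, hu3⟩ := exists_tangent (F i) τ ξ h0 h1
  refine ⟨τ, u, hu1, by rwa [hu2], fun j hj => by rw [hu2]; exact h2 ⟨j, hj⟩, ?_⟩
  intro e he1 he2
  set w : k[X] := (X - C τ) ^ e with hw
  have hw0 : w ≠ 0 := pow_ne_zero _ (X_sub_C_ne_zero τ)
  have hwτ : w.eval τ = 0 := by
    rw [hw, eval_pow, eval_sub, eval_X, eval_C, sub_self, zero_pow (by omega)]
  have hex : ∀ j, ∃ H : k[X][X], (F j).comp (C u + C w * X) = C (if j = i then w else 1) * H ∧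
      H.map (evalRingHom τ) ≠ 0 := by
    intro j
    by_cases hj : j = i
    · subst hj
      simp only [if_true]
      exact exists_factor (F j) τ u w hwτ ((pow_dvd_pow _ he2).trans hu3) (by rwa [hu2])
    · refine ⟨(F j).comp (C u + C w * X), by simp [hj], ?_⟩
      rw [Polynomial.map_comp]
      simp only [Polynomial.map_add, Polynomial.map_mul, map_C, map_X, coe_evalRingHom, hwτ,
        C_0, zero_mul, add_zero, hu2, comp_C]
      exact C_ne_zero.2 (h2 ⟨j, hj⟩)
  choose H hH hHτ using hex
  have hc : ∀ j, (if j = i then w else 1) ≠ 0 := by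
    intro j; split_ifs
    · exact hw0
    · exact one_ne_zero
  have hcomp : ∀ j, ((F j).comp (C u + C w * X)).natDegree = (F j).natDegree := by
    intro j
    rw [natDegree_comp, add_comm (C u), natDegree_linear hw0, mul_one]
  have hdeg : ∀ j, (H j).natDegree = (F j).natDegree := by
    intro j
    rw [← hcomp, hH, natDegree_C_mul (hc j)]
  have hprim : ∀ j, (H j).IsPrimitive := by
    intro j
    apply isPrimitive_of_eval
    intro t ht
    by_cases htτ : t = τ
    · rw [htτ] at ht; exact hHτ j ht
    · have h3 := congrArg (Polynomial.map (evalRingHom t)) (hH j)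
      rw [Polynomial.map_mul, ht, mul_zero, Polynomial.map_comp] at h3
      have hwt : w.eval t ≠ 0 := by
        rw [hw, eval_pow, eval_sub, eval_X, eval_C]
        exact pow_ne_zero _ (sub_ne_zero.2 htτ)
      simp only [Polynomial.map_add, Polynomial.map_mul, map_C, map_X, coe_evalRingHom] at h3
      rw [comp_eq_zero_iff] at h3
      rcases h3 with h3 | h3
      · exact eval_ne_of_irreducible (F j) (hirr j) (hdegx j) t h3
      · have := congrArg natDegree h3.2
        rw [add_comm, natDegree_linear hwt, natDegree_C] at this
        exact one_ne_zero this
  refine ⟨H, fun j => affine_irreducible (F j) (H j) (hirr j) (hdegx j) u w _ hw0 (hc j) (hH j)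
    (hprim j), fun j => (hdeg j).symm ▸ hdegx j, hHτ, ?_, hH⟩
  intro j j' hjj' ha
  apply hnonassoc j j' hjj'
  apply (hirr j).associated_of_dvd (hirr j')
  exact affine_dvd (F j) (F j') (H j) (H j') (hirr j) (hdegx j) u w _ _ hw0 (hc j) (hc j')
    (hH j) (hH j') ha.dvd

end config2

theorem galois_embed {R Ka L A : Type} [CommRing R] [IsDomain R] [Field Ka] [Algebra R Ka]
    [IsFractionRing R Ka] [Field L] [Algebra Ka L] (p : R[X])
    [IsSplittingField Ka L (p.map (algebraMap R Ka))]
    [CommRing A] [IsDomain A] (θ : R →+* A) (hθ : Function.Injective θ)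
    (hspl : (p.map θ).roots.card = (p.map θ).natDegree) (hp : p ≠ 0) :
    ∃ g : L → A,
      (∀ (c : R[X]) (x : L), aeval x (p.map (algebraMap R Ka)) = 0 →
        (aeval x (c.map (algebraMap R Ka)) = 0 ↔ (c.map θ).eval (g x) = 0)) ∧
      (∀ x y : L, aeval x (p.map (algebraMap R Ka)) = 0 →
        aeval y (p.map (algebraMap R Ka)) = 0 → g x = g y → x = y) ∧
      (∀ a : A, (p.map θ).eval a = 0 →
        ∃ x : L, aeval x (p.map (algebraMap R Ka)) = 0 ∧ g x = a) ∧
      (∀ φ : A ≃+* A, (∀ r, φ (θ r) = θ r) → ∃ σ : L ≃ₐ[Ka] L,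
        ∀ x : L, aeval x (p.map (algebraMap R Ka)) = 0 → g (σ x) = φ (g x)) := by
  classical
  let Λ := FractionRing A
  let j : A →+* Λ := algebraMap A Λ
  have hj : Function.Injective j := IsFractionRing.injective A Λ
  have hjθ : Function.Injective (j.comp θ) := hj.comp hθ
  let θ' : Ka →+* Λ := IsFractionRing.lift hjθ
  have hθ' : ∀ r, θ' (algebraMap R Ka r) = j (θ r) := fun r =>
    IsFractionRing.lift_algebraMap hjθ r
  have hcomp : θ'.comp (algebraMap R Ka) = j.comp θ := RingHom.ext hθ'
  let _ : Algebra Ka Λ := θ'.toAlgebra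
  have halg : algebraMap Ka Λ = θ' := rfl
  set P := p.map (algebraMap R Ka) with hP
  have hmapP : P.map (algebraMap Ka Λ) = (p.map θ).map j := by
    rw [halg, hP, Polynomial.map_map, Polynomial.map_map, hcomp]
  have hsplA : (p.map θ).Splits := splits_iff_card_roots.2 hspl
  have hsplΛ : (P.map (algebraMap Ka Λ)).Splits := by
    rw [hmapP]; exact hsplA.map j
  have hp0 : p.map θ ≠ 0 := (Polynomial.map_ne_zero_iff hθ).2 hp
  let ψ : L →ₐ[Ka] Λ := IsSplittingField.lift L P hsplΛ
  have hrootA : ∀ x : L, aeval x P = 0 → ∃ a : A, j a = ψ x := by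
    intro x hx
    have h1 : ((p.map θ).map j).eval (ψ x) = 0 := by
      rw [← hmapP, eval_map_algebraMap, aeval_algHom_apply, hx, map_zero]
    have h2 : ψ x ∈ ((p.map θ).map j).roots :=
      (mem_roots ((Polynomial.map_ne_zero_iff hj).2 hp0)).2 h1
    rw [hsplA.roots_map_of_injective hj, Multiset.mem_map] at h2
    obtain ⟨a, _, ha⟩ := h2
    exact ⟨a, ha⟩
  let g : L → A := fun x => if h : ∃ a : A, j a = ψ x then h.choose else 0
  have hg : ∀ x : L, aeval x P = 0 → j (g x) = ψ x := by
    intro x hx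
    have h := hrootA x hx
    simp only [g, dif_pos h]
    exact h.choose_spec
  have hiff : ∀ (c : R[X]) (x : L), aeval x P = 0 →
        (aeval x (c.map (algebraMap R Ka)) = 0 ↔ (c.map θ).eval (g x) = 0) := by
    intro c x hx
    have h1 : j ((c.map θ).eval (g x)) = ψ (aeval x (c.map (algebraMap R Ka))) := by
      rw [← aeval_algHom_apply, ← hg x hx, ← eval_map_algebraMap, halg, Polynomial.map_map, hcomp,
        ← Polynomial.map_map, eval_map_apply]
    rw [← map_eq_zero_iff j hj, h1, map_eq_zero_iff ψ ψ.injective]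
  refine ⟨g, hiff, ?_, ?_, ?_⟩
  · intro x y hx hy hxy
    have h : ψ x = ψ y := by rw [← hg x hx, ← hg y hy, hxy]
    exact ψ.injective h
  · intro a ha
    have hsL : (P.map (algebraMap Ka L)).Splits := IsSplittingField.splits L P
    have h1 : j a ∈ ((P.map (algebraMap Ka L)).map (ψ : L →+* Λ)).roots := by
      rw [Polynomial.map_map, AlgHom.comp_algebraMap, hmapP,
        mem_roots ((Polynomial.map_ne_zero_iff hj).2 hp0), IsRoot.def, eval_map_apply, ha, map_zero]
    rw [hsL.roots_map_of_injective (RingHom.injective _), Multiset.mem_map] at h1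
    obtain ⟨x, hx, hxa⟩ := h1
    have hx' : aeval x P = 0 := by
      have := (mem_roots'.1 hx).2
      rwa [IsRoot.def, eval_map_algebraMap] at this
    refine ⟨x, hx', hj ?_⟩
    rw [hg x hx']; exact hxa
  · intro φ hφ
    let Φ : Λ ≃+* Λ := IsFractionRing.ringEquivOfRingEquiv φ
    have hΦ : ∀ a, Φ (j a) = j (φ a) := fun a =>
      IsFractionRing.ringEquivOfRingEquiv_algebraMap φ a
    have hΦθ : (Φ : Λ →+* Λ).comp θ' = θ' := by
      apply IsLocalization.ringHom_ext (nonZeroDivisors R)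
      ext r
      simp only [RingHom.comp_apply, hθ']
      exact (hΦ _).trans (by rw [hφ])
    let Φ' : Λ ≃ₐ[Ka] Λ := AlgEquiv.ofRingEquiv (f := Φ) (fun r => RingHom.congr_fun hΦθ r)
    let _ : Algebra L Λ := ψ.toRingHom.toAlgebra
    have : IsScalarTower Ka L Λ := IsScalarTower.of_algebraMap_eq fun x => (ψ.commutes x).symm
    have : Normal Ka L := Normal.of_isSplittingField P
    refine ⟨Φ'.restrictNormal L, fun x hx => hj ?_⟩
    have h1 : aeval (Φ'.restrictNormal L x) P = 0 := by
      rw [aeval_algEquiv, AlgHom.comp_apply, hx]; simp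
    rw [hg _ h1]
    have h2 := Φ'.restrictNormal_commutes L x
    refine h2.trans ?_
    change Φ (ψ x) = _
    rw [← hg x hx, hΦ]

section theta
variable {k Om : Type} [Field k] [Field Om]

/-- the field of coefficients of the deformation -/
abbrev WW (Om : Type) [Field Om] (n : ℕ) : Type := FractionRing (MvPolynomial (Fin (n + 1)) Om)

/-- constants -/
noncomputable def cW (Om : Type) [Field Om] (n : ℕ) : Om →+* WW Om n :=
  (algebraMap (MvPolynomial (Fin (n + 1)) Om) (WW Om n)).comp MvPolynomial.C

/-- variables -/
noncomputable def eW (Om : Type) [Field Om] (n : ℕ) (j : Fin (n + 1)) : WW Om n :=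
  algebraMap (MvPolynomial (Fin (n + 1)) Om) (WW Om n) (MvPolynomial.X j)

/-- the deformation -/
noncomputable def theta (n : ℕ) (ι : k →+* Om) (b : Fin (n + 1) → Om) :
    MvPolynomial (Fin (n + 1)) k →+* PowerSeries (WW Om n) :=
  MvPolynomial.eval₂Hom ((PowerSeries.C.comp (cW Om n)).comp ι)
    (fun j => PowerSeries.C (cW Om n (b j)) + PowerSeries.X ^ 2 * ((if j = 0 then 1 else 0)
      + PowerSeries.X ^ 2 * PowerSeries.C (eW Om n j)))

theorem theta_C (n : ℕ) (ι : k →+* Om) (b : Fin (n + 1) → Om) (x : k) :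
    theta n ι b (MvPolynomial.C x) = PowerSeries.C (cW Om n (ι x)) := by
  simp [theta]

theorem theta_X (n : ℕ) (ι : k →+* Om) (b : Fin (n + 1) → Om) (j : Fin (n + 1)) :
    theta n ι b (MvPolynomial.X j) = PowerSeries.C (cW Om n (b j))
      + PowerSeries.X ^ 2 * ((if j = 0 then 1 else 0)
      + PowerSeries.X ^ 2 * PowerSeries.C (eW Om n j)) := by
  simp [theta]

/-- polynomial version -/
noncomputable def theta0 (n : ℕ) (ι : k →+* Om) (b : Fin (n + 1) → Om) :
    MvPolynomial (Fin (n + 1)) k →+* (MvPolynomial (Fin (n + 1)) Om)[X] :=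
  MvPolynomial.eval₂Hom ((C.comp (MvPolynomial.C)).comp ι)
    (fun j => C (MvPolynomial.C (b j)) + X ^ 2 * ((if j = 0 then 1 else 0)
      + X ^ 2 * C (MvPolynomial.X j)))

theorem theta0_injective (n : ℕ) (ι : k →+* Om) (b : Fin (n + 1) → Om) :
    Function.Injective (theta0 n ι b) := by
  let c : Fin (n + 1) → Om := fun j => b j + (if j = 0 then 1 else 0)
  let T : MvPolynomial (Fin (n + 1)) Om →+* MvPolynomial (Fin (n + 1)) Om :=
    MvPolynomial.eval₂Hom MvPolynomial.C (fun j => MvPolynomial.X j - MvPolynomial.C (c j))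
  have h : (T.comp ((evalRingHom 1).comp (theta0 n ι b))) = MvPolynomial.map ι := by
    apply MvPolynomial.ringHom_ext
    · intro r; simp [T, theta0]
    · intro j
      simp only [T, theta0, c, RingHom.comp_apply, MvPolynomial.coe_eval₂Hom,
        MvPolynomial.eval₂_X, coe_evalRingHom, eval_add, eval_mul, eval_pow, eval_X, one_pow,
        eval_C, one_mul, MvPolynomial.eval₂_add, MvPolynomial.eval₂_C, MvPolynomial.map_X]
      split_ifs <;> simp <;> ring
  have hinj : Function.Injective (MvPolynomial.map (σ := Fin (n + 1)) ι) :=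
    MvPolynomial.map_injective ι ι.injective
  rw [← h] at hinj
  intro x y hxy
  apply hinj
  rw [RingHom.comp_apply, RingHom.comp_apply, RingHom.comp_apply, RingHom.comp_apply, hxy]

theorem theta_injective (n : ℕ) (ι : k →+* Om) (b : Fin (n + 1) → Om) :
    Function.Injective (theta n ι b) := by
  let j : (MvPolynomial (Fin (n + 1)) Om)[X] →+* PowerSeries (WW Om n) :=
    (Polynomial.coeToPowerSeries.ringHom).comp
      (mapRingHom (algebraMap (MvPolynomial (Fin (n + 1)) Om) (WW Om n)))
  have hj : Function.Injective j := by
    apply Function.Injective.comp (Polynomial.coe_injective _)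
    exact Polynomial.map_injective _ (IsFractionRing.injective _ _)
  have h : theta n ι b = j.comp (theta0 n ι b) := by
    apply MvPolynomial.ringHom_ext
    · intro r; simp [theta, theta0, j, cW]
    · intro i
      simp only [theta, theta0, j, cW, eW, RingHom.comp_apply, MvPolynomial.coe_eval₂Hom,
        MvPolynomial.eval₂_X]
      split_ifs <;> simp <;> ring
  rw [h]
  exact hj.comp (theta0_injective n ι b)

/-- sign change -/
noncomputable def negEquiv (W : Type) [Field W] : PowerSeries W ≃+* PowerSeries W :=
  RingEquiv.ofRingHom PowerSeries.evalNegHom PowerSeries.evalNegHom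
    (by ext f n; simp [PowerSeries.evalNegHom, PowerSeries.coeff_rescale, ← mul_assoc, ← mul_pow])
    (by ext f n; simp [PowerSeries.evalNegHom, PowerSeries.coeff_rescale, ← mul_assoc, ← mul_pow])

theorem negEquiv_coeff (W : Type) [Field W] (f : PowerSeries W) (n : ℕ) :
    PowerSeries.coeff n (negEquiv W f) = (-1) ^ n * PowerSeries.coeff n f := by
  change PowerSeries.coeff n (PowerSeries.evalNegHom f) = _
  simp [PowerSeries.evalNegHom, PowerSeries.coeff_rescale]

theorem negEquiv_constantCoeff (W : Type) [Field W] (f : PowerSeries W) :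
    PowerSeries.constantCoeff (negEquiv W f) = PowerSeries.constantCoeff f := by
  rw [← PowerSeries.coeff_zero_eq_constantCoeff_apply, negEquiv_coeff]; simp

theorem negEquiv_C (W : Type) [Field W] (w : W) :
    negEquiv W (PowerSeries.C w) = PowerSeries.C w := by
  ext n
  rw [negEquiv_coeff, PowerSeries.coeff_C]
  split_ifs with h <;> simp [h]

theorem negEquiv_X (W : Type) [Field W] :
    negEquiv W PowerSeries.X = - PowerSeries.X := by
  ext n
  rw [negEquiv_coeff, map_neg, PowerSeries.coeff_X]
  split_ifs with h <;> simp [h]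

theorem negEquiv_theta (n : ℕ) (ι : k →+* Om) (b : Fin (n + 1) → Om) (r) :
    negEquiv (WW Om n) (theta n ι b r) = theta n ι b r := by
  have : ((negEquiv (WW Om n)) : PowerSeries (WW Om n) →+* PowerSeries (WW Om n)).comp
      (theta n ι b) = theta n ι b := by
    apply MvPolynomial.ringHom_ext
    · intro r; simp [theta_C, negEquiv_C]
    · intro j
      simp only [RingHom.comp_apply, theta_X, RingHom.coe_coe, map_add, map_mul, map_pow,
        negEquiv_C, negEquiv_X]
      split_ifs <;> simp
  exact RingHom.congr_fun this r

/-- coefficientwise automorphism of `W` -/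
noncomputable def liftW (n : ℕ) (α : Om ≃+* Om) : WW Om n ≃+* WW Om n :=
  IsFractionRing.ringEquivOfRingEquiv (MvPolynomial.mapEquiv (Fin (n + 1)) α)

theorem liftW_c (n : ℕ) (α : Om ≃+* Om) (x : Om) : liftW n α (cW Om n x) = cW Om n (α x) := by
  simp only [liftW, cW, RingHom.comp_apply]
  rw [IsFractionRing.ringEquivOfRingEquiv_algebraMap]
  simp

theorem liftW_e (n : ℕ) (α : Om ≃+* Om) (j) : liftW n α (eW Om n j) = eW Om n j := by
  simp only [liftW, eW]
  rw [IsFractionRing.ringEquivOfRingEquiv_algebraMap]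
  simp

/-- lift to power series -/
noncomputable def psEquiv {W : Type} [Field W] (α : W ≃+* W) : PowerSeries W ≃+* PowerSeries W :=
  RingEquiv.ofRingHom (PowerSeries.map (α : W →+* W)) (PowerSeries.map (α.symm : W →+* W))
    (by ext f n; simp) (by ext f n; simp)

theorem psEquiv_apply {W : Type} [Field W] (α : W ≃+* W) (f) :
    psEquiv α f = PowerSeries.map (α : W →+* W) f := rfl

theorem psEquiv_theta (n : ℕ) (ι : k →+* Om) (b : Fin (n + 1) → Om) (α : Om ≃+* Om)
    (h1 : ∀ x, α (ι x) = ι x) (h2 : ∀ j, α (b j) = b j) (r) :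
    psEquiv (liftW n α) (theta n ι b r) = theta n ι b r := by
  have : ((psEquiv (liftW n α)) : PowerSeries (WW Om n) →+* PowerSeries (WW Om n)).comp
      (theta n ι b) = theta n ι b := by
    apply MvPolynomial.ringHom_ext
    · intro r; simp [theta_C, psEquiv_apply, liftW_c, h1]
    · intro j
      simp only [RingHom.comp_apply, theta_X, RingHom.coe_coe, map_add, map_mul, map_pow,
        psEquiv_apply, PowerSeries.map_C, PowerSeries.map_X, liftW_c, liftW_e, h2]
      split_ifs <;> simp
  exact RingHom.congr_fun this r

end theta

theorem sb_expand {k B : Type*} [CommRing k] [CommRing B] (φ : k →+* B) (f w s : B[X])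
    (G : k[X][X]) : ∃ Q : B[X], sb φ (f + s * w) G
      = sb φ f G + s * (w * sb φ f G.derivative + s * Q) := by
  obtain ⟨Q, hQ⟩ := Polynomial.binomExpansion (G.map (mapRingHom φ)) f (s * w)
  refine ⟨Q * w ^ 2, ?_⟩
  have h : ∀ (g : B[X]) (G : k[X][X]), sb φ g G = (G.map (mapRingHom φ)).eval g := by
    intro g G; simp [sb, eval_map]
  rw [h, h, h, hQ, derivative_map]
  ring

theorem eval_equiv_fixed {R A : Type*} [CommRing R] [CommRing A] (θ : R →+* A) (φ : A ≃+* A)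
    (h : ∀ r, φ (θ r) = θ r) (p : R[X]) (r : A) (hr : (p.map θ).eval r = 0) :
    (p.map θ).eval (φ r) = 0 := by
  have h1 : (φ : A →+* A).comp θ = θ := RingHom.ext h
  have h2 : ((p.map θ).map (φ : A →+* A)).eval ((φ : A →+* A) r) = 0 := by
    rw [eval_map_apply, hr, map_zero]
  rw [Polynomial.map_map, h1] at h2
  exact h2

section theta2
variable {k Om : Type} [Field k] [Field Om]

theorem theta_f (n : ℕ) (ι : k →+* Om) (f : Om[X]) (hf : f.natDegree ≤ n) :
    ∃ ε : (PowerSeries (WW Om n))[X], (fsharp k n).map (theta n ι (fun j => f.coeff j))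
      = (f.map (cW Om n)).map PowerSeries.C
        + C (PowerSeries.X ^ 2) * (1 + C (PowerSeries.X ^ 2) * ε) := by
  refine ⟨∑ j : Fin (n + 1), C (PowerSeries.C (eW Om n j)) * X ^ (j : ℕ), ?_⟩
  have h1 : (f.map (cW Om n)).map PowerSeries.C
      = ∑ j : Fin (n + 1), C (PowerSeries.C (cW Om n (f.coeff j))) * X ^ (j : ℕ) := by
    rw [Fin.sum_univ_eq_sum_range
      (fun j => C (PowerSeries.C (cW Om n (f.coeff j))) * X ^ (j : ℕ)) (n + 1)]
    conv_lhs => rw [f.as_sum_range_C_mul_X_pow' (n := n + 1) (by omega)]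
    simp [Polynomial.map_sum]
  have h2 : (1 : (PowerSeries (WW Om n))[X])
      = ∑ j : Fin (n + 1), C (if j = 0 then 1 else 0) * X ^ (j : ℕ) := by
    rw [Finset.sum_eq_single 0]
    · simp
    · intro j _ hj; simp [hj]
    · simp
  rw [h1, h2]
  simp only [fsharp, Polynomial.map_sum, Polynomial.map_mul, Polynomial.map_pow, map_C, map_X,
    theta_X, Finset.mul_sum, ← Finset.sum_add_distrib]
  refine Finset.sum_congr rfl fun j _ => ?_
  simp only [C_add, C_mul]
  ring

theorem theta_subst (n : ℕ) (ι : k →+* Om) (f : Om[X]) (hf : f.natDegree ≤ n) (G : k[X][X]) :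
    ∃ P1 : (PowerSeries (WW Om n))[X], (substF n G).map (theta n ι (fun j => f.coeff j))
      = ((sb ι f G).map (cW Om n)).map PowerSeries.C + C (PowerSeries.X ^ 2) * P1 ∧
      ∀ τ : k, PowerSeries.constantCoeff (P1.eval (PowerSeries.C (cW Om n (ι τ))))
        = cW Om n ((G.derivative.map (evalRingHom τ)).eval₂ ι (f.eval (ι τ))) := by
  obtain ⟨ε, hε⟩ := theta_f n ι f hf
  have hc : (theta n ι (fun j => f.coeff j)).comp MvPolynomial.C
      = (PowerSeries.C.comp (cW Om n)).comp ι := by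
    ext1 x; simp [theta_C]
  have hm : ∀ G : k[X][X], sb ((PowerSeries.C.comp (cW Om n)).comp ι)
      ((f.map (cW Om n)).map PowerSeries.C) G = ((sb ι f G).map (cW Om n)).map PowerSeries.C := by
    intro G
    rw [sb_map, sb_map, RingHom.comp_assoc]
  obtain ⟨Q, hQ⟩ := sb_expand ((PowerSeries.C.comp (cW Om n)).comp ι)
    ((f.map (cW Om n)).map PowerSeries.C) (1 + C (PowerSeries.X ^ 2) * ε) (C (PowerSeries.X ^ 2)) G
  refine ⟨(1 + C (PowerSeries.X ^ 2) * ε) * sb ((PowerSeries.C.comp (cW Om n)).comp ι)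
    ((f.map (cW Om n)).map PowerSeries.C) G.derivative + C (PowerSeries.X ^ 2) * Q, ?_, ?_⟩
  · rw [substF_eq, sb_map, hc, hε, hQ, hm]
  · intro τ
    simp only [hm, eval_add, eval_mul, eval_C, eval_one, map_add, map_mul, map_pow, map_one,
      PowerSeries.constantCoeff_X]
    rw [eval_map_apply, PowerSeries.constantCoeff_C, eval_map_apply, sb_eval]
    simp

theorem theta_red (n : ℕ) (ι : k →+* Om) (f : Om[X]) (hf : f.natDegree ≤ n) (G : k[X][X]) :
    ((substF n G).map (theta n ι (fun j => f.coeff j))).map PowerSeries.constantCoeff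
      = (sb ι f G).map (cW Om n) := by
  obtain ⟨P1, h, _⟩ := theta_subst n ι f hf G
  rw [h]
  have : (PowerSeries.constantCoeff (R := WW Om n)).comp PowerSeries.C = RingHom.id _ := by
    ext1 x; simp
  rw [Polynomial.map_add, Polynomial.map_mul, Polynomial.map_map PowerSeries.C, this]
  simp

theorem theta_natDegree (n : ℕ) (ι : k →+* Om) (f : Om[X]) (hf : f.natDegree ≤ n)
    (hγ : ∀ ℓ : k[X], ℓ.eval₂ ι (f.coeff n) = 0 → ℓ = 0) (G : k[X][X]) (hG : G ≠ 0) :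
    ((substF n G).map (theta n ι (fun j => f.coeff j))).natDegree = (sb ι f G).natDegree := by
  rw [natDegree_map_eq_of_injective (theta_injective n ι _), substF_natDegree n G hG,
    sb_natDegree ι f n G hG hf hγ]

theorem theta_root_res (n : ℕ) (ι : k →+* Om) (f : Om[X]) (hf : f.natDegree ≤ n) (G : k[X][X])
    (r : PowerSeries (WW Om n))
    (hr : ((substF n G).map (theta n ι (fun j => f.coeff j))).eval r = 0) :
    ((sb ι f G).map (cW Om n)).eval (PowerSeries.constantCoeff r) = 0 := by
  rw [← theta_red n ι f hf G, eval_map_apply, hr, map_zero]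

/-- transposition -/
theorem exists_transposition [IsAlgClosed Om] (h2 : (2 : Om) ≠ 0) (n : ℕ) (ι : k →+* Om)
    (f : Om[X]) (hf : f.natDegree ≤ n) (hγ : ∀ ℓ : k[X], ℓ.eval₂ ι (f.coeff n) = 0 → ℓ = 0)
    (G : k[X][X]) (hG : G ≠ 0) (τ : k) (q : Om[X])
    (hq : sb ι f G = (X - C (ι τ)) ^ 2 * q) (hsep : q.Separable) (hqτ : q.eval (ι τ) ≠ 0)
    (hder : (G.derivative.map (evalRingHom τ)).eval₂ ι (f.eval (ι τ)) ≠ 0)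
    (Ka L : Type) [Field Ka] [Algebra (MvPolynomial (Fin (n + 1)) k) Ka]
    [IsFractionRing (MvPolynomial (Fin (n + 1)) k) Ka] [Field L] [Algebra Ka L]
    [IsSplittingField Ka L ((substF n G).map (algebraMap (MvPolynomial (Fin (n + 1)) k) Ka))] :
    ∃ (σ : L ≃ₐ[Ka] L) (x y : L), x ≠ y ∧ σ x = y ∧ σ y = x ∧
      (∀ z, aeval z ((substF n G).map (algebraMap (MvPolynomial (Fin (n + 1)) k) Ka)) = 0 →
        z ≠ x → z ≠ y → σ z = z) ∧
      aeval x ((substF n G).map (algebraMap (MvPolynomial (Fin (n + 1)) k) Ka)) = 0 ∧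
      aeval y ((substF n G).map (algebraMap (MvPolynomial (Fin (n + 1)) k) Ka)) = 0 ∧
      ∀ H : k[X][X],
        (aeval x ((substF n H).map (algebraMap (MvPolynomial (Fin (n + 1)) k) Ka)) = 0 ∨
        aeval y ((substF n H).map (algebraMap (MvPolynomial (Fin (n + 1)) k) Ka)) = 0) →
        (H.map (evalRingHom τ)).eval₂ ι (f.eval (ι τ)) = 0 := by
  set θ := theta n ι (fun j => f.coeff j) with hθ
  obtain ⟨v, hv⟩ := IsAlgClosed.exists_pow_nat_eq
    (-((G.derivative.map (evalRingHom τ)).eval₂ ι (f.eval (ι τ)) / q.eval (ι τ))) (n := 2)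
    (by norm_num)
  have hv0 : v ≠ 0 := by
    rintro rfl
    rw [zero_pow (by norm_num), eq_comm, neg_eq_zero, div_eq_zero_iff] at hv
    tauto
  obtain ⟨P1, hP, hP1⟩ := theta_subst n ι f hf G
  rw [← hθ] at hP
  have hc := (cW Om n).injective
  have hqm : (sb ι f G).map (cW Om n) = (X - C (cW Om n (ι τ))) ^ 2 * q.map (cW Om n) := by
    rw [hq]; simp
  rw [hqm] at hP
  have h2W : (2 : WW Om n) ≠ 0 := by
    have := (map_ne_zero_iff _ hc).2 h2
    rwa [map_ofNat] at this
  obtain ⟨hcard, r₁, r₂, hr1, hr2, hc1, hc2, hv1, hv2, huniq⟩ :=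
    ps_split_two h2W ((substF n G).map θ) P1 (q.map (cW Om n)) (cW Om n (ι τ)) (cW Om n v) hP
    (by rw [hθ, theta_natDegree n ι f hf hγ G hG, ← hqm, natDegree_map]) hsep.map
    ((IsAlgClosed.splits q).map _)
    (by rw [eval_map_apply]; exact (map_ne_zero_iff _ hc).2 hqτ)
    ((map_ne_zero_iff _ hc).2 hv0)
    (by rw [hP1, eval_map_apply, ← map_pow, ← map_mul, ← map_neg, hv]; congr 1; field_simp)
  have hne : r₁ ≠ r₂ := by
    rintro rfl
    rw [hv1] at hv2
    have : (2 : WW Om n) * cW Om n v = 0 := by linear_combination hv2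
    rcases mul_eq_zero.1 this with h | h
    · exact h2W h
    · exact (map_ne_zero_iff _ hc).2 hv0 h
  have hp0 : substF n G ≠ 0 := by
    rw [substF_eq]; intro h0
    exact hG (by rw [← retr_sb n G, h0, map_zero])
  obtain ⟨g, hg1, hg2, hg3, hg4⟩ := galois_embed (L := L) (Ka := Ka) (substF n G) θ
    (theta_injective n ι _) hcard hp0
  obtain ⟨σ, hσ⟩ := hg4 (negEquiv (WW Om n)) (negEquiv_theta n ι _)
  have hneg : ∀ r, ((substF n G).map θ).eval r = 0 →
      ((substF n G).map θ).eval (negEquiv (WW Om n) r) = 0 := by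
    intro r hr
    exact eval_equiv_fixed θ (negEquiv (WW Om n)) (negEquiv_theta n ι _) _ r hr
  obtain ⟨x, hx, hxr⟩ := hg3 r₁ hr1
  obtain ⟨y, hy, hyr⟩ := hg3 r₂ hr2
  have hroot : ∀ z, aeval z ((substF n G).map (algebraMap (MvPolynomial (Fin (n + 1)) k) Ka)) = 0 →
      aeval (σ z) ((substF n G).map (algebraMap (MvPolynomial (Fin (n + 1)) k) Ka)) = 0 := by
    intro z hz
    rw [aeval_algEquiv, AlgHom.comp_apply, hz]; simp
  have hsw1 : negEquiv (WW Om n) r₁ = r₂ := by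
    rcases huniq _ (hneg r₁ hr1) (by rw [negEquiv_constantCoeff, hc1]) with h | h
    · have h3 := congrArg (PowerSeries.coeff 1) h
      rw [negEquiv_coeff, hv1] at h3
      have : (2 : WW Om n) * cW Om n v = 0 := by linear_combination -h3
      rcases mul_eq_zero.1 this with h | h
      · exact absurd h h2W
      · exact absurd h ((map_ne_zero_iff _ hc).2 hv0)
    · exact h
  have hsw2 : negEquiv (WW Om n) r₂ = r₁ := by
    rcases huniq _ (hneg r₂ hr2) (by rw [negEquiv_constantCoeff, hc2]) with h | h
    · exact h
    · exact absurd ((negEquiv (WW Om n)).injective (h.trans hsw1.symm)).symm hne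
  have hres : ∀ r, PowerSeries.constantCoeff r = cW Om n (ι τ) → ∀ H : k[X][X],
      ((substF n H).map θ).eval r = 0 → (H.map (evalRingHom τ)).eval₂ ι (f.eval (ι τ)) = 0 := by
    intro r hr H hH
    have h1 := theta_root_res n ι f hf H r hH
    rw [hr, eval_map_apply, map_eq_zero_iff _ hc, sb_eval] at h1
    exact h1
  refine ⟨σ, x, y, ?_, ?_, ?_, ?_, hx, hy, ?_⟩
  · rintro rfl; exact hne (hxr.symm.trans hyr)
  · exact hg2 _ _ (hroot x hx) hy (by rw [hσ x hx, hxr, hyr, hsw1])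
  · exact hg2 _ _ (hroot y hy) hx (by rw [hσ y hy, hxr, hyr, hsw2])
  · intro z hz hzx hzy
    apply hg2 _ _ (hroot z hz) hz
    rw [hσ z hz]
    have hz0 := (hg1 _ z hz).1 hz
    have hzc : PowerSeries.constantCoeff (g z) ≠ cW Om n (ι τ) := by
      intro h
      rcases huniq _ hz0 h with h | h
      · exact hzx (hg2 _ _ hz hx (h.trans hxr.symm))
      · exact hzy (hg2 _ _ hz hy (h.trans hyr.symm))
    refine (ps_hensel_unique _ _ _ hz0 (hneg _ hz0) (negEquiv_constantCoeff _ _).symm ?_).symm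
    · rw [hθ, theta_red n ι f hf G, hqm]
      have h5 := theta_root_res n ι f hf G _ hz0
      rw [hqm, eval_mul, mul_eq_zero] at h5
      have hne0 : ((X - C (cW Om n (ι τ))) ^ 2 : (WW Om n)[X]).eval (PowerSeries.constantCoeff (g z)) ≠ 0 := by
        simpa [sub_eq_zero] using hzc
      have h6 := h5.resolve_left hne0
      rw [derivative_mul, eval_add, eval_mul, eval_mul, h6, mul_zero, zero_add]
      exact mul_ne_zero hne0 (sep_deriv_ne _ hsep.map _ h6)
  · rintro H (h | h)
    · exact hres r₁ hc1 H (hxr ▸ (hg1 _ x hx).1 h)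
    · exact hres r₂ hc2 H (hyr ▸ (hg1 _ y hy).1 h)

end theta2

section stab
variable {k K1 Om : Type} [Field k] [Field K1] [Field Om] [Algebra K1 Om]

theorem exists_stab [IsAlgClosed Om] [Normal K1 Om] (n : ℕ) (ι : k →+* K1)
    (f : K1[X]) (hf : f.natDegree ≤ n) (hγ : ∀ ℓ : k[X], ℓ.eval₂ ι (f.coeff n) = 0 → ℓ = 0)
    (G : k[X][X]) (hG : G ≠ 0) (τ : k) (q : K1[X])
    (hq : sb ι f G = (X - C (ι τ)) * q) (hsep : q.Separable) (hqτ : q.eval (ι τ) ≠ 0)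
    (H0 : k[X][X]) (h0 : K1[X]) (hH0 : sb ι f H0 = (X - C (ι τ)) * h0) (hirr : Irreducible h0)
    (Ka L : Type) [Field Ka] [Algebra (MvPolynomial (Fin (n + 1)) k) Ka]
    [IsFractionRing (MvPolynomial (Fin (n + 1)) k) Ka] [Field L] [Algebra Ka L]
    [IsSplittingField Ka L ((substF n G).map (algebraMap (MvPolynomial (Fin (n + 1)) k) Ka))] :
    ∃ x0 : L, aeval x0 ((substF n G).map (algebraMap (MvPolynomial (Fin (n + 1)) k) Ka)) = 0 ∧
      (∀ H : k[X][X],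
        aeval x0 ((substF n H).map (algebraMap (MvPolynomial (Fin (n + 1)) k) Ka)) = 0 →
        (H.map (evalRingHom τ)).eval₂ ι (f.eval (ι τ)) = 0) ∧
      ∀ x y : L, aeval x ((substF n G).map (algebraMap (MvPolynomial (Fin (n + 1)) k) Ka)) = 0 →
        aeval y ((substF n G).map (algebraMap (MvPolynomial (Fin (n + 1)) k) Ka)) = 0 →
        aeval x ((substF n H0).map (algebraMap (MvPolynomial (Fin (n + 1)) k) Ka)) = 0 →
        aeval y ((substF n H0).map (algebraMap (MvPolynomial (Fin (n + 1)) k) Ka)) = 0 →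
        x ≠ x0 → y ≠ x0 → ∃ σ : L ≃ₐ[Ka] L, σ x0 = x0 ∧ σ x = y := by
  set a : K1 →+* Om := algebraMap K1 Om with ha
  set ι' : k →+* Om := a.comp ι with hι'
  set f' : Om[X] := f.map a with hf'
  set θ := theta n ι' (fun j => f'.coeff j) with hθ
  have hc := (cW Om n).injective
  have hfdeg : f'.natDegree ≤ n := natDegree_map_le.trans hf
  have hγ' : ∀ ℓ : k[X], ℓ.eval₂ ι' (f'.coeff n) = 0 → ℓ = 0 := by
    intro ℓ hℓ
    apply hγ
    rw [hf', coeff_map, hι', ← hom_eval₂, map_eq_zero_iff a a.injective] at hℓ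
    exact hℓ
  have hsb : ∀ H : k[X][X], sb ι' f' H = (sb ι f H).map a := by
    intro H; rw [sb_map]
  have hsepG : (sb ι f G).Separable := by
    rw [hq]
    refine (separable_X_sub_C).mul hsep ?_
    rw [(irreducible_X_sub_C _).coprime_iff_not_dvd, dvd_iff_isRoot]
    exact hqτ
  have hsepW : ((sb ι' f' G).map (cW Om n)).Separable := by
    rw [hsb]; exact hsepG.map.map
  have hred : ((substF n G).map θ).map PowerSeries.constantCoeff = (sb ι' f' G).map (cW Om n) := by
    rw [hθ, theta_red n ι' f' hfdeg G]
  have hcard := ps_split_one ((substF n G).map θ)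
    (by rw [hred, hθ, theta_natDegree n ι' f' hfdeg hγ' G hG, natDegree_map])
    (by rw [hred]; exact hsepW) (by rw [hred]; exact (IsAlgClosed.splits _).map _)
  have huniq : ∀ r r', ((substF n G).map θ).eval r = 0 → ((substF n G).map θ).eval r' = 0 →
      PowerSeries.constantCoeff r = PowerSeries.constantCoeff r' → r = r' := by
    intro r r' hr hr' h
    refine ps_hensel_unique _ _ _ hr hr' h ?_
    rw [hred]
    exact sep_deriv_ne _ hsepW _ (theta_root_res n ι' f' hfdeg G r hr)
  have hp0 : substF n G ≠ 0 := by
    rw [substF_eq]; intro h0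
    exact hG (by rw [← retr_sb n G, h0, map_zero])
  obtain ⟨g, hg1, hg2, hg3, hg4⟩ := galois_embed (L := L) (Ka := Ka) (substF n G) θ
    (theta_injective n ι' _) hcard hp0
  have hroot0 : ((sb ι' f' G).map (cW Om n)).eval (cW Om n (ι' τ)) = 0 := by
    rw [hsb, hq, eval_map_apply, hι', RingHom.comp_apply, eval_map_apply]
    simp
  obtain ⟨r0, hr0, hcr0⟩ := ps_hensel ((substF n G).map θ) (cW Om n (ι' τ))
    (by rw [hred]; exact hroot0) (by rw [hred]; exact sep_deriv_ne _ hsepW _ hroot0)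
  obtain ⟨x0, hx0, hgx0⟩ := hg3 r0 hr0
  have hroot : ∀ (σ : L ≃ₐ[Ka] L) z,
      aeval z ((substF n G).map (algebraMap (MvPolynomial (Fin (n + 1)) k) Ka)) = 0 →
      aeval (σ z) ((substF n G).map (algebraMap (MvPolynomial (Fin (n + 1)) k) Ka)) = 0 := by
    intro σ z hz
    rw [aeval_algEquiv, AlgHom.comp_apply, hz]; simp
  have hres : ∀ x, aeval x ((substF n G).map (algebraMap (MvPolynomial (Fin (n + 1)) k) Ka)) = 0 →
      aeval x ((substF n H0).map (algebraMap (MvPolynomial (Fin (n + 1)) k) Ka)) = 0 →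
      x ≠ x0 → ∃ z : Om, PowerSeries.constantCoeff (g x) = cW Om n z ∧ aeval z h0 = 0 := by
    intro x hx hxH hne
    have h1 := theta_root_res n ι' f' hfdeg H0 (g x) ((hg1 _ x hx).1 hxH)
    have hneτ : PowerSeries.constantCoeff (g x) ≠ cW Om n (ι' τ) := by
      intro h
      exact hne (hg2 _ _ hx hx0 (by
        rw [hgx0]; exact huniq _ _ ((hg1 _ x hx).1 hx) hr0 (h.trans hcr0.symm)))
    rw [hsb, hH0] at h1
    simp only [Polynomial.map_mul, eval_mul, Polynomial.map_sub, map_X, map_C, eval_sub, eval_X,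
      eval_C] at h1
    have h2 := (mul_eq_zero.1 h1).resolve_left (sub_ne_zero.2 hneτ)
    have h3 : PowerSeries.constantCoeff (g x) ∈ ((h0.map a).map (cW Om n)).roots := by
      rw [mem_roots, IsRoot.def, h2]
      exact Polynomial.map_ne_zero (Polynomial.map_ne_zero hirr.ne_zero)
    rw [(IsAlgClosed.splits _).roots_map, Multiset.mem_map] at h3
    obtain ⟨z, hz, hzx⟩ := h3
    refine ⟨z, hzx.symm, ?_⟩
    have := (mem_roots'.1 hz).2
    rwa [IsRoot.def, ha, eval_map_algebraMap] at this
  refine ⟨x0, hx0, ?_, ?_⟩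
  · intro H hH
    have h1 := theta_root_res n ι' f' hfdeg H (g x0) ((hg1 _ x0 hx0).1 hH)
    rw [hgx0, hcr0, eval_map_apply, map_eq_zero_iff _ hc, hsb, hι', RingHom.comp_apply,
      eval_map_apply, map_eq_zero_iff _ a.injective, sb_eval] at h1
    exact h1
  · intro x y hx hy hxH hyH hxne hyne
    obtain ⟨z, hz, hz0⟩ := hres x hx hxH hxne
    obtain ⟨z', hz', hz0'⟩ := hres y hy hyH hyne
    have hconj : IsConjRoot K1 z' z := by
      rw [isConjRoot_def, ← minpoly.eq_of_irreducible hirr hz0,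
        ← minpoly.eq_of_irreducible hirr hz0']
    obtain ⟨α, hα⟩ := isConjRoot_iff_exists_algEquiv.1 hconj
    have hfix : ∀ r, psEquiv (liftW n α.toRingEquiv) (θ r) = θ r := by
      apply psEquiv_theta
      · intro x; exact α.commutes _
      · intro j; rw [hf', coeff_map]; exact α.commutes _
    have hcoef : ∀ r, PowerSeries.constantCoeff (psEquiv (liftW n α.toRingEquiv) r)
        = liftW n α.toRingEquiv (PowerSeries.constantCoeff r) := by
      intro r
      rw [psEquiv_apply, ← PowerSeries.coeff_zero_eq_constantCoeff_apply, PowerSeries.coeff_map,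
        PowerSeries.coeff_zero_eq_constantCoeff_apply]
      rfl
    obtain ⟨σ, hσ⟩ := hg4 _ hfix
    refine ⟨σ, hg2 _ _ (hroot σ _ hx0) hx0 ?_, hg2 _ _ (hroot σ _ hx) hy ?_⟩
    · rw [hσ _ hx0, hgx0]
      refine huniq _ _ (eval_equiv_fixed θ _ hfix _ _ hr0) hr0 ?_
      rw [hcoef, hcr0, liftW_c]
      congr 1
      exact α.commutes _
    · rw [hσ _ hx]
      refine huniq _ _ (eval_equiv_fixed θ _ hfix _ _ ((hg1 _ x hx).1 hx)) ((hg1 _ y hy).1 hy) ?_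
      rw [hcoef, hz, hz', liftW_c, ← hα]
      rfl

end stab

theorem deriv_ne_of_lt {R : Type*} [CommRing R] [IsDomain R] (p : ℕ) [CharP R p] (P : R[X])
    (h0 : 0 < P.natDegree) (hp : P.natDegree < p) : P.derivative ≠ 0 := by
  intro h
  have h1 := congrArg (fun Q => Q.coeff (P.natDegree - 1)) h
  simp only [coeff_derivative, coeff_zero] at h1
  rw [Nat.sub_add_cancel h0, mul_eq_zero] at h1
  rcases h1 with h1 | h1
  · have h2 : P.leadingCoeff = 0 := h1
    rw [leadingCoeff_eq_zero] at h2
    rw [h2] at h0; simp at h0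
  · have h2 : ((P.natDegree : ℕ) : R) = 0 := by
      rw [← h1, ← Nat.cast_succ, Nat.succ_eq_add_one, Nat.sub_add_cancel h0]
    rw [CharP.cast_eq_zero_iff R p] at h2
    exact absurd (Nat.le_of_dvd h0 h2) (by omega)

theorem sep_of_lt {K : Type*} [Field K] (p : ℕ) [CharP K p] (P : K[X]) (hP : Irreducible P)
    (hp : P.natDegree < p) : P.Separable :=
  (separable_iff_derivative_ne_zero hP).2 (deriv_ne_of_lt p P hP.natDegree_pos hp)

theorem config_field {k : Type} [Field k] [IsAlgClosed k] (p : ℕ) [CharP k p] {m : ℕ} (n : ℕ)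
    (hn : 3 ≤ n) (F : Fin m → k[X][X])
    (hdegx : ∀ i, 0 < (F i).natDegree)
    (hnonassoc : ∀ i j, i ≠ j → ¬ Associated (F i) (F j))
    (hirr : ∀ i, Irreducible (F i)) (hN : ∀ i, NN n (F i) < p) (i : Fin m)
    (e : ℕ) (he1 : 1 ≤ e) (he2 : e ≤ 2) :
    ∃ (K1 : Type) (_ : Field K1) (τ : k) (ι : k →+* K1) (f : K1[X]) (h : Fin m → K1[X]),
      f.natDegree ≤ n ∧ (∀ ℓ : k[X], ℓ.eval₂ ι (f.coeff n) = 0 → ℓ = 0) ∧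
      (∀ j, Irreducible (h j)) ∧ (∏ j, h j).Separable ∧ (∏ j, h j).eval (ι τ) ≠ 0 ∧
      sb ι f (F i) = (X - C (ι τ)) ^ e * h i ∧
      sb ι f (∏ j, F j) = (X - C (ι τ)) ^ e * ∏ j, h j ∧
      ((∏ j, F j).derivative.map (evalRingHom τ)).eval₂ ι (f.eval (ι τ)) ≠ 0 ∧
      (∀ j, j ≠ i → ((F j).map (evalRingHom τ)).eval₂ ι (f.eval (ι τ)) ≠ 0) := by
  classical
  have hder : ∀ j, (F j).derivative ≠ 0 := by
    intro j
    apply deriv_ne_of_lt p _ (hdegx j)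
    have := mul_natDegree_le_NN n (F j) (hirr j).ne_zero
    have := hN j
    nlinarith
  obtain ⟨τ, u, hu1, hdi, hdj, hall⟩ := exists_config F hdegx hnonassoc hirr hder i
  obtain ⟨H, hHirr, hHdeg, hHτ, hHna, hH⟩ := hall e he1 he2
  obtain ⟨d, rfl⟩ : ∃ d, n = d + e := ⟨n - e, by omega⟩
  have hd : 1 ≤ d := by omega
  let R := MvPolynomial (Fin (d + 1)) k
  let K1 := FractionRing R
  let a : R →+* K1 := algebraMap R K1
  have hainj : Function.Injective a := IsFractionRing.injective R K1
  let ι : k →+* K1 := a.comp MvPolynomial.C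
  have hCP : CharP K1 p := charP_of_injective_ringHom ι.injective p
  let fs : K1[X] := (fsharp k d).map a
  let f : K1[X] := u.map ι + ((X - C τ) ^ e : k[X]).map ι * fs
  let h : Fin m → K1[X] := fun j => (substF d (H j)).map a
  have hw : ((X - C τ) ^ e : k[X]).map ι = (X - C (ι τ)) ^ e := by simp
  have hfdeg : f.natDegree ≤ d + e := by
    apply natDegree_add_le_of_degree_le
    · exact natDegree_map_le.trans (by omega)
    · rw [hw]
      refine natDegree_mul_le.trans ?_
      rw [natDegree_pow, natDegree_X_sub_C, mul_one, add_comm]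
      exact Nat.add_le_add_right (natDegree_map_le.trans (fsharp_natDegree_le d)) e
  have hfcoeff : f.coeff (d + e) = a (MvPolynomial.X (Fin.last d)) := by
    have h1 : (u.map ι).coeff (d + e) = 0 :=
      coeff_eq_zero_of_natDegree_lt (lt_of_le_of_lt natDegree_map_le (by omega))
    have h2 := fsharp_coeff (K := k) d (Fin.last d)
    rw [Fin.val_last] at h2
    have h3 : ((X - C (ι τ)) ^ e).natDegree ≤ e := by
      rw [natDegree_pow, natDegree_X_sub_C, mul_one]
    have h4 : ((X - C (ι τ)) ^ e).coeff e = 1 := by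
      have := ((monic_X_sub_C (ι τ)).pow e).coeff_natDegree
      rwa [natDegree_pow, natDegree_X_sub_C, mul_one] at this
    simp only [f, coeff_add, h1, zero_add, hw]
    rw [add_comm d e, coeff_mul_add_eq_of_natDegree_le h3
      (natDegree_map_le.trans (fsharp_natDegree_le d)), h4, one_mul, coeff_map, h2]
  have hγ : ∀ ℓ : k[X], ℓ.eval₂ ι (f.coeff (d + e)) = 0 → ℓ = 0 := by
    intro ℓ hℓ
    rw [hfcoeff, ← hom_eval₂, map_eq_zero_iff a hainj] at hℓ
    exact mv_transc _ _ hℓ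
  have hfτ : f.eval (ι τ) = ι (u.eval τ) := by
    simp only [f, eval_add, eval_mul, hw, eval_pow, eval_sub, eval_X, eval_C, sub_self]
    rw [zero_pow (by omega), zero_mul, add_zero, eval_map_apply]
  have hsb : ∀ j, sb ι f (F j) = (if j = i then (X - C (ι τ)) ^ e else 1) * h j := by
    intro j
    have h1 := sb_comp ι fs u ((X - C τ) ^ e) (F j)
    rw [hH j, map_mul, sb_C] at h1
    change _ = sb ι f (F j) at h1
    rw [← h1]
    congr 1
    · split_ifs
      · exact hw
      · simp
    · simp only [h]
      rw [substF_eq, sb_map]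
  have hirrh : ∀ j, Irreducible (h j) := fun j => sb_irreducible d hd (H j) (hHirr j) (hHdeg j)
  have hdegh : ∀ j, (h j).natDegree < p := by
    intro j
    refine lt_of_le_of_lt ?_ (hN j)
    rw [← sb_natDegree ι f (d + e) (F j) (hirr j).ne_zero hfdeg hγ, hsb j]
    apply natDegree_le_of_dvd (dvd_mul_left _ _)
    apply mul_ne_zero _ (hirrh j).ne_zero
    split_ifs
    · exact pow_ne_zero _ (X_sub_C_ne_zero _)
    · exact one_ne_zero
  have hev : ∀ G : k[X][X], (G.map (evalRingHom τ)).eval₂ ι (f.eval (ι τ))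
      = ι ((G.map (evalRingHom τ)).eval (u.eval τ)) := by
    intro G
    rw [hfτ, eval₂_at_apply]
  have hFi0 : ((F i).map (evalRingHom τ)).eval (u.eval τ) = 0 := by
    rw [← map_eq_zero_iff ι ι.injective, ← hev, ← sb_eval, hsb i]
    simp only [if_true, eval_mul, eval_pow, eval_sub, eval_X, eval_C, sub_self]
    rw [zero_pow (by omega), zero_mul]
  refine ⟨K1, inferInstance, τ, ι, f, h, hfdeg, hγ, hirrh, ?_, ?_, ?_, ?_, ?_, ?_⟩
  · apply separable_prod
    · intro j j' hjj'
      exact sb_coprime d hd (H j) (H j') (hHirr j) (hHdeg j) (hHirr j') (hHna j j' hjj')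
    · intro j
      exact sep_of_lt p (h j) (hirrh j) (hdegh j)
  · rw [eval_prod]
    refine Finset.prod_ne_zero_iff.2 fun j _ => ?_
    have h1 : (h j).eval (ι τ) = a ((substF d (H j)).eval (MvPolynomial.C τ)) := by
      simp only [h, ι, RingHom.comp_apply]
      rw [eval_map_apply]
    rw [h1]
    exact (map_ne_zero_iff a hainj).2 (sb_eval_ne d (H j) τ (hHτ j))
  · rw [hsb i, if_pos rfl]
  · rw [map_prod, Finset.prod_congr rfl (fun j _ => hsb j), Finset.prod_mul_distrib]
    congr 1
    rw [Finset.prod_ite_eq' Finset.univ i]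
    simp
  · rw [hev]
    apply (map_ne_zero_iff ι ι.injective).2
    rw [← Finset.mul_prod_erase Finset.univ F (Finset.mem_univ i), derivative_mul,
      Polynomial.map_add, eval_add, Polynomial.map_mul, Polynomial.map_mul, eval_mul, eval_mul,
      hFi0, zero_mul, add_zero, Polynomial.map_prod, eval_prod]
    apply mul_ne_zero hdi
    refine Finset.prod_ne_zero_iff.2 fun j hj => hdj j (Finset.ne_of_mem_erase hj)
  · intro j hj
    rw [hev]
    exact (map_ne_zero_iff ι ι.injective).2 (hdj j hj)

section final
variable {k : Type} [Field k]

/-- the field `k(a_0,…,a_n)` -/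
abbrev KA (k : Type) [Field k] (n : ℕ) : Type := FractionRing (MvPolynomial (Fin (n + 1)) k)

/-- `F(t,f♯)` over the fraction field -/
noncomputable abbrev PK (n : ℕ) (G : k[X][X]) : (KA k n)[X] :=
  (substF n G).map (algebraMap (MvPolynomial (Fin (n + 1)) k)
    (FractionRing (MvPolynomial (Fin (n + 1)) k)))

theorem PK_prod (n : ℕ) {m : ℕ} (F : Fin m → k[X][X]) : PK n (∏ i, F i) = ∏ i, PK n (F i) := by
  simp only [PK, substF_eq, map_prod, Polynomial.map_prod]

theorem PK_natDegree (n : ℕ) (G : k[X][X]) (hG : G ≠ 0) : (PK n G).natDegree = NN n G := by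
  rw [PK, natDegree_map_eq_of_injective (IsFractionRing.injective _ _), substF_natDegree n G hG]

theorem root_prod_iff {m : ℕ} (n : ℕ) (F : Fin m → k[X][X]) (L : Type) [Field L]
    [Algebra (KA k n) L] (x : L) :
    aeval x (PK n (∏ i, F i)) = 0 ↔ ∃ i, aeval x (PK n (F i)) = 0 := by
  rw [PK_prod, map_prod, Finset.prod_eq_zero_iff]
  simp

theorem root_map {K L : Type} [Field K] [Field L] [Algebra K L] (P : K[X]) (σ : L ≃ₐ[K] L) (x : L)
    (hx : aeval x P = 0) : aeval (σ x) P = 0 := by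
  rw [aeval_algEquiv, AlgHom.comp_apply, hx]; simp

theorem trans_one {K L : Type} [Field K] [Field L] [Algebra K L] [Normal K L] (P : K[X])
    (hP : Irreducible P) (x y : L) (hx : aeval x P = 0) (hy : aeval y P = 0) :
    ∃ σ : L ≃ₐ[K] L, σ x = y := by
  apply isConjRoot_iff_exists_algEquiv.1
  rw [isConjRoot_def, ← minpoly.eq_of_irreducible hP hx, ← minpoly.eq_of_irreducible hP hy]

theorem root_disjoint (n : ℕ) (hn : 1 ≤ n) (H H' : k[X][X]) (hH : Irreducible H)
    (hdeg : 0 < H.natDegree) (hH' : Irreducible H') (hna : ¬ Associated H H')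
    (L : Type) [Field L] [Algebra (KA k n) L] (x : L)
    (h1 : aeval x (PK n H) = 0) (h2 : aeval x (PK n H') = 0) : False := by
  obtain ⟨a, b, hab⟩ := sb_coprime n hn H H' hH hdeg hH' hna
  have h3 := congrArg (aeval (R := KA k n) x) hab
  rw [map_add, map_mul, map_mul, map_one] at h3
  erw [h1, h2] at h3
  simp at h3

theorem swap_mem [IsAlgClosed k] (p : ℕ) [CharP k p] {m : ℕ} (n : ℕ) (hn : 3 ≤ n)
    (F : Fin m → k[X][X])
    (hdegx : ∀ i, 0 < (F i).natDegree)
    (hnonassoc : ∀ i j, i ≠ j → ¬ Associated (F i) (F j))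
    (hirr : ∀ i, Irreducible (F i)) (hN : ∀ i, NN n (F i) < p)
    (L : Type) [Field L] [Algebra (KA k n) L]
    [IsSplittingField (KA k n) L (PK n (∏ i, F i))] (i : Fin m) (x y : L)
    (hx : aeval x (PK n (F i)) = 0) (hy : aeval y (PK n (F i)) = 0) (hxy : x ≠ y) :
    ∃ σ : L ≃ₐ[KA k n] L, σ x = y ∧ σ y = x ∧
      ∀ z, aeval z (PK n (∏ i, F i)) = 0 → z ≠ x → z ≠ y → σ z = z := by
  have hnorm : Normal (KA k n) L := Normal.of_isSplittingField (PK n (∏ i, F i))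
  have hG : (∏ i, F i) ≠ 0 := Finset.prod_ne_zero_iff.2 fun j _ => (hirr j).ne_zero
  have hirrP : Irreducible (PK n (F i)) := sb_irreducible n (by omega) (F i) (hirr i) (hdegx i)
  have hT : ∃ (σ : L ≃ₐ[KA k n] L) (x y : L), x ≠ y ∧ σ x = y ∧ σ y = x ∧
      (∀ z, aeval z (PK n (∏ i, F i)) = 0 → z ≠ x → z ≠ y → σ z = z) ∧
      aeval x (PK n (F i)) = 0 ∧ aeval y (PK n (F i)) = 0 := by
    obtain ⟨K1, _, τ, ι, f, h, hf, hγ, hh, hs, hsτ, hi, hprod, hd, hj⟩ :=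
      config_field p n hn F hdegx hnonassoc hirr hN i 2 (by norm_num) le_rfl
    have hCP : CharP K1 p := charP_of_injective_ringHom ι.injective p
    let Om := AlgebraicClosure K1
    let a : K1 →+* Om := algebraMap K1 Om
    have hCPOm : CharP Om p := charP_of_injective_ringHom a.injective p
    have h2 : (2 : Om) ≠ 0 := by
      intro h
      have h3 : ((2 : ℕ) : Om) = 0 := by exact_mod_cast h
      rw [CharP.cast_eq_zero_iff Om p] at h3
      have h4 := Nat.le_of_dvd (by norm_num) h3
      have h5 := hN i
      have h6 := mul_natDegree_le_NN n (F i) (hirr i).ne_zero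
      have h7 := hdegx i
      nlinarith
    have hev : ∀ G : k[X][X], (G.map (evalRingHom τ)).eval₂ (a.comp ι)
        ((f.map a).eval ((a.comp ι) τ)) = a ((G.map (evalRingHom τ)).eval₂ ι (f.eval (ι τ))) := by
      intro G
      rw [hom_eval₂, RingHom.comp_apply, eval_map_apply]
    obtain ⟨σ, x, y, h1, h2, h3, h4, h5, h6, h7⟩ := exists_transposition h2 n (a.comp ι) (f.map a)
      (natDegree_map_le.trans hf)
      (by
        intro ℓ hℓ
        rw [coeff_map, ← hom_eval₂, map_eq_zero_iff a a.injective] at hℓ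
        exact hγ ℓ hℓ)
      (∏ i, F i) hG τ ((∏ j, h j).map a)
      (by rw [← sb_map, hprod]; simp [Polynomial.map_prod])
      hs.map (by
        rw [RingHom.comp_apply, eval_map_apply]
        exact (map_ne_zero_iff a a.injective).2 hsτ)
      (by rw [hev]; exact (map_ne_zero_iff a a.injective).2 hd) (KA k n) L
    have hmem : ∀ z, aeval z (PK n (∏ i, F i)) = 0 → (z = x ∨ z = y) →
        aeval z (PK n (F i)) = 0 := by
      intro z hz hzx
      obtain ⟨j, hjz⟩ := (root_prod_iff n F L z).1 hz
      by_cases hji : j = i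
      · rw [← hji]; exact hjz
      · exfalso
        apply hj j hji
        have h8 := h7 (F j) (by rcases hzx with rfl | rfl; exacts [Or.inl hjz, Or.inr hjz])
        rw [hev, map_eq_zero_iff a a.injective] at h8
        exact h8
    exact ⟨σ, x, y, h1, h2, h3, h4, hmem x h5 (Or.inl rfl), hmem y h6 (Or.inr rfl)⟩
  have hS : ∃ x0 : L, aeval x0 (PK n (F i)) = 0 ∧ ∀ x y : L, aeval x (PK n (F i)) = 0 →
      aeval y (PK n (F i)) = 0 → x ≠ x0 → y ≠ x0 → ∃ σ : L ≃ₐ[KA k n] L, σ x0 = x0 ∧ σ x = y := by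
    obtain ⟨K1, _, τ, ι, f, h, hf, hγ, hh, hs, hsτ, hi, hprod, hd, hj⟩ :=
      config_field p n hn F hdegx hnonassoc hirr hN i 1 le_rfl (by norm_num)
    rw [pow_one] at hprod hi
    obtain ⟨x0, h1, h2, h3⟩ := exists_stab (Om := AlgebraicClosure K1) n ι f hf hγ (∏ i, F i) hG τ
      (∏ j, h j) hprod hs hsτ (F i) (h i) hi (hh i) (KA k n) L
    have hroot : ∀ x : L, aeval x (PK n (F i)) = 0 → aeval x (PK n (∏ i, F i)) = 0 :=
      fun x hx => (root_prod_iff n F L x).2 ⟨i, hx⟩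
    refine ⟨x0, ?_, fun x y hx hy => h3 x y (hroot x hx) (hroot y hy) hx hy⟩
    obtain ⟨j, hjz⟩ := (root_prod_iff n F L x0).1 h1
    by_cases hji : j = i
    · rw [← hji]; exact hjz
    · exact absurd (h2 (F j) hjz) (hj j hji)
  obtain ⟨σ, x1, y1, h1, h2, h3, h4, h5, h6⟩ := hT
  obtain ⟨x0, hx0, hst⟩ := hS
  obtain ⟨α, hα⟩ := trans_one (PK n (F i)) hirrP x1 x0 h5 hx0
  obtain ⟨β, hβ⟩ := trans_one (PK n (F i)) hirrP x x0 hx hx0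
  obtain ⟨γ, hγ0, hγ⟩ := hst (α y1) (β y) (root_map _ α _ h6) (root_map _ β _ hy)
    (fun h => h1 (α.injective (hα.trans h.symm))) (fun h => hxy (β.injective (hβ.trans h.symm)))
  let ρ : L ≃ₐ[KA k n] L := (α.trans γ).trans β.symm
  have hρx : ρ x1 = x := by
    simp only [ρ, AlgEquiv.trans_apply, hα, hγ0]
    rw [AlgEquiv.symm_apply_eq, hβ]
  have hρy : ρ y1 = y := by
    simp only [ρ, AlgEquiv.trans_apply, hγ]
    rw [AlgEquiv.symm_apply_apply]
  have hρx' : ρ.symm x = x1 := by rw [AlgEquiv.symm_apply_eq, hρx]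
  have hρy' : ρ.symm y = y1 := by rw [AlgEquiv.symm_apply_eq, hρy]
  refine ⟨(ρ.symm.trans σ).trans ρ, ?_, ?_, ?_⟩
  · simp only [AlgEquiv.trans_apply, hρx', h2, hρy]
  · simp only [AlgEquiv.trans_apply, hρy', h3, hρx]
  · intro z hz hzx hzy
    simp only [AlgEquiv.trans_apply]
    rw [h4 (ρ.symm z) (root_map _ ρ.symm z hz), AlgEquiv.apply_symm_apply]
    · rw [← hρx']; exact fun h => hzx (ρ.symm.injective h)
    · rw [← hρy']; exact fun h => hzy (ρ.symm.injective h)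

theorem main_general [IsAlgClosed k] (p : ℕ) [CharP k p] {m : ℕ} (n : ℕ) (hn : 3 ≤ n)
    (F : Fin m → k[X][X])
    (hdegx : ∀ i, 0 < (F i).natDegree)
    (hnonassoc : ∀ i j, i ≠ j → ¬ Associated (F i) (F j))
    (hirr : ∀ i, Irreducible (F i)) (hN : ∀ i, (PK n (F i)).natDegree < p)
    (L : Type) [Field L] [Algebra (KA k n) L]
    [IsSplittingField (KA k n) L (PK n (∏ i, F i))] :
    (∀ i, Nat.card ((PK n (F i)).rootSet L) = (PK n (F i)).natDegree) ∧
    ∀ r : (∀ i, Fin ((PK n (F i)).natDegree) ≃ (PK n (F i)).rootSet L),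
      ∀ π : (∀ i, Equiv.Perm (Fin ((PK n (F i)).natDegree))),
        ∃! σ : L ≃ₐ[KA k n] L, ∀ i a, σ (r i a : L) = (r i (π i a) : L) := by
  classical
  have hNN : ∀ i, NN n (F i) < p := fun i => by
    rw [← PK_natDegree n (F i) (hirr i).ne_zero]; exact hN i
  have hirrP : ∀ i, Irreducible (PK n (F i)) := fun i =>
    sb_irreducible n (by omega) (F i) (hirr i) (hdegx i)
  have hCP : CharP (KA k n) p := charP_of_injective_ringHom (R := k)
    (f := (algebraMap (MvPolynomial (Fin (n + 1)) k) (KA k n)).comp MvPolynomial.C)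
    (RingHom.injective _) p
  have hP0 : PK n (∏ i, F i) ≠ 0 := by
    rw [PK_prod]
    exact Finset.prod_ne_zero_iff.2 fun j _ => (hirrP j).ne_zero
  constructor
  · intro i
    rw [Nat.card_eq_fintype_card]
    apply card_rootSet_eq_natDegree (sep_of_lt p _ (hirrP i) (hN i))
    refine Splits.of_dvd (IsSplittingField.splits L (PK n (∏ i, F i)))
      (Polynomial.map_ne_zero hP0) ?_
    apply Polynomial.map_dvd
    rw [PK_prod]
    exact Finset.dvd_prod_of_mem _ (Finset.mem_univ i)
  · intro r π
    have hroot : ∀ i a, aeval (r i a : L) (PK n (F i)) = 0 := fun i a =>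
      (mem_rootSet'.1 (r i a).2).2
    let S : Submonoid (∀ i, Equiv.Perm (Fin ((PK n (F i)).natDegree))) :=
      { carrier := {π | ∃ σ : L ≃ₐ[KA k n] L, ∀ i a, σ (r i a : L) = (r i (π i a) : L)}
        one_mem' := ⟨AlgEquiv.refl, fun i a => rfl⟩
        mul_mem' := by
          rintro π π' ⟨σ, hσ⟩ ⟨σ', hσ'⟩
          refine ⟨σ'.trans σ, fun i a => ?_⟩
          rw [AlgEquiv.trans_apply, hσ', hσ]
          rfl }
    have hswap : ∀ (i : Fin m) (a b : Fin ((PK n (F i)).natDegree)), a ≠ b →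
        Pi.mulSingle i (Equiv.swap a b) ∈ S := by
      intro i a b hab
      obtain ⟨σ, h1, h2, h3⟩ := swap_mem p n hn F hdegx hnonassoc hirr hNN L i (r i a) (r i b)
        (hroot i a) (hroot i b) (fun h => hab ((r i).injective (Subtype.ext h)))
      refine ⟨σ, fun j c => ?_⟩
      by_cases hj : j = i
      · subst hj
        rw [Pi.mulSingle_eq_same]
        by_cases hca : c = a
        · rw [hca, Equiv.swap_apply_left, h1]
        by_cases hcb : c = b
        · rw [hcb, Equiv.swap_apply_right, h2]
        rw [Equiv.swap_apply_of_ne_of_ne hca hcb]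
        exact h3 _ ((root_prod_iff n F L _).2 ⟨j, hroot j c⟩)
          (fun h => hca ((r j).injective (Subtype.ext h)))
          (fun h => hcb ((r j).injective (Subtype.ext h)))
      · rw [Pi.mulSingle_eq_of_ne hj]
        have hd : ∀ d, (r j c : L) ≠ r i d := by
          intro d h
          refine root_disjoint n (by omega) (F j) (F i) (hirr j) (hdegx j) (hirr i)
            (hnonassoc j i hj) L (r j c) (hroot j c) ?_
          rw [h]; exact hroot i d
        exact h3 _ ((root_prod_iff n F L _).2 ⟨j, hroot j c⟩) (hd a) (hd b)
    have hsingle : ∀ i (g : Equiv.Perm (Fin ((PK n (F i)).natDegree))), Pi.mulSingle i g ∈ S := by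
      intro i g
      induction g using Equiv.Perm.swap_induction_on with
      | one => rw [Pi.mulSingle_one]; exact S.one_mem
      | swap_mul g x y hxy ih =>
        rw [Pi.mulSingle_mul]
        exact S.mul_mem (hswap i x y hxy) ih
    obtain ⟨σ, hσ⟩ : π ∈ S := Submonoid.pi_mem_of_mulSingle_mem π fun i => hsingle i (π i)
    refine ⟨σ, hσ, fun σ' hσ' => ?_⟩
    have h1 : (σ' : L →ₐ[KA k n] L) = σ := by
      refine AlgHom.ext_of_adjoin_eq_top
        (IsSplittingField.adjoin_rootSet L (PK n (∏ i, F i))) fun x hx => ?_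
      obtain ⟨i, hi⟩ := (root_prod_iff n F L x).1 (mem_rootSet'.1 hx).2
      obtain ⟨a, ha⟩ := (r i).surjective
        ⟨x, mem_rootSet.2 ⟨(hirrP i).ne_zero, hi⟩⟩
      have hxa : x = (r i a : L) := by rw [ha]
      rw [hxa]
      exact (hσ' i a).trans (hσ i a).symm
    ext x
    exact AlgHom.congr_fun h1 x

end final

/-- for `k = F̄_p` and pairwise non-associate irreducible
`F_i ∈ k[t][x]`, separable over `k(t)`, `deg_x F_i > 0` (not necessarily monic),
with `n ≥ 3`, `n` exceeding the number of points of multiplicity `> 2` on the curve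
`∏ F_i(t,x) = 0`, and `p > max N_i` where `N_i = deg_t F_i(t,f♯)`, the Galois group
of the splitting field `L` of `∏ F_i(t,f♯)` over `k(a_0,…,a_n)` is the full product
`S_{N_1} × … × S_{N_m}` acting on the roots of the `F_i(t,f♯)`. -/
theorem galois_group_of_generic_substitution_eq_full_product_nonmonic
    (p : ℕ) [Fact (Nat.Prime p)] (m : ℕ) (hm : 1 ≤ m) (n : ℕ) (hn : 3 ≤ n)
    (F : Fin m → Polynomial (Polynomial (AlgebraicClosure (ZMod p))))
    (hdegx : ∀ i, 0 < (F i).natDegree)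
    (hnonassoc : ∀ i j, i ≠ j → ¬ Associated (F i) (F j))
    (hirr : ∀ i, Irreducible (F i))
    (hsep : ∀ i, ∀ G : Polynomial (Polynomial (AlgebraicClosure (ZMod p))),
      F i ≠ G.comp (Polynomial.X ^ p))
    (hsing : Nat.card {P : (AlgebraicClosure (ZMod p)) × (AlgebraicClosure (ZMod p)) //
        Polynomial.eval P.1 (Polynomial.eval (Polynomial.C P.2) (∏ i, F i)) = 0 ∧
        2 < multAt (∏ i, F i) P.1 P.2} < n) :
    let k := AlgebraicClosure (ZMod p)
    let R := MvPolynomial (Fin (n + 1)) k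
    let Ka := FractionRing R
    let Pprod : Polynomial Ka := (substF n (∏ i, F i)).map (algebraMap R Ka)
    let L := Pprod.SplittingField
    let Pi : Fin m → Polynomial Ka := fun i => (substF n (F i)).map (algebraMap R Ka)
    let N : Fin m → ℕ := fun i => (Pi i).natDegree
    (∀ i, N i < p) →
    (∀ i, Nat.card ((Pi i).rootSet L) = N i) ∧
    ∀ r : (∀ i, Fin (N i) ≃ (Pi i).rootSet L),
      ∀ π : (∀ i, Equiv.Perm (Fin (N i))),
        ∃! σ : L ≃ₐ[Ka] L, ∀ i a, σ (r i a : L) = (r i (π i a) : L) := by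
  intro k R Ka Pprod L Pi N hN
  haveI : CharP (AlgebraicClosure (ZMod p)) p :=
    charP_of_injective_algebraMap (algebraMap (ZMod p) (AlgebraicClosure (ZMod p))).injective p
  exact main_general (k := AlgebraicClosure (ZMod p)) p n hn F hdegx hnonassoc hirr hN
    (SplittingField (PK n (∏ i, F i)))
end

section
/- Let p be a prime, k the algebraic closure of F_p, and F_1,…,F_m ∈ k[t][x] with deg_x F_i > 0 pairwise non-associate, irreducible and separable over k(t); set F = ∏_{i=1}^m F_i and let C be the affine plane curve defined by F(t,x) = 0. Let n ≥ 3, let a_0,…,a_n be algebraically independent variables, and f♯ = Σ_{j=0}^n a_j t^j. Let H ∈ k[a_0,…,a_n] \ k[a_n] be an irreducible polynomial, let K be an algebraic closure of the field of fractions of k[a_0,…,a_n]/(H), let b_j ∈ K be the image of a_j, and set g = Σ_{j=0}^n b_j t^j ∈ K[t]. Then at least one of the following holds for F(t,g) ∈ K[t]: (1) F(t,g) is separable (all roots in K simple); (2) F(t,g) has exactly one root of multiplicity two and all its other roots are simple; (3) there exists a point P = (τ, ξ) on C, of multiplicity m_P, such that H is associate in k[a_0,…,a_n] to f♯(τ)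 − ξ = Σ_{j=0}^n a_j τ^j − ξ, τ is a root of F(t,g) of exact multiplicity m_P, and all other roots of F(t,g) are simple. -/
open Polynomial

section aux
variable {k K : Type} [Field k] [Field K] [Algebra k K]

/-- `k(T)` algebraically closed inside `K`. -/
noncomputable def aclF (k : Type) {K : Type} [Field k] [Field K] [Algebra k K] (T : Set K) :
    IntermediateField k K :=
  (algebraicClosure (IntermediateField.adjoin k T) K).restrictScalars k

lemma mem_aclF {T : Set K} {x : K} :
    x ∈ aclF k T ↔ IsAlgebraic (IntermediateField.adjoin k T) x := by
  unfold aclF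
  rw [IntermediateField.mem_restrictScalars, mem_algebraicClosure_iff]

lemma subset_aclF (T : Set K) : T ⊆ (aclF k T : Set K) := by
  intro x hx
  exact mem_aclF.2 (isAlgebraic_algebraMap
    (⟨x, IntermediateField.subset_adjoin k T hx⟩ : IntermediateField.adjoin k T))

lemma aclF_closed {T : Set K} {x : K} (h : IsAlgebraic (aclF k T) x) : x ∈ aclF k T := by
  rw [mem_aclF]
  have h' : IsAlgebraic (algebraicClosure (IntermediateField.adjoin k T) K) x := h
  exact h'.restrictScalars (IntermediateField.adjoin k T)

lemma aclF_mono {S T : Set K} (hST : S ⊆ T) : aclF k S ≤ aclF k T := by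
  intro x hx
  rw [mem_aclF] at *
  have := IntermediateField.adjoin.mono k S T hST
  let : Algebra (IntermediateField.adjoin k S) (IntermediateField.adjoin k T) :=
    (IntermediateField.inclusion this).toAlgebra
  have : IsScalarTower (IntermediateField.adjoin k S) (IntermediateField.adjoin k T) K :=
    IsScalarTower.of_algebraMap_eq (fun _ => rfl)
  exact hx.tower_top _

lemma aclF_eq_closure (T : Set K) :
    (aclF k T : Set K) = (AlgebraicIndependent.matroid k K).closure T := by
  rw [AlgebraicIndependent.matroid_closure_eq]
  ext x
  simp only [SetLike.mem_coe, mem_aclF, Subalgebra.mem_algebraicClosure]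
  exact IntermediateField.isAlgebraic_adjoin_iff

lemma card_le_of_mem_aclF {ι : Type} [Fintype ι] {b : ι → K} (hb : AlgebraicIndependent k b)
    {T : Finset K} (h : ∀ i, b i ∈ aclF k (T : Set K)) : Fintype.card ι ≤ T.card := by
  have h1 : (AlgebraicIndependent.matroid k K).Indep (Set.range b) := by
    rw [AlgebraicIndependent.matroid_indep_iff]
    exact hb.coe_range
  have h2 : Set.range b ⊆ (AlgebraicIndependent.matroid k K).closure (T : Set K) := by
    rw [← aclF_eq_closure]
    rintro _ ⟨i, rfl⟩
    exact h i
  have h3 := h1.encard_le_eRk_of_subset h2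
  rw [Matroid.eRk_closure_eq] at h3
  have h4 := h3.trans (Matroid.eRk_le_encard _ _)
  rw [← Set.image_univ, hb.injective.encard_image, Set.encard_coe_eq_coe_finsetCard,
    Set.encard_univ, ENat.card_eq_coe_fintype_card] at h4
  exact_mod_cast h4

/-- Dimension count -/
lemma dim_count {n : ℕ} {g : K[X]} (hg : g.natDegree ≤ n)
    (hgen : ∀ T : Finset K, (∀ i, g.coeff i ∈ aclF k (T : Set K)) → n ≤ T.card)
    (T : Finset K) (Q r : (aclF k (T : Set K))[X]) (hQ : Q.Monic) (hd : Q.natDegree ≤ n + 1)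
    (h : Q.map (algebraMap _ K) ∣ g - r.map (algebraMap _ K)) :
    Q.natDegree ≤ T.card + 1 := by
  classical
  set ι := algebraMap (aclF k (T : Set K)) K with hι
  wlog hr : r = r %ₘ Q generalizing r with H
  · refine H (r %ₘ Q) ?_ ?_
    · have : g - (r %ₘ Q).map ι = (g - r.map ι) + Q.map ι * (r /ₘ Q).map ι := by
        have h0 := congrArg (Polynomial.map ι) (modByMonic_add_div r Q)
        simp only [Polynomial.map_add, Polynomial.map_mul] at h0
        linear_combination -h0
      rw [this]
      exact dvd_add h (dvd_mul_right _ _)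
    · exact ((modByMonic_eq_self_iff hQ).2 (degree_modByMonic_lt r hQ)).symm
  obtain ⟨q, hq⟩ := h
  have hgq : g = r.map ι + Q.map ι * q := by rw [← hq]; ring
  -- number of coefficients
  set N := n + 1 - Q.natDegree with hN
  have hqdeg : ∀ i, N ≤ i → q.coeff i = 0 := by
    intro i hi
    by_contra hne
    have hq0 : q ≠ 0 := by rintro rfl; simp at hne
    have h1 : i ≤ q.natDegree := le_natDegree_of_ne_zero hne
    have hQm : (Q.map ι).Monic := hQ.map ι
    have h2 : (Q.map ι * q).natDegree = Q.natDegree + q.natDegree := by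
      rw [hQm.natDegree_mul' hq0, hQ.natDegree_map]
    have h3 : (Q.map ι * q).coeff (Q.natDegree + q.natDegree) ≠ 0 := by
      rw [← h2]; simpa using mul_ne_zero hQm.ne_zero hq0
    have h4 : g.coeff (Q.natDegree + q.natDegree) = 0 :=
      coeff_eq_zero_of_natDegree_lt (by omega)
    have h5 : r.coeff (Q.natDegree + q.natDegree) = 0 := by
      apply coeff_eq_zero_of_degree_lt
      rw [hr]
      refine (degree_modByMonic_lt r hQ).trans_le ?_
      rw [degree_eq_natDegree hQ.ne_zero]
      exact_mod_cast Nat.le_add_right _ _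
    rw [hgq, coeff_add, coeff_map, h5] at h4
    simp at h4
    exact h3 h4
  set T' : Finset K := T ∪ (Finset.range N).image q.coeff with hT'
  have hsub : aclF k (T : Set K) ≤ aclF k (T' : Set K) := aclF_mono (by simp [hT'])
  have hqL : ∀ i, q.coeff i ∈ aclF k (T' : Set K) := by
    intro i
    by_cases hi : N ≤ i
    · rw [hqdeg i hi]; exact zero_mem _
    · apply subset_aclF
      simp only [hT', Finset.coe_union, Finset.coe_image, Finset.coe_range]
      exact Or.inr ⟨i, by simpa using hi, rfl⟩
  have hall : ∀ i, g.coeff i ∈ aclF k (T' : Set K) := by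
    intro i
    rw [hgq, coeff_add, coeff_map, coeff_mul]
    refine add_mem (hsub (r.coeff i).2) (sum_mem fun x _ => mul_mem ?_ (hqL _))
    rw [coeff_map]
    exact hsub (Q.coeff x.1).2
  have h1 := hgen T' hall
  have h2 : T'.card ≤ T.card + N := by
    refine (Finset.card_union_le _ _).trans ?_
    have := Finset.card_image_le (s := Finset.range N) (f := q.coeff)
    simp at this
    omega
  omega

/-- `F(y,x)` -/
noncomputable def ev (y x : K) : k[X][X] →+* K := eval₂RingHom (aeval y : k[X] →ₐ[k] K).toRingHom x

/-- `F(t,·)` with coefficients extended to `L` -/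
noncomputable def exq (L : Type) [Field L] [Algebra k L] : k[X][X] →+* L[X][X] :=
  mapRingHom (mapRingHom (algebraMap k L))

lemma eval_eval_exq (F : k[X][X]) (g : K[X]) (y : K) :
    eval y (eval g (exq K F)) = ev y (eval y g) F := by
  simp only [exq, ev, coe_mapRingHom, coe_eval₂RingHom]
  rw [eval_map, ← coe_evalRingHom y, hom_eval₂]
  congr 1
  ext <;> simp

lemma map_eval_exq (L : IntermediateField k K) (F : k[X][X]) (r : L[X]) :
    (eval r (exq L F)).map (algebraMap L K) = eval (r.map (algebraMap L K)) (exq K F) := by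
  simp only [exq, coe_mapRingHom]
  rw [eval_map, eval_map, ← coe_mapRingHom (algebraMap L K), hom_eval₂]
  congr 1
  ext <;> simp [← IsScalarTower.algebraMap_apply k L K]

lemma derivative_exq (L : Type) [Field L] [Algebra k L] (F : k[X][X]) :
    exq L (derivative F) = derivative (exq L F) := by
  simp [exq, derivative_map]

lemma hensel_step (L : IntermediateField k K) (F : k[X][X]) (g : K[X]) (y : L) (e : ℕ)
    (he : 1 ≤ e) (r : L[X]) (hr : (X - C (y : K)) ^ e ∣ g - r.map (algebraMap L K))
    (hF : (X - C (y : K)) ^ (e + 1) ∣ eval g (exq K F))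
    (hx : ev (y : K) (eval (y : K) g) (derivative F) ≠ 0) :
    ∃ r' : L[X], (X - C (y : K)) ^ (e + 1) ∣ g - r'.map (algebraMap L K) := by
  set ι := algebraMap L K with hι
  have hiy : ι y = (y : K) := rfl
  obtain ⟨h, hh⟩ := hr
  have hg : g = r.map ι + (X - C (y : K)) ^ e * h := by rw [← hh]; ring
  have hgy : eval (y : K) g = eval (y : K) (r.map ι) := by
    rw [hg]; simp [show e ≠ 0 by omega]
  obtain ⟨q, hq⟩ := binomExpansion (exq K F) (r.map ι) ((X - C (y : K)) ^ e * h)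
  rw [← hg, ← map_eval_exq, ← derivative_exq] at hq
  have h2 : (X - C (y : K)) ^ (e + 1) ∣ q * ((X - C (y : K)) ^ e * h) ^ 2 := by
    refine Dvd.dvd.mul_left ?_ _
    rw [mul_pow, ← pow_mul]
    exact (pow_dvd_pow _ (by omega)).mul_right _
  have h3 : (X - C (y : K)) ^ (e + 1) ∣ (eval r (exq L F)).map ι +
      eval (r.map ι) (exq K (derivative F)) * ((X - C (y : K)) ^ e * h) := by
    have := dvd_sub hF h2
    rwa [hq, add_sub_cancel_right] at this
  have h4 : (X - C (y : K)) ^ e ∣ (eval r (exq L F)).map ι := by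
    have h5 := (pow_dvd_pow (X - C (y : K)) (Nat.le_succ e)).trans h3
    exact (dvd_add_left (Dvd.dvd.mul_left (dvd_mul_right _ _) _)).1 h5
  have h5 : (X - C y) ^ e ∣ eval r (exq L F) := by
    rw [← map_dvd_map' ι]
    simpa [hiy] using h4
  obtain ⟨σ, hσ⟩ := h5
  rw [hσ] at h3
  have h6 : (X - C (y : K)) ∣ σ.map ι + eval (r.map ι) (exq K (derivative F)) * h := by
    have hne : (X - C (y : K)) ^ e ≠ 0 := pow_ne_zero _ (X_sub_C_ne_zero _)
    rw [← mul_dvd_mul_iff_left hne, ← pow_succ]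
    convert h3 using 1
    simp [hiy]
    ring
  rw [dvd_iff_isRoot, IsRoot, eval_add, eval_mul, eval_eval_exq, ← hgy] at h6
  set D := ev (y : K) (eval (y : K) g) (derivative F) with hD
  have hDL : D ∈ L := by
    rw [hD, hgy, ← eval_eval_exq, ← map_eval_exq, ← hiy, eval_map, eval₂_at_apply]
    exact SetLike.coe_mem _
  have hsL : eval (y : K) (σ.map ι) ∈ L := by
    rw [← hiy, eval_map, eval₂_at_apply]
    exact SetLike.coe_mem _
  have hc : eval (y : K) h = - eval (y : K) (σ.map ι) / D := by
    field_simp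
    linear_combination h6
  have hcL : eval (y : K) h ∈ L := by
    rw [hc]; exact div_mem (neg_mem hsL) hDL
  set cL : L := ⟨eval (y : K) h, hcL⟩ with hcLdef
  refine ⟨r + C cL * (X - C y) ^ e, ?_⟩
  have : g - (r + C cL * (X - C y) ^ e).map ι =
      (X - C (y : K)) ^ e * (h - C (eval (y : K) h)) := by
    conv_lhs => rw [hg]
    have : ι cL = eval (y : K) h := rfl
    simp only [Polynomial.map_add, Polynomial.map_mul, Polynomial.map_pow, Polynomial.map_sub,
      map_C, map_X, this, hiy]
    ring
  rw [this, pow_succ]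
  exact mul_dvd_mul_left _ (by rw [dvd_iff_isRoot]; simp)

lemma crt (L : IntermediateField k K) (g : K[X]) (P Q r s : L[X]) (hPQ : IsCoprime P Q)
    (h1 : P.map (algebraMap L K) ∣ g - r.map (algebraMap L K))
    (h2 : Q.map (algebraMap L K) ∣ g - s.map (algebraMap L K)) :
    ∃ w : L[X], (P * Q).map (algebraMap L K) ∣ g - w.map (algebraMap L K) := by
  obtain ⟨u, v, huv⟩ := hPQ
  refine ⟨r * (v * Q) + s * (u * P), ?_⟩
  rw [Polynomial.map_mul]
  have hc : IsCoprime (P.map (algebraMap L K)) (Q.map (algebraMap L K)) :=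
    ⟨u.map _, v.map _, by rw [← Polynomial.map_mul, ← Polynomial.map_mul, ← Polynomial.map_add, huv]; simp⟩
  have huv' : u.map (algebraMap L K) * P.map (algebraMap L K) +
    v.map (algebraMap L K) * Q.map (algebraMap L K) = 1 := by
    rw [← Polynomial.map_mul, ← Polynomial.map_mul, ← Polynomial.map_add, huv]; simp
  simp only [Polynomial.map_mul, Polynomial.map_add]
  refine hc.mul_dvd ?_ ?_
  · have : g - (r.map (algebraMap L K) * (v.map (algebraMap L K) * Q.map (algebraMap L K)) +
      s.map (algebraMap L K) * (u.map (algebraMap L K) * P.map (algebraMap L K))) =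
      (g - r.map (algebraMap L K)) +
      P.map (algebraMap L K) * (u.map (algebraMap L K) * (r.map (algebraMap L K) - s.map (algebraMap L K))) := by
      linear_combination (-r.map (algebraMap L K)) * huv'
    rw [this]
    exact dvd_add h1 (dvd_mul_right _ _)
  · have : g - (r.map (algebraMap L K) * (v.map (algebraMap L K) * Q.map (algebraMap L K)) +
      s.map (algebraMap L K) * (u.map (algebraMap L K) * P.map (algebraMap L K))) =
      (g - s.map (algebraMap L K)) +
      Q.map (algebraMap L K) * (v.map (algebraMap L K) * (s.map (algebraMap L K) - r.map (algebraMap L K))) := by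
      linear_combination (-s.map (algebraMap L K)) * huv'
    rw [this]
    exact dvd_add h2 (dvd_mul_right _ _)

/-- irreducible polynomial vanishing at a generic point generates the kernel -/
lemma dvd_of_generic {f G : k[X][X]} (hf : Irreducible f) (hdeg : 0 < f.natDegree) {y x : K}
    (hy : Transcendental k y) (h1 : ev y x f = 0) (h2 : ev y x G = 0) : f ∣ G := by
  have hprim : f.IsPrimitive := hf.isPrimitive hdeg.ne'
  have hinj : Function.Injective (aeval y : k[X] →ₐ[k] K).toRingHom :=
    transcendental_iff_injective.1 hy
  set θ : FractionRing k[X] →+* K := IsFractionRing.lift hinj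
  have hθ : θ.comp (algebraMap k[X] (FractionRing k[X])) = (aeval y : k[X] →ₐ[k] K).toRingHom := by
    apply RingHom.ext
    intro a
    rw [RingHom.comp_apply]
    exact IsFractionRing.lift_algebraMap hinj a
  have hev : ∀ G : k[X][X], ev y x G = eval₂ θ x (G.map (algebraMap k[X] (FractionRing k[X]))) := by
    intro G
    rw [eval₂_map, hθ]; rfl
  apply hprim.dvd_of_fraction_map_dvd_fraction_map (K := FractionRing k[X])
  have hirr := (hprim.irreducible_iff_irreducible_map_fraction_map (K := FractionRing k[X])).1 hf
  by_contra hnd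
  obtain ⟨u, v, huv⟩ := (hirr.coprime_iff_not_dvd.2 hnd)
  have := congrArg (eval₂ θ x) huv
  rw [eval₂_add, eval₂_mul, eval₂_mul, ← hev, ← hev, h1, h2] at this
  simp at this

lemma ev_derivative_ne_zero {m : ℕ} {F : Fin m → k[X][X]}
    (hdegx : ∀ i, 0 < (F i).natDegree)
    (hnonassoc : ∀ i j, i ≠ j → ¬ Associated (F i) (F j))
    (hirr : ∀ i, Irreducible (F i)) (hsep : ∀ i, derivative (F i) ≠ 0) {y x : K}
    (hy : Transcendental k y) (h1 : ev y x (∏ i, F i) = 0) :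
    ev y x (derivative (∏ i, F i)) ≠ 0 := by
  classical
  intro h2
  rw [map_prod, Finset.prod_eq_zero_iff] at h1
  obtain ⟨i, -, hi⟩ := h1
  rw [← Finset.mul_prod_erase _ _ (Finset.mem_univ i), derivative_mul, map_add, map_mul, map_mul,
    hi, zero_mul, add_zero, mul_eq_zero] at h2
  rcases h2 with h2 | h2
  · have hd := dvd_of_generic (hirr i) (hdegx i) hy hi h2
    have := natDegree_le_of_dvd hd (hsep i)
    have h3 := natDegree_derivative_lt (hdegx i).ne'
    omega
  · rw [map_prod, Finset.prod_eq_zero_iff] at h2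
    obtain ⟨j, hj, hj0⟩ := h2
    have hd := dvd_of_generic (hirr i) (hdegx i) hy hi hj0
    exact hnonassoc i j (Finset.ne_of_mem_erase hj).symm ((hirr i).associated_of_dvd (hirr j) hd)

/-- If `y ∈ L` and `F(y,x)=0` then `x ∈ L`. -/
lemma x_mem {m : ℕ} {F : Fin m → k[X][X]}
    (hdegx : ∀ i, 0 < (F i).natDegree) (hirr : ∀ i, Irreducible (F i)) {T : Set K} {y x : K}
    (hy : y ∈ aclF k T) (h1 : ev y x (∏ i, F i) = 0) : x ∈ aclF k T := by
  rw [map_prod, Finset.prod_eq_zero_iff] at h1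
  obtain ⟨i, -, hi⟩ := h1
  apply aclF_closed
  refine ⟨(F i).map (aeval (⟨y, hy⟩ : aclF k T) : k[X] →ₐ[k] aclF k T).toRingHom, ?_, ?_⟩
  · intro h0
    have hprim : (F i).IsPrimitive := (hirr i).isPrimitive (hdegx i).ne'
    have : IsUnit (minpoly k (⟨y, hy⟩ : aclF k T)) := by
      apply hprim
      rw [C_dvd_iff_dvd_coeff]
      intro j
      apply minpoly.dvd
      have := congrArg (fun q => q.coeff j) h0
      simpa using this
    exact minpoly.not_isUnit _ _ this
  · rw [aeval_def, eval₂_map]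
    rw [← hi]
    simp only [ev, coe_eval₂RingHom]
    congr 1
    ext a
    · simp [← IsScalarTower.algebraMap_apply k (aclF k T) K]
    · simp

lemma lift_one {m : ℕ} {F : Fin m → k[X][X]}
    (hdegx : ∀ i, 0 < (F i).natDegree) (hirr : ∀ i, Irreducible (F i)) {T : Set K} 
    (y : aclF k T) (g : K[X]) (h1 : (X - C (y : K)) ∣ eval g (exq K (∏ i, F i))) :
    ∃ r : (aclF k T)[X], (X - C (y : K)) ∣ g - r.map (algebraMap _ K) := by
  rw [dvd_iff_isRoot, IsRoot, eval_eval_exq] at h1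
  have := x_mem hdegx hirr y.2 h1
  refine ⟨C ⟨_, this⟩, ?_⟩
  rw [dvd_iff_isRoot, IsRoot]
  simp only [map_C, eval_sub, eval_C]
  exact sub_self _

lemma lift_pow {m : ℕ} {F : Fin m → k[X][X]}
    (hdegx : ∀ i, 0 < (F i).natDegree)
    (hnonassoc : ∀ i j, i ≠ j → ¬ Associated (F i) (F j))
    (hirr : ∀ i, Irreducible (F i)) (hsep : ∀ i, derivative (F i) ≠ 0) {T : Set K} 
    (y : aclF k T) (hy : Transcendental k (y : K)) (g : K[X]) (e : ℕ)
    (h1 : (X - C (y : K)) ^ (e + 1) ∣ eval g (exq K (∏ i, F i))) :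
    ∃ r : (aclF k T)[X], (X - C (y : K)) ^ (e + 1) ∣ g - r.map (algebraMap _ K) := by
  induction e with
  | zero => 
    rw [zero_add, pow_one] at h1 ⊢
    exact lift_one hdegx hirr y g h1
  | succ e ih =>
    obtain ⟨r, hr⟩ := ih ((pow_dvd_pow _ (Nat.le_succ _)).trans h1)
    refine hensel_step _ _ g y (e + 1) (by omega) r hr h1 ?_
    apply ev_derivative_ne_zero hdegx hnonassoc hirr hsep hy
    rw [← eval_eval_exq, ← IsRoot, ← dvd_iff_isRoot]
    exact (dvd_pow_self _ (by omega)).trans h1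

lemma comb {n : ℕ} {g : K[X]} (hg : g.natDegree ≤ n)
    (hgen : ∀ T : Finset K, (∀ i, g.coeff i ∈ aclF k (T : Set K)) → n ≤ T.card)
    (T : Finset K) (y z : aclF k (T : Set K)) (hyz : (y : K) ≠ z) (a b : ℕ) (hab : a + b ≤ n + 1)
    (h1 : ∃ r : (aclF k (T : Set K))[X], (X - C (y : K)) ^ a ∣ g - r.map (algebraMap _ K))
    (h2 : ∃ r : (aclF k (T : Set K))[X], (X - C (z : K)) ^ b ∣ g - r.map (algebraMap _ K)) :
    a + b ≤ T.card + 1 := by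
  obtain ⟨r, hr⟩ := h1
  obtain ⟨s, hs⟩ := h2
  have hcop : IsCoprime ((X - C y) ^ a) ((X - C z) ^ b) := by
    apply IsCoprime.pow
    apply isCoprime_X_sub_C_of_isUnit_sub
    rw [isUnit_iff_ne_zero, sub_ne_zero]
    intro h; exact hyz (by rw [h])
  have e : ∀ (w : aclF k (T : Set K)) (c : ℕ),
      ((X - C w) ^ c).map (algebraMap (aclF k (T : Set K)) K) = (X - C (w : K)) ^ c := by
    intro w c
    simp only [Polynomial.map_pow, Polynomial.map_sub, map_X, map_C]
    rfl
  obtain ⟨w, hw⟩ := crt _ g _ _ r s hcop (by rw [e]; exact hr) (by rw [e]; exact hs)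
  have hm1 : ((X - C y) ^ a).Monic := (monic_X_sub_C y).pow a
  have hm2 : ((X - C z) ^ b).Monic := (monic_X_sub_C z).pow b
  have hnd : ((X - C y) ^ a * (X - C z) ^ b).natDegree = a + b := by
    rw [hm1.natDegree_mul hm2, natDegree_pow, natDegree_pow]; simp
  have := dim_count hg hgen T _ w (hm1.mul hm2) (by rw [hnd]; exact hab) hw
  rwa [hnd] at this

lemma comb1 {n : ℕ} {g : K[X]} (hg : g.natDegree ≤ n)
    (hgen : ∀ T : Finset K, (∀ i, g.coeff i ∈ aclF k (T : Set K)) → n ≤ T.card)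
    (T : Finset K) (y : aclF k (T : Set K)) (a : ℕ) (hab : a ≤ n + 1)
    (h1 : ∃ r : (aclF k (T : Set K))[X], (X - C (y : K)) ^ a ∣ g - r.map (algebraMap _ K)) :
    a ≤ T.card + 1 := by
  obtain ⟨r, hr⟩ := h1
  have hm1 : ((X - C y) ^ a).Monic := (monic_X_sub_C y).pow a
  have hnd : ((X - C y) ^ a).natDegree = a := by
    rw [natDegree_pow]; simp
  have := dim_count hg hgen T _ r hm1 (by rw [hnd]; exact hab) (by
    simp only [Polynomial.map_pow, Polynomial.map_sub, map_X, map_C]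
    exact hr)
  rwa [hnd] at this

lemma mult_zero (G : k[X][X]) (hG : G ≠ 0) (h : K[X]) (hc : Transcendental k (h.coeff 0)) :
    rootMultiplicity 0 (eval (X * h) (exq K G)) =
      sInf {d : ℕ | ∃ j l, j + l = d ∧ (G.coeff j).coeff l ≠ 0} := by
  classical
  set S := {d : ℕ | ∃ j l, j + l = d ∧ (G.coeff j).coeff l ≠ 0} with hS
  have hSne : S.Nonempty := by
    by_contra hne
    apply hG
    ext j l
    by_contra hjl
    exact hne ⟨j + l, j, l, rfl, by simpa using hjl⟩
  set m := sInf S with hm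
  have hlow : ∀ j l, j + l < m → (G.coeff j).coeff l = 0 := by
    intro j l hjl
    by_contra hne
    exact Nat.notMem_of_lt_sInf hjl ⟨j, l, rfl, hne⟩
  obtain ⟨j₀, l₀, hjl, hne⟩ := Nat.sInf_mem hSne
  have hdvd : ∀ j, ∃ u : k[X], G.coeff j = X ^ (m - j) * u := by
    intro j
    have : X ^ (m - j) ∣ G.coeff j := by
      rw [X_pow_dvd_iff]
      intro l hl
      exact hlow j l (by omega)
    exact this
  choose u hu using hdvd
  set w : K[X] := ∑ j ∈ Finset.range (G.natDegree + 1),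
    (u j).map (algebraMap k K) * h ^ j * X ^ (j - m) with hw
  have hfac : eval (X * h) (exq K G) = X ^ m * w := by
    simp only [exq, coe_mapRingHom]
    rw [eval_map, eval₂_eq_sum_range, hw, Finset.mul_sum]
    refine Finset.sum_congr rfl fun j _ => ?_
    rw [hu j, coe_mapRingHom, Polynomial.map_mul, Polynomial.map_pow, map_X, mul_pow]
    have : (X : K[X]) ^ (m - j) * X ^ j = X ^ m * X ^ (j - m) := by
      rw [← pow_add, ← pow_add]; congr 1; omega
    linear_combination (map (algebraMap k K) (u j) * h ^ j) * this
  have hw0 : eval 0 w ≠ 0 := by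
    set P : k[X] := ∑ j ∈ Finset.range (m + 1), C ((G.coeff j).coeff (m - j)) * X ^ j with hP
    have hPc : ∀ j ≤ m, P.coeff j = (G.coeff j).coeff (m - j) := by
      intro j hj
      rw [hP, finsetSum_coeff]
      simp only [coeff_C_mul, coeff_X_pow, mul_ite, mul_one, mul_zero]
      rw [Finset.sum_ite_eq]
      simp [Nat.lt_succ_of_le hj]
    have hP0 : P ≠ 0 := by
      intro h0
      have := hPc j₀ (by omega)
      rw [h0, show m - j₀ = l₀ by omega] at this
      exact hne (by simpa using this.symm)
    have hev : eval 0 w = aeval (h.coeff 0) P := by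
      rw [hw, eval_finsetSum, hP, map_sum]
      have key : ∀ j, j ≤ m → eval 0 ((u j).map (algebraMap k K) * h ^ j * X ^ (j - m)) =
          aeval (h.coeff 0) (C ((G.coeff j).coeff (m - j)) * X ^ j) := by
        intro j hj
        have : (G.coeff j).coeff (m - j) = (u j).coeff 0 := by
          rw [hu j]
          simpa using coeff_X_pow_mul (u j) (m - j) 0
        rw [this, show j - m = 0 by omega]
        rw [pow_zero, mul_one, eval_mul, eval_pow, ← coeff_zero_eq_eval_zero,
          ← coeff_zero_eq_eval_zero, coeff_map, map_mul, map_pow, aeval_C, aeval_X]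
      have key2 : ∀ j, m < j → eval 0 ((u j).map (algebraMap k K) * h ^ j * X ^ (j - m)) = 0 := by
        intro j hj
        simp [show j - m ≠ 0 by omega]
      have key3 : ∀ j, G.natDegree < j → 
          eval 0 ((u j).map (algebraMap k K) * h ^ j * X ^ (j - m)) = 0 := by
        intro j hj
        have : u j = 0 := by
          have h0 : G.coeff j = 0 := coeff_eq_zero_of_natDegree_lt hj
          rw [hu j] at h0
          simpa using h0
        simp [this]
      rw [← Finset.sum_congr rfl (fun j hj => key j (by simpa [Nat.lt_succ_iff] using hj))]
      rcases le_total (G.natDegree + 1) (m + 1) with hle | hle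
      · refine Finset.sum_subset (Finset.range_mono hle) fun j _ hj => key3 j ?_
        simpa [Nat.lt_succ_iff] using hj
      · refine (Finset.sum_subset (Finset.range_mono hle) fun j _ hj => key2 j ?_).symm
        simpa [Nat.lt_succ_iff] using hj
    rw [hev]
    intro h0
    exact hc ⟨P, hP0, h0⟩
  have hw00 : w ≠ 0 := by rintro h0; rw [h0] at hw0; simp at hw0
  rw [hfac, rootMultiplicity_mul (mul_ne_zero (pow_ne_zero _ X_ne_zero) hw00),
    rootMultiplicity_eq_zero (p := w) hw0]
  have := rootMultiplicity_X_sub_C_pow (0 : K) m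
  simpa using this

lemma mult_eq (F : k[X][X]) (hF : F ≠ 0) (g : K[X]) (τ ξ : k) 
    (hg : eval (algebraMap k K τ) g = algebraMap k K ξ)
    (hc : Transcendental k (eval (algebraMap k K τ) (derivative g))) :
    rootMultiplicity (algebraMap k K τ) (eval g (exq K F)) = multAt F τ ξ := by
  rw [rootMultiplicity_eq_rootMultiplicity]
  set G := ((F.map (aeval (X + C τ) : k[X] →ₐ[k] k[X]).toRingHom).comp (X + C (C ξ))) with hG
  have hinj : Function.Injective (aeval (X + C τ) : k[X] →ₐ[k] k[X]).toRingHom := by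
    intro p q hpq
    have h1 : p.comp (X + C τ) = q.comp (X + C τ) := hpq
    have := congrArg (fun s => s.comp (X - C τ)) h1
    simpa [comp_assoc] using this
  have hG0 : G ≠ 0 := by
    rw [hG]
    intro h0
    rw [comp_X_add_C_eq_zero_iff, Polynomial.map_eq_zero_iff hinj] at h0
    exact hF h0
  have hdv : X ∣ g.comp (X + C (algebraMap k K τ)) - C (algebraMap k K ξ) := by
    rw [X_dvd_iff, coeff_zero_eq_eval_zero]
    simp [hg]
  obtain ⟨h, hh⟩ := hdv
  have hgc : g.comp (X + C (algebraMap k K τ)) = X * h + C (algebraMap k K ξ) := by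
    rw [← hh]; ring
  have hd : h.coeff 0 = eval (algebraMap k K τ) (derivative g) := by
    have := congrArg (fun q => eval 0 (derivative q)) hgc
    simp [derivative_comp] at this
    rw [coeff_zero_eq_eval_zero, ← this]
  have := mult_zero G hG0 h (by rw [hd]; exact hc)
  unfold multAt
  rw [← this]
  congr 1
  have e1 : (eval g (exq K F)).comp (X + C (algebraMap k K τ)) =
      eval₂ ((compRingHom (X + C (algebraMap k K τ))).comp (mapRingHom (algebraMap k K)))
        (g.comp (X + C (algebraMap k K τ))) F := by
    simp only [exq, coe_mapRingHom]
    rw [eval_map, ← coe_compRingHom_apply, hom_eval₂]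
    rfl
  rw [e1, hG]
  simp only [exq, coe_mapRingHom]
  rw [eval_map, eval₂_comp, eval₂_map, hgc]
  congr 1
  · ext <;> simp
  · simp

lemma sq_dvd (g : K[X]) (t : K) :
    (X - C t) ^ 2 ∣ g - (C (eval t g) + C (eval t (derivative g)) * (X - C t)) := by
  have h1 : X - C t ∣ g - (C (eval t g) + C (eval t (derivative g)) * (X - C t)) := by
    rw [dvd_iff_isRoot]; simp
  obtain ⟨q, hq⟩ := h1
  have h2 := congrArg (fun f => eval t (derivative f)) hq
  have h3 : X - C t ∣ q := by
    rw [dvd_iff_isRoot, IsRoot]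
    simpa using h2.symm
  rw [hq, pow_two]
  exact mul_dvd_mul_left _ h3

lemma ev_algebraMap (P : k[X][X]) (τ ξ : k) :
    ev (algebraMap k K τ) (algebraMap k K ξ) P = algebraMap k K (eval τ (eval (C ξ) P)) := by
  have : algebraMap k K (eval τ (eval (C ξ) P)) =
      ((algebraMap k K).comp (evalRingHom τ)) (eval₂ (RingHom.id _) (C ξ) P) := rfl
  rw [this, hom_eval₂]
  simp only [ev, coe_eval₂RingHom]
  congr 1
  · ext <;> simp
  · simp

lemma trichotomy [IsAlgClosed k] {m : ℕ} {F : Fin m → k[X][X]}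
    (hdegx : ∀ i, 0 < (F i).natDegree)
    (hnonassoc : ∀ i j, i ≠ j → ¬ Associated (F i) (F j))
    (hirr : ∀ i, Irreducible (F i)) (hsep : ∀ i, derivative (F i) ≠ 0)
    {n : ℕ} (hn : 3 ≤ n) {g : K[X]} (hg : g.natDegree ≤ n)
    (hgen : ∀ T : Finset K, (∀ i, g.coeff i ∈ aclF k (T : Set K)) → n ≤ T.card) :
    eval g (exq K (∏ i, F i)) ≠ 0 ∧
    ((∀ y : K, (eval g (exq K (∏ i, F i))).rootMultiplicity y ≤ 1) ∨
     (∃ y : K, (eval g (exq K (∏ i, F i))).rootMultiplicity y = 2 ∧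
        ∀ y' : K, y' ≠ y → (eval g (exq K (∏ i, F i))).rootMultiplicity y' ≤ 1) ∨
     (∃ τ ξ : k, eval τ (eval (C ξ) (∏ i, F i)) = 0 ∧
        eval (algebraMap k K τ) g = algebraMap k K ξ ∧
        (eval g (exq K (∏ i, F i))).rootMultiplicity (algebraMap k K τ) = 
          multAt (∏ i, F i) τ ξ ∧
        ∀ y : K, y ≠ algebraMap k K τ → 
          (eval g (exq K (∏ i, F i))).rootMultiplicity y ≤ 1)) := by
  classical
  set Fg := eval g (exq K (∏ i, F i)) with hFg
  have halg : ∀ y : K, ¬ Transcendental k y → ∃ τ : k, algebraMap k K τ = y := by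
    intro y hy
    have : IsAlgebraic k y := by simpa [Transcendental] using hy
    have hyI := this.isIntegral
    exact minpoly.mem_range_of_degree_eq_one k y
      (IsAlgClosed.degree_eq_one_of_irreducible k (minpoly.irreducible hyI))
  have hmem : ∀ (T : Set K) (τ : k), algebraMap k K τ ∈ aclF k T := 
    fun T τ => (aclF k T).algebraMap_mem τ
  -- two algebraic roots
  have E1 : ∀ τ σ : k, τ ≠ σ → X - C (algebraMap k K τ) ∣ Fg → X - C (algebraMap k K σ) ∣ Fg → 
      False := by
    intro τ σ hne h1 h2
    have := comb hg hgen ∅ ⟨_, hmem _ τ⟩ ⟨_, hmem _ σ⟩ 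
      (fun h => hne ((algebraMap k K).injective h)) 1 1 (by omega)
      (by simpa only [pow_one] using lift_one hdegx hirr ⟨_, hmem _ τ⟩ g h1)
      (by simpa only [pow_one] using lift_one hdegx hirr ⟨_, hmem _ σ⟩ g h2)
    simp at this
  have E2 : ∀ (y : K) (τ : k), Transcendental k y → (X - C y) ^ 2 ∣ Fg → 
      X - C (algebraMap k K τ) ∣ Fg → False := by
    intro y τ hy h1 h2
    have hy' : y ∈ aclF k (({y} : Finset K) : Set K) := subset_aclF _ (by simp)
    have := comb hg hgen {y} ⟨y, hy'⟩ ⟨_, hmem _ τ⟩ 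
      (by
        intro h
        apply hy
        rw [show y = algebraMap k K τ from h]
        exact (isAlgebraic_algebraMap τ)) 2 1 (by omega)
      (lift_pow hdegx hnonassoc hirr hsep ⟨y, hy'⟩ hy g 1 h1)
      (by simpa only [pow_one] using lift_one hdegx hirr ⟨_, hmem _ τ⟩ g h2)
    simp at this
  have E3 : ∀ (y z : K), y ≠ z → Transcendental k y → Transcendental k z → 
      (X - C y) ^ 2 ∣ Fg → (X - C z) ^ 2 ∣ Fg → False := by
    intro y z hne hy hz h1 h2
    have hy' : y ∈ aclF k (({y, z} : Finset K) : Set K) := subset_aclF _ (by simp)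
    have hz' : z ∈ aclF k (({y, z} : Finset K) : Set K) := subset_aclF _ (by simp)
    have := comb hg hgen {y, z} ⟨y, hy'⟩ ⟨z, hz'⟩ hne 2 2 (by omega)
      (lift_pow hdegx hnonassoc hirr hsep ⟨y, hy'⟩ hy g 1 h1)
      (lift_pow hdegx hnonassoc hirr hsep ⟨z, hz'⟩ hz g 1 h2)
    have h3 := Finset.card_le_two (a := y) (b := z)
    omega
  have E4 : ∀ (y : K), Transcendental k y → (X - C y) ^ 3 ∣ Fg → False := by
    intro y hy h1
    have hy' : y ∈ aclF k (({y} : Finset K) : Set K) := subset_aclF _ (by simp)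
    have := comb1 hg hgen {y} ⟨y, hy'⟩ 3 (by omega)
      (lift_pow hdegx hnonassoc hirr hsep ⟨y, hy'⟩ hy g 2 h1)
    simp at this
  have hne : Fg ≠ 0 := by
    intro h0
    apply E1 0 1 zero_ne_one <;> rw [h0] <;> exact dvd_zero _
  refine ⟨hne, ?_⟩
  have hle : ∀ y, ¬ (X - C y) ^ 2 ∣ Fg → Fg.rootMultiplicity y ≤ 1 := by
    intro y hy
    by_contra hlt
    exact hy ((le_rootMultiplicity_iff hne).1 (by omega))
  by_cases hA : ∀ y : K, ¬ (X - C y) ^ 2 ∣ Fg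
  · exact Or.inl fun y => hle y (hA y)
  push Not at hA
  obtain ⟨y, hy⟩ := hA
  have hy1 : X - C y ∣ Fg := (dvd_pow_self _ two_ne_zero).trans hy
  by_cases htr : Transcendental k y
  · refine Or.inr (Or.inl ⟨y, ?_, ?_⟩)
    · apply le_antisymm
      · by_contra hlt
        exact E4 y htr ((le_rootMultiplicity_iff hne).1 (by omega))
      · exact (le_rootMultiplicity_iff hne).2 hy
    · intro z hz
      apply hle
      intro hz2
      by_cases htz : Transcendental k z
      · exact E3 y z hz.symm htr htz hy hz2
      · obtain ⟨σ, rfl⟩ := halg z htz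
        exact E2 y σ htr hy ((dvd_pow_self _ two_ne_zero).trans hz2)
  · obtain ⟨τ, rfl⟩ := halg y htr
    have hroot := hy1
    rw [dvd_iff_isRoot, IsRoot, hFg, eval_eval_exq] at hroot
    have hxm := x_mem (T := ∅) hdegx hirr (hmem _ τ) hroot
    obtain ⟨ξ, hξ⟩ : ∃ ξ : k, algebraMap k K ξ = eval (algebraMap k K τ) g := by
      apply halg
      rw [mem_aclF] at hxm
      have : Algebra.IsAlgebraic k (IntermediateField.adjoin k (∅ : Set K)) :=
        (IntermediateField.isAlgebraic_adjoin_iff_isAlgebraic k K).2 (by simp)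
      exact fun h => h (hxm.restrictScalars k)
    have hE5 : Transcendental k (eval (algebraMap k K τ) (derivative g)) := by
      by_contra hntr
      obtain ⟨δ, hδ⟩ := halg _ hntr
      have := comb1 hg hgen ∅ ⟨_, hmem _ τ⟩ 2 (by omega) 
        ⟨(C ξ + C δ * (X - C τ)).map (algebraMap k _), by
          rw [Polynomial.map_map, ← IsScalarTower.algebraMap_eq]
          simp only [Polynomial.map_add, Polynomial.map_mul, Polynomial.map_sub, map_C, map_X, 
            hξ, hδ]
          exact sq_dvd g _⟩
      simp at this
    refine Or.inr (Or.inr ⟨τ, ξ, ?_, hξ.symm, ?_, ?_⟩)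
    · apply (algebraMap k K).injective
      rw [map_zero, ← hroot, ← hξ, ev_algebraMap]
    · exact mult_eq _ (Finset.prod_ne_zero_iff.2 fun i _ => (hirr i).ne_zero) g τ ξ hξ.symm hE5
    · intro z hz
      apply hle
      intro hz2
      by_cases htz : Transcendental k z
      · exact E2 z τ htz hz2 hy1
      · obtain ⟨σ, rfl⟩ := halg z htz
        exact E1 τ σ (fun h => hz (by rw [h])) hy1 ((dvd_pow_self _ two_ne_zero).trans hz2)

lemma gen_alg_indep {n : ℕ} {H : MvPolynomial (Fin (n + 1)) k} (hH : Irreducible H)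
    (b : Fin (n + 1) → K) 
    (hker : ∀ G : MvPolynomial (Fin (n + 1)) k, MvPolynomial.aeval b G = 0 → H ∣ G) 
    (T : Finset K) (hT : ∀ j, b j ∈ aclF k (T : Set K)) : n ≤ T.card := by
  classical
  have hne : H.vars.Nonempty := by
    rw [Finset.nonempty_iff_ne_empty]
    intro h0
    have h1 : H.totalDegree = 0 := by
      rw [MvPolynomial.totalDegree_eq_zero_iff_eq_C]
      exact MvPolynomial.vars_eq_empty_iff_eq_C.1 h0
    exact hH.not_isUnit (MvPolynomial.isUnit_iff_totalDegree_of_isReduced.2 ⟨by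
      rw [isUnit_iff_ne_zero]
      intro h2
      rw [MvPolynomial.totalDegree_eq_zero_iff_eq_C.1 h1, h2] at hH
      simp at hH, h1⟩)
  obtain ⟨i, hi⟩ := hne
  have hdeg : ∀ G : MvPolynomial (Fin (n + 1)) k, G.degreeOf i = 0 ↔ i ∉ G.vars := by
    intro G
    rw [MvPolynomial.degreeOf_def, Multiset.count_eq_zero, MvPolynomial.vars_def,
      Multiset.mem_toFinset]
  have hind : AlgebraicIndependent k (fun j : {j : Fin (n + 1) // j ≠ i} => b j) := by
    rw [algebraicIndependent_iff]
    intro P hP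
    by_contra hP0
    have h1 : MvPolynomial.aeval b (MvPolynomial.rename Subtype.val P) = 0 := by
      rw [MvPolynomial.aeval_rename]; exact hP
    have h2 : MvPolynomial.rename Subtype.val P ≠ 0 := by
      intro h; apply hP0
      exact MvPolynomial.rename_injective _ Subtype.val_injective (by simpa using h)
    obtain ⟨Q, hQ⟩ := hker _ h1
    have h3 : (MvPolynomial.rename Subtype.val P).degreeOf i = 0 := by
      rw [hdeg]
      intro hmem
      have := MvPolynomial.vars_rename _ _ hmem
      simp at this
    rw [hQ] at h2 h3
    rw [MvPolynomial.degreeOf_mul_eq (left_ne_zero_of_mul h2) (right_ne_zero_of_mul h2)] at h3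
    exact (hdeg H).1 (by omega) hi
  have := card_le_of_mem_aclF hind (T := T) (fun j => hT j)
  simpa using this

lemma assoc_lin {n : ℕ} {H : MvPolynomial (Fin (n + 1)) k} (hH : Irreducible H) (τ ξ : k)
    (hd : H ∣ (∑ j : Fin (n + 1),
            MvPolynomial.C (τ ^ (j : ℕ)) * MvPolynomial.X j) - MvPolynomial.C ξ) :
    Associated H ((∑ j : Fin (n + 1),
            MvPolynomial.C (τ ^ (j : ℕ)) * MvPolynomial.X j) - MvPolynomial.C ξ) := by
  classical
  set ℓ : MvPolynomial (Fin (n + 1)) k := (∑ j : Fin (n + 1),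
            MvPolynomial.C (τ ^ (j : ℕ)) * MvPolynomial.X j) - MvPolynomial.C ξ with hℓ
  have hne : ℓ ≠ 0 := by
    intro h0
    have h1 := congrArg (MvPolynomial.eval (fun j => if j = 0 then ξ + 1 else 0)) h0
    simp [hℓ] at h1
  have hdeg : ℓ.totalDegree ≤ 1 := by
    refine (MvPolynomial.totalDegree_sub _ _).trans (max_le ?_ (by simp))
    refine MvPolynomial.totalDegree_finsetSum_le fun j _ => ?_
    refine (MvPolynomial.totalDegree_mul _ _).trans ?_
    rw [MvPolynomial.totalDegree_C, MvPolynomial.totalDegree_X]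
  obtain ⟨Q, hQ⟩ := hd
  rw [hQ] at hne hdeg
  have hQ0 := right_ne_zero_of_mul hne
  rw [MvPolynomial.totalDegree_mul_of_isDomain hH.ne_zero hQ0] at hdeg
  have hunit : ∀ G : MvPolynomial (Fin (n + 1)) k, G ≠ 0 → G.totalDegree = 0 → IsUnit G := by
    intro G hG hG0
    rw [MvPolynomial.totalDegree_eq_zero_iff_eq_C] at hG0
    rw [hG0]
    apply IsUnit.map
    rw [isUnit_iff_ne_zero]
    intro h; rw [h] at hG0; simp at hG0; exact hG hG0
  have hHd : H.totalDegree ≠ 0 := fun h => hH.not_isUnit (hunit H hH.ne_zero h)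
  rw [hQ]
  exact (associated_mul_unit_right H Q (hunit Q hQ0 (by omega)))

end aux

theorem key_trichotomy_for_specialized_discriminant
    (p : ℕ) [Fact (Nat.Prime p)] (m : ℕ) (hm : 1 ≤ m) (n : ℕ) (hn : 3 ≤ n)
    (F : Fin m → Polynomial (Polynomial (AlgebraicClosure (ZMod p))))
    (hdegx : ∀ i, 0 < (F i).natDegree)
    (hnonassoc : ∀ i j, i ≠ j → ¬ Associated (F i) (F j))
    (hirr : ∀ i, Irreducible (F i))
    (hsep : ∀ i, ∀ G : Polynomial (Polynomial (AlgebraicClosure (ZMod p))),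
      F i ≠ G.comp (Polynomial.X ^ p))
    (H : MvPolynomial (Fin (n + 1)) (AlgebraicClosure (ZMod p)))
    (hH : Irreducible H)
    (hHnot : H ∉ Algebra.adjoin (AlgebraicClosure (ZMod p))
      ({MvPolynomial.X (Fin.last n)} : Set (MvPolynomial (Fin (n + 1)) (AlgebraicClosure (ZMod p)))))
    (K : Type) [Field K] [IsAlgClosed K]
    (φ : MvPolynomial (Fin (n + 1)) (AlgebraicClosure (ZMod p)) →+* K)
    (hker : RingHom.ker φ = Ideal.span {H}) :
    let k := AlgebraicClosure (ZMod p)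
    let g : Polynomial K := ∑ j : Fin (n + 1), Polynomial.C (φ (MvPolynomial.X j)) * Polynomial.X ^ (j : ℕ)
    let Fg : Polynomial K := Polynomial.eval g ((∏ i, F i).map
      (Polynomial.mapRingHom (φ.comp (MvPolynomial.C))))
    Fg ≠ 0 ∧
    ((∀ y : K, Fg.rootMultiplicity y ≤ 1) ∨
     (∃ y : K, Fg.rootMultiplicity y = 2 ∧
        ∀ y' : K, y' ≠ y → Fg.rootMultiplicity y' ≤ 1) ∨
     (∃ τ ξ : k,
        Polynomial.eval τ (Polynomial.eval (Polynomial.C ξ) (∏ i, F i)) = 0 ∧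
        Associated H ((∑ j : Fin (n + 1),
            MvPolynomial.C (τ ^ (j : ℕ)) * MvPolynomial.X j) - MvPolynomial.C ξ) ∧
        Fg.rootMultiplicity (φ (MvPolynomial.C τ)) = multAt (∏ i, F i) τ ξ ∧
        ∀ y : K, y ≠ φ (MvPolynomial.C τ) → Fg.rootMultiplicity y ≤ 1)) := by
  intro k g Fg
  letI : Algebra k K := (φ.comp MvPolynomial.C).toAlgebra
  have hmap : ∀ c : k, algebraMap k K c = φ (MvPolynomial.C c) := fun c => rfl
  set b : Fin (n + 1) → K := fun j => φ (MvPolynomial.X j) with hb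
  have haev : ∀ G : MvPolynomial (Fin (n + 1)) k, MvPolynomial.aeval b G = φ G := by
    intro G
    have : ((MvPolynomial.aeval b : MvPolynomial (Fin (n + 1)) k →ₐ[k] K) : 
        MvPolynomial (Fin (n + 1)) k →+* K) = φ := by
      apply MvPolynomial.ringHom_ext
      · intro c
        simp [hmap]
      · intro i
        simp [hb]
    exact congrArg (fun f => f G) this
  have hdvd : ∀ G : MvPolynomial (Fin (n + 1)) k, φ G = 0 → H ∣ G := by
    intro G hG
    rw [← RingHom.mem_ker, hker, Ideal.mem_span_singleton] at hG
    exact hG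
  have hsep' : ∀ i, derivative (F i) ≠ 0 := by
    intro i h0
    have hp : p ≠ 0 := (Fact.out : Nat.Prime p).ne_zero
    haveI : CharP (AlgebraicClosure (ZMod p))[X] p := inferInstance
    exact hsep i (contract p (F i)) (by
      rw [← expand_eq_comp_X_pow, expand_contract p h0 hp])
  have hcoeff : ∀ j : Fin (n + 1), g.coeff j = b j := by
    intro j
    simp only [g, finsetSum_coeff, coeff_C_mul, coeff_X_pow]
    rw [Finset.sum_eq_single j]
    · simp [hb]
    · intro i _ hij
      have : (j : ℕ) ≠ i := fun h => hij (Fin.ext h.symm)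
      simp [this]
    · simp
  have hg : g.natDegree ≤ n := by
    refine natDegree_sum_le_of_forall_le _ _ fun j _ => ?_
    refine (natDegree_C_mul_X_pow_le _ _).trans ?_
    omega
  have hgen : ∀ T : Finset K, (∀ i, g.coeff i ∈ aclF k (T : Set K)) → n ≤ T.card := by
    intro T hT
    refine gen_alg_indep hH b (fun G hG => hdvd G (by rw [← haev]; exact hG)) T fun j => ?_
    rw [← hcoeff]
    exact hT j
  have hk : IsAlgClosed k := inferInstance
  obtain ⟨h1, h2⟩ := trichotomy (k := k) hdegx hnonassoc hirr hsep' hn hg hgen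
  refine ⟨h1, ?_⟩
  rcases h2 with h2 | h2 | ⟨τ, ξ, h2, h3, h4, h5⟩
  · exact Or.inl h2
  · exact Or.inr (Or.inl h2)
  · refine Or.inr (Or.inr ⟨τ, ξ, h2, ?_, h4, h5⟩)
    apply assoc_lin hH
    apply hdvd
    rw [hmap, hmap] at h3
    rw [map_sub, ← h3, map_sum, sub_eq_zero]
    simp only [g, eval_finsetSum]
    refine Finset.sum_congr rfl fun j _ => ?_
    rw [map_mul, eval_mul, eval_C, eval_pow, eval_X, map_pow, map_pow, mul_comm]
end

section
/- Let p be a prime, k the algebraic closure of F_p, and F_1 ∈ k[t][x] an irreducible polynomial with deg_x F_1 > 0, separable over k(t). Let n ≥ 3, let a_0,…,a_n be algebraically independent variables over k, and f♯ = Σ_{j=0}^n a_j t^j. Let τ_0,…,τ_{n−2} ∈ k be pairwise distinct and ξ_0,…,ξ_{n−2} ∈ k arbitrary, set a_l' = f♯(τ_l) − ξ_l for 0 ≤ l ≤ n−2, and K = k(a_0',…,a_{n−2}', a_n) (so that a_0',…,a_{n−2}', a_{n−1}, a_n is obtained from a_0,…,a_n by an invertible affine change of coordinates and k(a_0,…,a_n)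 = K(a_{n−1})). Then the polynomial F_1(t, f♯), considered as an element of K[t, a_{n−1}], is irreducible over the algebraic closure of K. -/
open Polynomial

lemma exists_algHom_of_field {k : Type*} (L : Type*) [Field k] [IsAlgClosed k] [Field L]
    [Algebra k L] [Algebra.FiniteType k L] : Nonempty (L →ₐ[k] k) := by
  have : Module.Finite k L := finite_of_finite_type_of_isJacobsonRing k L
  exact ⟨IsAlgClosed.lift⟩

lemma exists_algHom_of_adjoin {k E : Type*} [Field k] [IsAlgClosed k] [Field E] [Algebra k E]
    (S : Finset E) : Nonempty (Algebra.adjoin k (S : Set E) →ₐ[k] k) := by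
  set A := Algebra.adjoin k (S : Set E)
  have hft : Algebra.FiniteType k A :=
    (Subalgebra.fg_iff_finiteType A).1 ⟨S, rfl⟩
  obtain ⟨m, hm⟩ := Ideal.exists_maximal A
  let := Ideal.Quotient.field m
  have : Algebra.FiniteType k (A ⧸ m) :=
    Algebra.FiniteType.of_surjective (Ideal.Quotient.mkₐ k m) (Ideal.Quotient.mkₐ_surjective k m)
  obtain ⟨f⟩ := exists_algHom_of_field (k := k) (A ⧸ m)
  exact ⟨f.comp (Ideal.Quotient.mkₐ k m)⟩

lemma exists_coeff_ne_zero {E : Type*} [Field E] (G : E[X][X]) (h0 : G ≠ 0) (hu : ¬ IsUnit G) :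
    ∃ i j, (i ≠ 0 ∨ j ≠ 0) ∧ (G.coeff i).coeff j ≠ 0 := by
  by_contra! h
  have : G = C (C ((G.coeff 0).coeff 0)) := by
    ext i j
    by_cases hi : i = 0
    · subst hi
      by_cases hj : j = 0
      · subst hj; simp
      · rw [h 0 j (Or.inr hj)]; simp [coeff_C, hj]
    · rw [h i j (Or.inl hi)]; simp [coeff_C, hi]
  apply hu
  rw [this]
  refine IsUnit.map C (IsUnit.map C (isUnit_iff_ne_zero.2 ?_))
  intro h
  rw [h] at this
  simp at this
  exact h0 this

lemma exists_lift {E : Type*} [Field E] {k : Type*} [Field k] [Algebra k E] (A : Subalgebra k E)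
    (G : E[X][X]) (hG : ∀ i j, (G.coeff i).coeff j ∈ A) :
    ∃ G' : A[X][X], G'.map (mapRingHom A.val.toRingHom) = G := by
  have : G ∈ Polynomial.lifts (mapRingHom A.val.toRingHom) := by
    rw [Polynomial.lifts_iff_coeff_lifts]
    intro i
    have : G.coeff i ∈ Polynomial.lifts A.val.toRingHom := by
      rw [Polynomial.lifts_iff_coeff_lifts]
      intro j
      exact ⟨⟨_, hG i j⟩, rfl⟩
    rw [Polynomial.mem_lifts] at this
    exact this
  rw [Polynomial.mem_lifts] at this
  exact this

lemma not_isUnit_of_coeff {k : Type*} [Field k] (G : k[X][X]) (i j : ℕ) (hij : i ≠ 0 ∨ j ≠ 0)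
    (h : (G.coeff i).coeff j ≠ 0) : ¬ IsUnit G := by
  intro hu
  obtain ⟨r, hr, rfl⟩ := Polynomial.isUnit_iff.1 hu
  obtain ⟨s, hs, rfl⟩ := Polynomial.isUnit_iff.1 hr
  apply h
  rcases hij with hi | hj
  · simp [coeff_C, hi]
  · by_cases hi : i = 0 <;> simp [coeff_C, hi, hj]

lemma irreducible_baseChange {k E : Type*} [Field k] [IsAlgClosed k] [Field E] [Algebra k E]
    (F : k[X][X]) (hF : Irreducible F) (hd : 0 < F.natDegree) :
    Irreducible (F.map (mapRingHom (algebraMap k E))) := by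
  have hinj : Function.Injective (mapRingHom (algebraMap k E)) :=
    Polynomial.map_injective _ (algebraMap k E).injective
  have hdeg : (F.map (mapRingHom (algebraMap k E))).natDegree = F.natDegree :=
    natDegree_map_eq_of_injective hinj F
  have hne : F.map (mapRingHom (algebraMap k E)) ≠ 0 := by
    intro h; rw [h] at hdeg; simp at hdeg; omega
  refine ⟨fun hu => ?_, fun G H hGH => ?_⟩
  · have := natDegree_eq_zero_of_isUnit hu
    omega
  by_contra! hcon
  obtain ⟨hGu, hHu⟩ := hcon
  have hG0 : G ≠ 0 := by rintro rfl; simp at hGH; exact hne (by simpa using hGH)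
  have hH0 : H ≠ 0 := by rintro rfl; simp at hGH; exact hne (by simpa using hGH)
  obtain ⟨i, j, hij, hg⟩ := exists_coeff_ne_zero G hG0 hGu
  obtain ⟨i', j', hij', hh⟩ := exists_coeff_ne_zero H hH0 hHu
  classical
  let cf : E[X][X] → Finset E := fun P => P.support.biUnion fun i => (P.coeff i).coeffs
  have hcf : ∀ P : E[X][X], ∀ i j, (P.coeff i).coeff j ≠ 0 → (P.coeff i).coeff j ∈ cf P := by
    intro P i j h
    simp only [cf, Finset.mem_biUnion]
    refine ⟨i, ?_, coeff_mem_coeffs h⟩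
    rw [mem_support_iff]
    intro h'; rw [h'] at h; simp at h
  let S : Finset E := cf G ∪ cf H ∪ {((G.coeff i).coeff j)⁻¹, ((H.coeff i').coeff j')⁻¹}
  obtain ⟨σ⟩ := exists_algHom_of_adjoin (k := k) S
  have hS : ∀ x ∈ S, x ∈ Algebra.adjoin k (S : Set E) := fun x hx =>
    Algebra.subset_adjoin hx
  generalize Algebra.adjoin k (S : Set E) = A at σ hS
  have hGA : ∀ i j, (G.coeff i).coeff j ∈ A := by
    intro i j
    by_cases h : (G.coeff i).coeff j = 0
    · rw [h]; exact A.zero_mem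
    · exact hS _ (by simp [S, hcf G i j h])
  have hHA : ∀ i j, (H.coeff i).coeff j ∈ A := by
    intro i j
    by_cases h : (H.coeff i).coeff j = 0
    · rw [h]; exact A.zero_mem
    · exact hS _ (by simp [S, hcf H i j h])
  have hgi : ((G.coeff i).coeff j)⁻¹ ∈ A := hS _ (by simp [S])
  have hhi : ((H.coeff i').coeff j')⁻¹ ∈ A := hS _ (by simp [S])
  obtain ⟨G', hG'⟩ := exists_lift A G hGA
  obtain ⟨H', hH'⟩ := exists_lift A H hHA
  have key : F.map (mapRingHom (algebraMap k A)) = G' * H' := by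
    have hi2 : Function.Injective (mapRingHom A.val.toRingHom) :=
      Polynomial.map_injective _ Subtype.val_injective
    apply Polynomial.map_injective _ hi2
    rw [Polynomial.map_mul, hG', hH', ← hGH, Polynomial.map_map, mapRingHom_comp]
    rfl
  have key2 : F = G'.map (mapRingHom σ.toRingHom) * H'.map (mapRingHom σ.toRingHom) := by
    rw [← Polynomial.map_mul, ← key, Polynomial.map_map, mapRingHom_comp]
    have : (σ.toRingHom).comp (algebraMap k A) = RingHom.id k := by
      ext x; exact σ.commutes x
    rw [this]; simp
  have nu : ∀ (P : E[X][X]) (P' : A[X][X]) (i j : ℕ), (i ≠ 0 ∨ j ≠ 0) →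
      (P.coeff i).coeff j ≠ 0 → ((P.coeff i).coeff j)⁻¹ ∈ A →
      P'.map (mapRingHom A.val.toRingHom) = P →
      ¬ IsUnit (P'.map (mapRingHom σ.toRingHom)) := by
    rintro P P' i j hij h hinv rfl
    apply not_isUnit_of_coeff _ i j hij
    have : ((P'.coeff i).coeff j) * ⟨_, hinv⟩ = 1 := by
      apply Subtype.ext
      simp only [coeff_map, coe_mapRingHom] at h ⊢
      exact mul_inv_cancel₀ h
    simp only [coeff_map, coe_mapRingHom]
    exact ((IsUnit.of_mul_eq_one _ this).map σ.toRingHom).ne_zero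
  rcases hF.isUnit_or_isUnit key2 with h | h
  · exact nu G G' i j hij hg hgi hG' h
  · exact nu H H' i' j' hij' hh hhi hH' h

lemma map_eval_ne_zero {E : Type*} [Field E] (F : E[X][X]) (hFp : F.IsPrimitive) (θ : E) :
    F.map (evalRingHom θ) ≠ 0 := by
  intro h0
  have : C (X - C θ) ∣ F := by
    rw [C_dvd_iff_dvd_coeff]
    intro i
    rw [dvd_iff_isRoot]
    have := congrArg (fun q => coeff q i) h0
    simpa using this
  exact not_isUnit_X_sub_C θ (hFp _ this)

lemma irreducible_comp_affine {E : Type*} [Field E] [IsAlgClosed E] (F : E[X][X])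
    (hF : Irreducible F) (hd : 0 < F.natDegree) (M c : E[X]) (hM : M ≠ 0)
    (h : ∀ θ, M.eval θ = 0 → (F.map (evalRingHom θ)).eval (c.eval θ) ≠ 0) :
    Irreducible (F.comp (C M * X + C c)) := by
  have hFp : F.IsPrimitive := hF.isPrimitive hd.ne'
  have hP : (F.comp (C M * X + C c)).IsPrimitive := by
    intro r hr
    by_contra hu
    obtain ⟨θ, hθ⟩ := IsAlgClosed.exists_root r
      (fun h => hu (Polynomial.isUnit_iff_degree_eq_zero.2 h))
    have h0 : (F.comp (C M * X + C c)).map (evalRingHom θ) = 0 := by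
      obtain ⟨q, hq⟩ := hr
      rw [hq, Polynomial.map_mul, map_C, coe_evalRingHom, hθ.eq_zero]; simp
    have hFθ : F.map (evalRingHom θ) ≠ 0 := map_eval_ne_zero F hFp θ
    rw [map_comp] at h0
    simp only [Polynomial.map_add, Polynomial.map_mul, map_C, map_X, coe_evalRingHom] at h0
    by_cases hMθ : M.eval θ = 0
    · rw [hMθ] at h0
      simp only [map_zero, zero_mul, zero_add, comp_C] at h0
      exact h θ hMθ (C_eq_zero.1 h0)
    · let := invertibleOfNonzero hMθ
      apply hFθ
      apply (algEquivCMulXAddC (M.eval θ) (c.eval θ)).injective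
      rw [map_zero, algEquivCMulXAddC_apply]
      rw [← h0]; rfl
  rw [hP.irreducible_iff_irreducible_map_fraction_map (K := FractionRing E[X])]
  rw [hFp.irreducible_iff_irreducible_map_fraction_map (K := FractionRing E[X])] at hF
  have hM' : algebraMap E[X] (FractionRing E[X]) M ≠ 0 := by simpa using hM
  let := invertibleOfNonzero hM'
  rw [map_comp]
  simp only [Polynomial.map_add, Polynomial.map_mul, map_C, map_X]
  have := (MulEquiv.irreducible_iff (algEquivCMulXAddC (algebraMap E[X] (FractionRing E[X]) M)
    (algebraMap E[X] (FractionRing E[X]) c))).2 hF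
  rw [algEquivCMulXAddC_apply] at this
  exact this

/-- Lagrange interpolation part. -/
noncomputable def ipol {k R : Type} [Field k] [CommRing R] (e : k →+* R) {m : ℕ}
    (τ : Fin m → k) (v : Fin m → R) : R[X] :=
  ∑ l : Fin m, C (v l) * (Lagrange.basis Finset.univ τ l).map e

/-- Full interpolation polynomial with values `v` at `τ` and top coefficients `a`, `b`. -/
noncomputable def gpol {k R : Type} [Field k] [CommRing R] (e : k →+* R) {m : ℕ}
    (τ : Fin m → k) (v : Fin m → R) (a b : R) : R[X] :=
  ipol e τ v + (Lagrange.nodal Finset.univ τ).map e *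
    (C (a - e ((Lagrange.nodal Finset.univ τ).coeff (m - 1)) * b) + C b * X)

section
variable {k R : Type} [Field k] [CommRing R] (e : k →+* R) {m : ℕ}
    (τ : Fin m → k) (v : Fin m → R) (a b : R)

lemma gpol_map {S : Type} [CommRing S] (f : R →+* S) :
    (gpol e τ v a b).map f = gpol (f.comp e) τ (fun l => f (v l)) (f a) (f b) := by
  simp [gpol, ipol, Polynomial.map_sum, Polynomial.map_map]

lemma gpol_eval (hτ : Function.Injective τ) (l : Fin m) :
    (gpol e τ v a b).eval (e (τ l)) = v l := by
  have h1 : (ipol e τ v).eval (e (τ l)) = v l := by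
    simp only [ipol, eval_finsetSum, eval_mul, eval_C, eval_map, eval₂_hom]
    rw [Finset.sum_eq_single l]
    · rw [Lagrange.eval_basis_self hτ.injOn (Finset.mem_univ _)]; simp
    · intro j _ hj
      rw [Lagrange.eval_basis_of_ne hj (Finset.mem_univ _)]; simp
    · simp
  simp only [gpol, eval_add, eval_mul, h1, eval_map, eval₂_hom]
  rw [Lagrange.eval_nodal_at_node (Finset.mem_univ _)]
  simp

lemma ipol_coeff (hτ : Function.Injective τ) (j : ℕ) (hj : m ≤ j) :
    (ipol e τ v).coeff j = 0 := by
  simp only [ipol, finsetSum_coeff, coeff_C_mul, coeff_map]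
  apply Finset.sum_eq_zero
  intro l _
  rw [coeff_eq_zero_of_natDegree_lt]
  · simp
  · rw [Lagrange.natDegree_basis hτ.injOn (Finset.mem_univ _)]
    have := l.2
    simp; omega

lemma nodal_coeff_gt (j : ℕ) (hj : m < j) : (Lagrange.nodal Finset.univ τ).coeff j = 0 := by
  apply coeff_eq_zero_of_natDegree_lt
  rw [Lagrange.natDegree_nodal]; simpa

lemma nodal_coeff_eq : (Lagrange.nodal Finset.univ τ).coeff m = 1 := by
  have h := Lagrange.nodal_monic (s := Finset.univ) (v := τ)
  have h2 := Lagrange.natDegree_nodal (s := Finset.univ) (v := τ)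
  rw [Monic, leadingCoeff, h2] at h
  simpa using h

lemma gpol_coeff (hm : 0 < m) (hτ : Function.Injective τ) :
    (gpol e τ v a b).coeff m = a ∧ (gpol e τ v a b).coeff (m + 1) = b ∧
    ∀ j, m + 1 < j → (gpol e τ v a b).coeff j = 0 := by
  obtain ⟨m, rfl⟩ : ∃ r, m = r + 1 := ⟨m - 1, by omega⟩
  refine ⟨?_, ?_, ?_⟩
  · simp only [gpol, coeff_add, ipol_coeff e τ v hτ _ le_rfl, mul_add, coeff_mul_C, ← mul_assoc,
      coeff_mul_X, coeff_map, nodal_coeff_eq]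
    simp
  · simp only [gpol, coeff_add, ipol_coeff e τ v hτ _ (Nat.le_succ _), mul_add, coeff_mul_C,
      ← mul_assoc, coeff_mul_X, coeff_map, nodal_coeff_eq]
    rw [nodal_coeff_gt τ _ (by omega)]
    simp
  · intro j hj
    obtain ⟨j, rfl⟩ : ∃ r, j = r + 1 := ⟨j - 1, by omega⟩
    simp only [gpol, coeff_add, ipol_coeff e τ v hτ (j + 1) (by omega), mul_add, coeff_mul_C,
      ← mul_assoc, coeff_mul_X, coeff_map]
    rw [nodal_coeff_gt τ (j + 1) (by omega), nodal_coeff_gt τ j (by omega)]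
    simp

lemma eq_gpol [IsDomain R] (hm : 0 < m) (hτ : Function.Injective τ) (f : R[X])
    (hv : ∀ l, f.eval (e (τ l)) = v l) (ha : f.coeff m = a) (hb : f.coeff (m + 1) = b)
    (hj : ∀ j, m + 1 < j → f.coeff j = 0) : gpol e τ v a b = f := by
  obtain ⟨h1, h2, h3⟩ := gpol_coeff e τ v a b hm hτ
  apply Polynomial.eq_of_degree_sub_lt_of_eval_index_eq (s := Finset.univ)
    (v := fun l => e (τ l)) (fun x _ y _ h => hτ (e.injective h))
  · rw [Polynomial.degree_lt_iff_coeff_zero]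
    intro j hj'
    simp only [Finset.card_univ, Fintype.card_fin] at hj'
    rw [coeff_sub]
    rcases Nat.lt_or_ge (m + 1) j with h | h
    · rw [h3 j h, hj j h, sub_zero]
    · obtain rfl | rfl : j = m ∨ j = m + 1 := by omega
      · rw [h1, ha, sub_self]
      · rw [h2, hb, sub_self]
  · intro l _
    rw [gpol_eval e τ v a b hτ, hv]

end

lemma fsharp_map {k R : Type} [CommRing k] [CommRing R] (n : ℕ)
    (θ : MvPolynomial (Fin (n + 1)) k →+* R) (g : R[X]) (h : ∀ j, θ (MvPolynomial.X j) = g.coeff j)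
    (hg : ∀ j, n < j → g.coeff j = 0) : (fsharp k n).map θ = g := by
  have hd : g.natDegree < n + 1 := by
    rw [Nat.lt_succ_iff, natDegree_le_iff_coeff_eq_zero]
    exact hg
  rw [g.as_sum_range_C_mul_X_pow' hd, Finset.sum_range]
  simp [fsharp, Polynomial.map_sum, h]

lemma fsharp_coeff_s17 {k : Type} [CommRing k] (n : ℕ) (j : ℕ) :
    (fsharp k n).coeff j = if h : j < n + 1 then MvPolynomial.X ⟨j, h⟩ else 0 := by
  simp only [fsharp, finsetSum_coeff, coeff_C_mul_X_pow]
  split_ifs with h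
  · rw [Finset.sum_eq_single ⟨j, h⟩]
    · simp
    · intro i _ hi
      rw [if_neg]
      rintro rfl
      exact hi rfl
    · simp
  · apply Finset.sum_eq_zero
    intro i _
    rw [if_neg]
    have := i.2
    omega

lemma substF_map {k R : Type} [CommRing k] [CommRing R] (n : ℕ)
    (θ : MvPolynomial (Fin (n + 1)) k →+* R) (F : k[X][X]) :
    (substF n F).map θ =
      eval₂ (mapRingHom (θ.comp MvPolynomial.C)) ((fsharp k n).map θ) F := by
  rw [substF, eval_map, ← coe_mapRingHom, hom_eval₂, mapRingHom_comp]

lemma swap_comp {k E : Type} [Field k] [Field E] (e : k →+* E) (F : k[X][X]) (q : E[X][X]) :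
    Bivariate.swap ((F.map (mapRingHom e)).comp q) =
      eval₂ (mapRingHom ((C : E →+* E[X]).comp e)) (Bivariate.swap q) F := by
  rw [comp, eval₂_map]
  have := hom_eval₂ F (C.comp (mapRingHom e)) (Bivariate.swap (R := E) : E[X][X] →+* E[X][X]) q
  refine this.trans ?_
  congr 1
  ext x
  · simp [Bivariate.swap_C_C]
  · simp [Bivariate.swap_X]

lemma gpol_eq_swap {k E : Type} [Field k] [Field E] (e : k →+* E) {m : ℕ} (τ : Fin m → k)
    (v : Fin m → E) (b : E) :
    gpol (C.comp e) τ (fun l => C (v l)) X (C b) =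
      Bivariate.swap (C ((Lagrange.nodal Finset.univ τ).map e) * X + C (gpol e τ v 0 b)) := by
  have h : (gpol e τ v 0 b).map C = gpol (C.comp e) τ (fun l => C (v l)) 0 (C b) := by
    rw [gpol_map]; simp
  rw [map_add, map_mul, Bivariate.swap_Y, Bivariate.swap_C, Bivariate.swap_C, h]
  simp only [gpol, Polynomial.map_map, map_sub, map_zero]
  ring

lemma main_irr {k E : Type} [Field k] [IsAlgClosed k] [Field E] [IsAlgClosed E] (n m : ℕ)
    (e : k →+* E) (embK : MvPolynomial (Fin n) k →+* E)
    (hinj : Function.Injective embK) (he : e = embK.comp MvPolynomial.C)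
    (F : k[X][X]) (hF : Irreducible F) (hd : 0 < F.natDegree) (τ ξ : Fin m → k)
    (hτ : Function.Injective τ) (i : Fin m → Fin n) (b : E) :
    Irreducible (eval₂ (mapRingHom ((C : E →+* E[X]).comp e))
      (gpol (C.comp e) τ (fun l => C (embK (MvPolynomial.X (i l)) + e (ξ l))) X (C b)) F) := by
  rw [gpol_eq_swap, ← swap_comp]
  rw [MulEquiv.irreducible_iff]
  let : Algebra k E := e.toAlgebra
  apply irreducible_comp_affine
  · exact irreducible_baseChange (E := E) F hF hd
  · rwa [natDegree_map_eq_of_injective]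
    exact Polynomial.map_injective _ e.injective
  · rw [Polynomial.map_ne_zero_iff e.injective]
    exact Lagrange.nodal_ne_zero
  · intro θ hθ
    obtain ⟨l, rfl⟩ : ∃ l, θ = e (τ l) := by
      rw [Lagrange.nodal_eq, Polynomial.map_prod, eval_prod, Finset.prod_eq_zero_iff] at hθ
      obtain ⟨l, _, hl⟩ := hθ
      exact ⟨l, sub_eq_zero.1 (by simpa using hl)⟩
    rw [gpol_eval _ _ _ _ _ hτ]
    have hF0 := map_eval_ne_zero F (hF.isPrimitive hd.ne') (τ l)
    have h1 : (F.map (mapRingHom e)).map (evalRingHom (e (τ l))) =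
        (F.map (evalRingHom (τ l))).map e := by
      rw [Polynomial.map_map, Polynomial.map_map]
      congr 1
      ext x <;> simp
    rw [h1]
    generalize F.map (evalRingHom (τ l)) = q at hF0
    intro h0
    have h2 : embK (eval₂ MvPolynomial.C (MvPolynomial.X (i l) + MvPolynomial.C (ξ l)) q) = 0 := by
      rw [hom_eval₂, ← he, ← eval_map, ← h0, map_add, he]; rfl
    have h3 := (map_eq_zero_iff embK hinj).1 h2
    apply hF0
    have h4 := congrArg (MvPolynomial.eval₂Hom (C : k →+* k[X]) (fun _ => X - C (ξ l))) h3
    rw [hom_eval₂, map_zero] at h4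
    have h5 : (MvPolynomial.eval₂Hom (C : k →+* k[X]) (fun _ : Fin n => X - C (ξ l))).comp
      MvPolynomial.C = C := by ext x; simp
    rw [h5] at h4
    simpa using h4

/-- with `k = F̄_p`, `F₁ ∈ k[t][x]` irreducible, separable over `k(t)`,
`n ≥ 3`, pairwise distinct `τ_0,…,τ_{n−2} ∈ k` and arbitrary `ξ_0,…,ξ_{n−2} ∈ k`,
set `a_l' = f♯(τ_l) − ξ_l` and `K = k(a_0',…,a_{n−2}', a_n)`.  Then `F₁(t,f♯)`,
viewed (through the invertible change of coordinates
`(a_0,…,a_n) ↦ (a_0',…,a_{n−2}',a_{n−1},a_n)`, encoded by the substitution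
homomorphism `ψ`) as a polynomial in `K[t, a_{n−1}]`, is irreducible over the
algebraic closure of `K`. -/
theorem generic_substitution_irreducible_over_closure_of_intermediate_field
    (p : ℕ) [Fact (Nat.Prime p)] (n : ℕ) (hn : 3 ≤ n)
    (F₁ : Polynomial (Polynomial (AlgebraicClosure (ZMod p))))
    (hdegx : 0 < F₁.natDegree)
    (hirr : Irreducible F₁)
    (hsep : ∀ G : Polynomial (Polynomial (AlgebraicClosure (ZMod p))),
      F₁ ≠ G.comp (Polynomial.X ^ p))
    (τ ξ : Fin (n - 1) → AlgebraicClosure (ZMod p))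
    (hτ : Function.Injective τ) :
    let k := AlgebraicClosure (ZMod p)
    let B := MvPolynomial (Fin (n + 1)) k
    -- ψ sends `a_l ↦ a_l' = f♯(τ_l) − ξ_l` for `l ≤ n−2` and fixes `a_{n−1}, a_n`;
    -- it expresses the coordinates `(a'_·, a_{n−1}, a_n)` in terms of `(a_0,…,a_n)`.
    let ψ : B →+* B := (MvPolynomial.aeval (fun l : Fin (n + 1) =>
      if h : (l : ℕ) < n - 1 then
        (∑ j : Fin (n + 1),
          MvPolynomial.C (τ ⟨l, h⟩ ^ (j : ℕ)) * MvPolynomial.X j) -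
            MvPolynomial.C (ξ ⟨l, h⟩)
      else MvPolynomial.X l) : B →ₐ[k] B).toRingHom
    let K' := MvPolynomial (Fin n) k
    let Kf := FractionRing K'
    let Ω := AlgebraicClosure Kf
    let emb : k →+* Ω := (algebraMap Kf Ω).comp
      ((algebraMap K' Kf).comp (MvPolynomial.C))
    let embK : K' →+* Ω := (algebraMap Kf Ω).comp (algebraMap K' Kf)
    -- χ views an element of `k[a_0',…,a_{n−2}', a_{n−1}, a_n]` as a polynomial in the
    -- variable `a_{n−1}` with coefficients in `Ω ⊇ K = k(a_0',…,a_{n−2}', a_n)`.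
    let χ : B →+* Polynomial Ω := MvPolynomial.eval₂Hom
      ((Polynomial.C : Ω →+* Polynomial Ω).comp emb)
      (fun l : Fin (n + 1) =>
        if h : (l : ℕ) < n - 1 then
          Polynomial.C (embK (MvPolynomial.X (⟨(l : ℕ), by omega⟩ : Fin n)))
        else if (l : ℕ) = n - 1 then Polynomial.X
        else Polynomial.C (embK (MvPolynomial.X (⟨n - 1, by omega⟩ : Fin n))))
    (∃ Q : Polynomial B, Q.map ψ = substF n F₁) ∧
    ∀ Q : Polynomial B, Q.map ψ = substF n F₁ →
      Irreducible (Q.map χ) := by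
  intro k B ψ K' Kf Ω emb embK χ
  have hψC : ∀ x : k, ψ (MvPolynomial.C x) = MvPolynomial.C x := fun x =>
    MvPolynomial.algHom_C _ x
  have hψlt : ∀ l : Fin (n - 1), ψ (MvPolynomial.X ⟨l, by omega⟩) + MvPolynomial.C (ξ l) =
      (fsharp k n).eval (MvPolynomial.C (τ l)) := by
    intro l
    have : ψ (MvPolynomial.X ⟨l, by omega⟩) =
        (∑ j : Fin (n + 1), MvPolynomial.C (τ l ^ (j : ℕ)) * MvPolynomial.X j) -
            MvPolynomial.C (ξ l) := by
      refine (MvPolynomial.aeval_X _ _).trans ?_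
      exact dif_pos l.2
    rw [this, sub_add_cancel, fsharp, eval_finsetSum]
    refine Finset.sum_congr rfl fun j _ => ?_
    rw [eval_mul, eval_C, eval_pow, eval_X, map_pow, mul_comm]
  have hψge : ∀ l : Fin (n + 1), ¬ (l : ℕ) < n - 1 → ψ (MvPolynomial.X l) = MvPolynomial.X l := by
    intro l hl
    refine (MvPolynomial.aeval_X _ _).trans ?_
    exact dif_neg hl
  have hn1 : n - 1 + 1 = n := by omega
  let X1 : B := MvPolynomial.X ⟨n - 1, by omega⟩
  let X2 : B := MvPolynomial.X ⟨n, by omega⟩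
  let v : Fin (n - 1) → B := fun l => MvPolynomial.X ⟨l, by omega⟩ + MvPolynomial.C (ξ l)
  let g : Polynomial B := gpol MvPolynomial.C τ v X1 X2
  obtain ⟨hg1, hg2, hg3⟩ := gpol_coeff (MvPolynomial.C : k →+* B) τ v X1 X2 (by omega) hτ
  rw [hn1] at hg2 hg3
  let θ : B →+* B := MvPolynomial.eval₂Hom MvPolynomial.C (fun j => g.coeff j)
  have hθX : ∀ j, θ (MvPolynomial.X j) = g.coeff j := fun j => MvPolynomial.eval₂Hom_X' _ _ _
  have hθC : ∀ x : k, θ (MvPolynomial.C x) = MvPolynomial.C x := fun x =>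
    MvPolynomial.eval₂Hom_C _ _ _
  have hfθ : (fsharp k n).map θ = g := fsharp_map n θ g hθX hg3
  have hgψ : g.map ψ = fsharp k n := by
    have hc : ψ.comp MvPolynomial.C = (MvPolynomial.C : k →+* B) := RingHom.ext hψC
    rw [gpol_map, hc]
    apply eq_gpol _ _ _ _ _ (by omega) hτ
    · intro l
      rw [← hψlt l, map_add, hψC]
    · rw [fsharp_coeff_s17, dif_pos (by omega), hψge _ (by simp)]
    · rw [hn1, fsharp_coeff_s17, dif_pos (by omega), hψge _ (by simp)]
    · intro j hj
      rw [fsharp_coeff_s17, dif_neg (by omega)]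
  have hψθ : ψ.comp θ = RingHom.id B := by
    apply MvPolynomial.ringHom_ext
    · intro x
      simp only [RingHom.comp_apply, hθC, hψC]
      rfl
    · intro j
      simp only [RingHom.comp_apply, hθX]
      rw [← coeff_map, hgψ, fsharp_coeff_s17, dif_pos j.2]
      rfl
  have hθψ : θ.comp ψ = RingHom.id B := by
    apply MvPolynomial.ringHom_ext
    · intro x
      simp only [RingHom.comp_apply, hθC, hψC]
      rfl
    · intro j
      simp only [RingHom.comp_apply]
      by_cases hj : (j : ℕ) < n - 1
      · have h1 := congrArg θ (hψlt ⟨j, hj⟩)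
        rw [map_add, hθC, ← eval_map_apply, hfθ, hθC] at h1
        rw [gpol_eval _ _ _ _ _ hτ] at h1
        exact add_right_cancel h1
      · rw [hψge _ hj, hθX]
        obtain h | h : (j : ℕ) = n - 1 ∨ (j : ℕ) = n := by omega
        · rw [h]
          refine hg1.trans ?_
          exact congrArg MvPolynomial.X (Fin.ext h.symm)
        · rw [h]
          refine hg2.trans ?_
          exact congrArg MvPolynomial.X (Fin.ext h.symm)
  refine ⟨⟨(substF n F₁).map θ, ?_⟩, ?_⟩
  · rw [Polynomial.map_map, hψθ, Polynomial.map_id]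
  intro Q hQ
  have hQ' : Q = (substF n F₁).map θ := by
    rw [← hQ, Polynomial.map_map, hθψ, Polynomial.map_id]
  have hχC : ∀ x : k, χ (MvPolynomial.C x) = C (emb x) := fun x =>
    MvPolynomial.eval₂Hom_C _ _ _
  have hχθ : (χ.comp θ).comp MvPolynomial.C = (C : Ω →+* Polynomial Ω).comp emb := by
    ext1 x
    simp only [RingHom.comp_apply, hθC, hχC]
  have hχC' : χ.comp MvPolynomial.C = (C : Ω →+* Polynomial Ω).comp emb := by
    ext1 x
    simp only [RingHom.comp_apply, hχC]
  rw [hQ', Polynomial.map_map, substF_map, hχθ, ← Polynomial.map_map, hfθ, gpol_map, hχC']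
  have h1 : χ X1 = X := by
    refine (MvPolynomial.eval₂Hom_X' _ _ _).trans ?_
    simp
  have h2 : χ X2 = C (embK (MvPolynomial.X (⟨n - 1, by omega⟩ : Fin n))) := by
    refine (MvPolynomial.eval₂Hom_X' _ _ _).trans ?_
    have : ¬ n < n - 1 := by omega
    have : ¬ n = n - 1 := by omega
    simp [*]
  have h3 : (fun l => χ (v l)) = fun l : Fin (n - 1) =>
      C (embK (MvPolynomial.X (⟨l, by omega⟩ : Fin n)) + emb (ξ l)) := by
    funext l
    rw [map_add, hχC, map_add]
    congr 1
    refine (MvPolynomial.eval₂Hom_X' _ _ _).trans ?_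
    exact dif_pos l.2
  rw [h1, h2, h3]
  exact main_irr n (n - 1) emb embK
    ((algebraMap Kf Ω).injective.comp (IsFractionRing.injective K' Kf)) rfl F₁ hirr hdegx τ ξ hτ
    (fun l => ⟨l, by omega⟩) _
end
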